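/- Fix an integer d ≥ 3 such that either (1) d is prime, or (2) there exists a prime q dividing d−1 with gcd(d−1, v_q(d−1)) = 1, where v_q denotes the q-adic valuation. Assume the Vojta-type hypothesis: there exist real constants C₁ = C₁(d) and C₂ = C₂(d) such that for every f ∈ ℤ[x] of degree d with nonzero discriminant and all integers x, y with y² = f(x), one has log max(1,|x|) ≤ C₁·h(f) + C₂, where h(f) denotes the maximum of log|a| over the nonzero coefficients a of f. For c a positive integer let φ_{(d,c)}(x) = x^d − cd·x^{d−1} + c(d−1) ∈ ℤ[x], and let B_d be the set of positive integers c such that φ_{(d,c)}^n(x) is irreducible over ℚ for all n ≥ 1 and gcd(c, d−1) = 1. Then for all but finitely many c ∈ B_d, the extension K_n/K_{n−1} (for φ_{(d,c)}) is maximal for every n ≥ 1, i.e. Gal(K_n/K_{n−1}) has order (d!)^{d^{n−1}} for every n ≥ 1; equivalently, the arboreal Galois representation of φ_{(d,c)} over ℚ is surjective. -/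

import Mathlib

open Polynomial

noncomputable section

/-- The `n`-th iterate of a polynomial under composition: `polyIter φ 0 = X`,
`polyIter φ (n+1) = φ ∘ (polyIter φ n)`. -/
def polyIter {R : Type*} [CommRing R] (φ : Polynomial R) : ℕ → Polynomial R
  | 0 => X
  | n + 1 => φ.comp (polyIter φ n)

/-- The splitting field `K_n` of the `n`-th iterate of `φ ∈ ℤ[x]` over `ℚ`, inside a fixed
algebraic closure of `ℚ`. -/
def Kfield (φ : Polynomial ℤ) (n : ℕ) : IntermediateField ℚ (AlgebraicClosure ℚ) :=
  IntermediateField.adjoin ℚ ((polyIter φ n).rootSet (AlgebraicClosure ℚ))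

/-- The order of `Gal(K_n / K_{n-1})`: the number of automorphisms of `K_n` over `ℚ`
fixing every element of `K_{n-1}` pointwise. -/
def relGalCard (φ : Polynomial ℤ) (n : ℕ) : ℕ :=
  Nat.card {σ : Kfield φ n ≃ₐ[ℚ] Kfield φ n //
    ∀ (x : AlgebraicClosure ℚ) (_ : x ∈ Kfield φ (n - 1)) (hx' : x ∈ Kfield φ n),
      σ ⟨x, hx'⟩ = ⟨x, hx'⟩}

end

noncomputable section
/-- The (logarithmic) height of an integer polynomial: the maximum of `log |a|` over its
nonzero coefficients `a` (equivalently, `log` of the maximum of `|a|`). -/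
def intPolyHeight (f : Polynomial ℤ) : ℝ :=
  Real.log ((f.support.sup fun i => (f.coeff i).natAbs : ℕ) : ℝ)

/-- The polynomial `φ_{(d,c)}(x) = x^d - cd·x^{d-1} + c(d-1) ∈ ℤ[x]`. -/
def phiDC (d c : ℕ) : Polynomial ℤ :=
  X ^ d - C ((c : ℤ) * d) * X ^ (d - 1) + C ((c : ℤ) * ((d : ℤ) - 1))
end

/-- The product of `m` consecutive terms, starting with `u`, of an arithmetic progression of
common difference `3`. -/
def apProd (u m : ℕ) : ℕ := ∏ i ∈ Finset.range m, (u + 3 * i)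

theorem apProd_add (u m n : ℕ) : apProd u (m + n) = apProd u m * apProd (u + 3 * m) n := by
  simp only [apProd, Finset.prod_range_add]
  congr 1
  exact Finset.prod_congr rfl fun i _ => by ring

theorem apProd_pos {u : ℕ} (hu : 0 < u) (m : ℕ) : 0 < apProd u m :=
  Finset.prod_pos fun i _ => by omega

theorem apProd_three (m : ℕ) : apProd 3 m = 3 ^ m * m.factorial := by
  induction m with
  | zero => simp [apProd]
  | succ m ih =>
    have : apProd 3 (m + 1) = apProd 3 m * (3 + 3 * m) := by simp [apProd, Finset.prod_range_succ]
    rw [this, ih, Nat.factorial_succ]; ring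

theorem factorial_dvd_three_pow_mul_apProd (u m : ℕ) :
    m.factorial ∣ 3 ^ m * apProd u m := by
  obtain ⟨s, t, ht, hst⟩ := Nat.exists_eq_pow_mul_and_not_dvd m.factorial_ne_zero 3 (by norm_num)
  have hcop : Nat.Coprime 3 t := (Nat.Prime.coprime_iff_not_dvd Nat.prime_three).2 ht
  have hs : 3 ^ s ∣ 3 ^ m := by
    apply pow_dvd_pow
    have h1 : s ≤ padicValNat 3 m.factorial := by
      rw [← padicValNat_dvd_iff_le m.factorial_ne_zero, hst]
      exact Dvd.intro _ rfl
    have h2 := sub_one_mul_padicValNat_factorial (p := 3) m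
    omega
  have ht0 : t ≠ 0 := by rintro rfl; simp at ht
  have : NeZero t := ⟨ht0⟩
  have hdt : t ∣ 3 ^ m * apProd u m := by
    rw [← ZMod.natCast_eq_zero_iff]
    obtain ⟨b, hb⟩ : ∃ b : ℕ, ((3 * b : ℕ) : ZMod t) = u := by
      have := ZMod.coe_mul_inv_eq_one 3 hcop
      refine ⟨((3 : ZMod t)⁻¹ * u).val, ?_⟩
      push_cast [ZMod.natCast_zmod_val] at this ⊢
      linear_combination (u : ZMod t) * this
    have h1 : ((3 ^ m * apProd u m : ℕ) : ZMod t) =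
        ((3 ^ m * 3 ^ m * b.ascFactorial m : ℕ) : ZMod t) := by
      rw [Nat.ascFactorial_eq_prod_range, mul_assoc, apProd]
      have : 3 ^ m * ∏ i ∈ Finset.range m, (b + i) = ∏ i ∈ Finset.range m, (3 * b + 3 * i) := by
        rw [← Finset.card_range m, ← Finset.prod_const, Finset.card_range,
          ← Finset.prod_mul_distrib]
        exact Finset.prod_congr rfl fun i _ => by ring
      rw [this]
      push_cast
      congr 1
      refine Finset.prod_congr rfl fun i _ => ?_
      rw [← hb]; push_cast; ring
    rw [h1, ZMod.natCast_eq_zero_iff]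
    have : t ∣ m.factorial := hst ▸ Dvd.intro_left _ rfl
    exact this.trans ((Nat.factorial_dvd_ascFactorial b m).mul_left _)
  have := Nat.Coprime.mul_dvd_of_dvd_of_dvd (Nat.Coprime.pow_left s hcop)
    (hs.mul_right (apProd u m)) hdt
  rwa [← hst] at this

theorem apProd_le (u v m : ℕ) (h : u ≤ 3 * v) : apProd u m ≤ 3 ^ m * v.ascFactorial m := by
  rw [Nat.ascFactorial_eq_prod_range]
  calc apProd u m ≤ ∏ i ∈ Finset.range m, (3 * (v + i)) :=
        Finset.prod_le_prod' fun i _ => by omega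
    _ = _ := by rw [Finset.prod_mul_distrib, Finset.prod_const, Finset.card_range]

/-- The (integral) coefficients of the Padé approximants to the cube root. -/
def padeCoeff (k j : ℕ) : ℕ :=
  (3 ^ (k - j) * apProd (3 * j + 4) (k - j) / (k - j).factorial) *
    (3 ^ j * apProd (3 * (k - j) + 2) j / j.factorial)

theorem padeCoeff_mul (j m : ℕ) :
    padeCoeff (j + m) j * (m.factorial * j.factorial) =
      3 ^ (j + m) * (apProd (3 * j + 4) m * apProd (3 * m + 2) j) := by
  have h1 := Nat.div_mul_cancel (factorial_dvd_three_pow_mul_apProd (3 * j + 4) m)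
  have h2 := Nat.div_mul_cancel (factorial_dvd_three_pow_mul_apProd (3 * m + 2) j)
  simp only [padeCoeff, Nat.add_sub_cancel_left]
  calc _ = ((3 ^ m * apProd (3 * j + 4) m / m.factorial) * m.factorial) *
        ((3 ^ j * apProd (3 * m + 2) j / j.factorial) * j.factorial) := by ring
    _ = _ := by rw [h1, h2]; ring

theorem padeCoeff_le {k j : ℕ} (h : j ≤ k) : padeCoeff k j ≤ 4 * 36 ^ k := by
  obtain ⟨m, rfl⟩ := Nat.exists_eq_add_of_le h
  have key : ∀ u v m : ℕ, u ≤ 3 * (v + 1) →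
      3 ^ m * apProd u m / m.factorial ≤ 9 ^ m * 2 ^ (v + m) := by
    intro u v m huv
    apply Nat.div_le_of_le_mul
    calc 3 ^ m * apProd u m ≤ 3 ^ m * (3 ^ m * (v + 1).ascFactorial m) :=
          Nat.mul_le_mul_left _ (apProd_le u (v + 1) m huv)
      _ = m.factorial * (9 ^ m * (v + m).choose m) := by
          rw [Nat.ascFactorial_eq_factorial_mul_choose, show (9 : ℕ) = 3 * 3 from rfl, mul_pow]
          ring
      _ ≤ _ := by gcongr; exact Nat.choose_le_two_pow _ _
  have h1 := key (3 * j + 4) (j + 1) m (by omega)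
  have h2 := key (3 * m + 2) m j (by omega)
  simp only [padeCoeff, Nat.add_sub_cancel_left]
  calc _ ≤ _ := Nat.mul_le_mul h1 h2
    _ = 2 * (9 ^ (j + m) * (2 ^ (j + m) * 2 ^ (j + m))) := by ring
    _ = 2 * 36 ^ (j + m) := by rw [← mul_pow, ← mul_pow]; norm_num
    _ ≤ _ := by gcongr; norm_num

theorem prod_erase_range {M : Type*} [CommMonoid M] (f : ℕ → M) (j m : ℕ) :
    ∏ i ∈ (Finset.range (j + m + 1)).erase j, f i =
      (∏ i ∈ Finset.range j, f i) * ∏ i ∈ Finset.range m, f (j + 1 + i) := by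
  have : (Finset.range (j + m + 1)).erase j =
      Finset.range j ∪ (Finset.range m).image (fun i => j + 1 + i) := by
    ext i
    simp only [Finset.mem_erase, Finset.mem_range, Finset.mem_union, Finset.mem_image]
    constructor
    · rintro ⟨h1, h2⟩
      rcases lt_or_gt_of_ne h1 with h | h
      · exact Or.inl h
      · exact Or.inr ⟨i - (j + 1), by omega, by omega⟩
    · rintro (h | ⟨a, h, rfl⟩) <;> omega
  rw [this, Finset.prod_union, Finset.prod_image]
  · intro a _ b _ h; simpa using h
  · rw [Finset.disjoint_left]
    intro i hi hi'
    simp only [Finset.mem_range, Finset.mem_image] at hi hi'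
    obtain ⟨a, _, rfl⟩ := hi'
    omega

theorem prod_range_sub_three_mul (r : ℚ) (j : ℕ) :
    ∏ i ∈ Finset.range j, (3 * (j : ℚ) + r - 3 * i) =
      ∏ i ∈ Finset.range j, (3 + r + 3 * (i : ℚ)) := by
  induction j with
  | zero => simp
  | succ j ih =>
    rw [Finset.prod_range_succ', Finset.prod_range_succ, ← ih]
    push_cast
    congr 1
    · exact Finset.prod_congr rfl fun i _ => by ring
    · ring

theorem prod_neg_apProd (u m : ℕ) :
    ∏ i ∈ Finset.range m, (-((u : ℚ) + 3 * i)) = (-1) ^ m * apProd u m := by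
  rw [Finset.prod_neg, Finset.card_range, apProd]
  push_cast; rfl

/-- The nodes `3 * j + 1` and `3 * j`. -/
def padeNode : ℕ ⊕ ℕ → ℚ := Sum.elim (fun j => 3 * j + 1) (fun j => 3 * j)

theorem padeNode_injective : Function.Injective padeNode := by
  rintro (a | a) (b | b) h <;> simp only [padeNode, Sum.elim_inl, Sum.elim_inr] at h
  · congr 1; have : (a : ℚ) = b := by linarith
    exact_mod_cast this
  · exfalso; have : 3 * a + 1 = 3 * b := by exact_mod_cast h
    omega
  · exfalso; have : 3 * a = 3 * b + 1 := by exact_mod_cast h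
    omega
  · congr 1; have : (a : ℚ) = b := by linarith
    exact_mod_cast this

/-- The normalising constant relating `padeCoeff` to nodal weights. -/
def padeScale (k : ℕ) : ℚ := 9 ^ k * (apProd 1 (k + 1) * apProd 2 k)

theorem erase_disjSum_inl {α β : Type*} [DecidableEq α] [DecidableEq β] (s : Finset α)
    (t : Finset β) (a : α) : (s.disjSum t).erase (Sum.inl a) = (s.erase a).disjSum t := by
  ext (x | x) <;> simp

theorem erase_disjSum_inr {α β : Type*} [DecidableEq α] [DecidableEq β] (s : Finset α)
    (t : Finset β) (b : β) : (s.disjSum t).erase (Sum.inr b) = s.disjSum (t.erase b) := by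
  ext (x | x) <;> simp

theorem prod_erase_inl (j m : ℕ) :
    padeCoeff (j + m) j * ∏ i ∈ ((Finset.range (j + m + 1)).disjSum
      (Finset.range (j + m + 1))).erase (Sum.inl j), (padeNode (Sum.inl j) - padeNode i) =
      padeScale (j + m) := by
  rw [erase_disjSum_inl, Finset.prod_disjSum, prod_erase_range,
    show j + m + 1 = j + 1 + m by ring, Finset.prod_range_add]
  simp only [padeNode, Sum.elim_inl, Sum.elim_inr]
  have e1 : ∏ i ∈ Finset.range j, (3 * (j : ℚ) + 1 - (3 * i + 1)) = 3 ^ j * j.factorial := by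
    have := prod_range_sub_three_mul 0 j
    have h3 := apProd_three j
    rw [apProd] at h3
    calc _ = ∏ i ∈ Finset.range j, (3 * (j : ℚ) + 0 - 3 * i) :=
          Finset.prod_congr rfl fun i _ => by ring
      _ = _ := by rw [this]; simp only [add_zero]; exact_mod_cast h3
  have e2 : ∏ i ∈ Finset.range m, (3 * (j : ℚ) + 1 - (3 * ((j + 1 + i : ℕ) : ℚ) + 1)) =
      (-1) ^ m * (3 ^ m * m.factorial) := by
    have h3 : (3 ^ m * m.factorial : ℚ) = apProd 3 m := by rw [apProd_three]; push_cast; rfl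
    rw [h3, ← prod_neg_apProd]
    exact Finset.prod_congr rfl fun i _ => by push_cast; ring
  have e3 : ∏ i ∈ Finset.range (j + 1), (3 * (j : ℚ) + 1 - 3 * i) = apProd 1 (j + 1) := by
    have := prod_range_sub_three_mul (-2) (j + 1)
    rw [apProd]; push_cast at this ⊢
    convert this using 2
    · ring
    · ring
  have e4 : ∏ i ∈ Finset.range m, (3 * (j : ℚ) + 1 - 3 * ((j + 1 + i : ℕ) : ℚ)) =
      (-1) ^ m * apProd 2 m := by
    rw [← prod_neg_apProd]
    exact Finset.prod_congr rfl fun i _ => by push_cast; ring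
  rw [e1, e2, e3, e4]
  have h := padeCoeff_mul j m
  have h' : (padeCoeff (j + m) j : ℚ) * (m.factorial * j.factorial) =
      3 ^ (j + m) * (apProd (3 * j + 4) m * apProd (3 * m + 2) j) := by exact_mod_cast h
  have s1 : (apProd 1 (j + m + 1) : ℚ) = apProd 1 (j + 1) * apProd (3 * j + 4) m := by
    rw [show j + m + 1 = (j + 1) + m by ring, apProd_add]; push_cast
    congr 3; ring
  have s2 : (apProd 2 (j + m) : ℚ) = apProd 2 m * apProd (3 * m + 2) j := by
    rw [add_comm j m, apProd_add]; push_cast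
    congr 3; ring
  have s3 : ((-1 : ℚ) ^ m) ^ 2 = 1 := by rw [← pow_mul, mul_comm, pow_mul]; norm_num
  rw [padeScale, s1, s2, show (9 : ℚ) = 3 * 3 by norm_num, mul_pow]
  linear_combination ((-1 : ℚ) ^ m) ^ 2 * (3 ^ j * 3 ^ m * apProd 1 (j + 1) * apProd 2 m) * h' +
    (3 ^ (j + m) * 3 ^ j * 3 ^ m * apProd 1 (j + 1) * apProd 2 m *
      (apProd (3 * j + 4) m * apProd (3 * m + 2) j)) * s3

theorem prod_erase_inr (j m : ℕ) :
    padeCoeff (j + m) m * ∏ i ∈ ((Finset.range (j + m + 1)).disjSum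
      (Finset.range (j + m + 1))).erase (Sum.inr j), (padeNode (Sum.inr j) - padeNode i) =
      - padeScale (j + m) := by
  rw [erase_disjSum_inr, Finset.prod_disjSum, prod_erase_range,
    show j + m + 1 = j + (m + 1) by ring, Finset.prod_range_add]
  simp only [padeNode, Sum.elim_inl, Sum.elim_inr]
  have e1 : ∏ i ∈ Finset.range j, (3 * (j : ℚ) - 3 * i) = 3 ^ j * j.factorial := by
    have := prod_range_sub_three_mul 0 j
    have h3 := apProd_three j
    rw [apProd] at h3
    simp only [add_zero] at this
    rw [this]; exact_mod_cast h3
  have e2 : ∏ i ∈ Finset.range m, (3 * (j : ℚ) - 3 * ((j + 1 + i : ℕ) : ℚ)) =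
      (-1) ^ m * (3 ^ m * m.factorial) := by
    have h3 : (3 ^ m * m.factorial : ℚ) = apProd 3 m := by rw [apProd_three]; push_cast; rfl
    rw [h3, ← prod_neg_apProd]
    exact Finset.prod_congr rfl fun i _ => by push_cast; ring
  have e3 : ∏ i ∈ Finset.range j, (3 * (j : ℚ) - (3 * i + 1)) = apProd 2 j := by
    have := prod_range_sub_three_mul (-1) j
    rw [apProd]; push_cast at this ⊢
    convert this using 2
    · ring
    · ring
  have e4 : ∏ i ∈ Finset.range (m + 1), (3 * (j : ℚ) - (3 * ((j + i : ℕ) : ℚ) + 1)) =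
      (-1) ^ (m + 1) * apProd 1 (m + 1) := by
    rw [← prod_neg_apProd]
    exact Finset.prod_congr rfl fun i _ => by push_cast; ring
  rw [e1, e2, e3, e4]
  have h := padeCoeff_mul m j
  have h' : (padeCoeff (j + m) m : ℚ) * (j.factorial * m.factorial) =
      3 ^ (j + m) * (apProd (3 * m + 4) j * apProd (3 * j + 2) m) := by
    rw [add_comm j m]; exact_mod_cast h
  have s1 : (apProd 1 (j + m + 1) : ℚ) = apProd 1 (m + 1) * apProd (3 * m + 4) j := by
    rw [show j + m + 1 = (m + 1) + j by ring, apProd_add]; push_cast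
    congr 3; ring
  have s2 : (apProd 2 (j + m) : ℚ) = apProd 2 j * apProd (3 * j + 2) m := by
    rw [apProd_add]; push_cast
    congr 3; ring
  have s3 : ((-1 : ℚ) ^ m) ^ 2 = 1 := by rw [← pow_mul, mul_comm, pow_mul]; norm_num
  rw [padeScale, s1, s2, show (9 : ℚ) = 3 * 3 by norm_num, mul_pow]
  linear_combination -((-1 : ℚ) ^ m) ^ 2 * (3 ^ j * 3 ^ m * apProd 1 (m + 1) * apProd 2 j) * h' -
    (3 ^ (j + m) * 3 ^ j * 3 ^ m * apProd 1 (m + 1) * apProd 2 j *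
      (apProd (3 * m + 4) j * apProd (3 * j + 2) m)) * s3

/-- The coefficients `padeCoeff` annihilate polynomials of low degree. -/
theorem sum_padeCoeff_eval (k : ℕ) (P : ℚ[X]) (hP : P.natDegree ≤ 2 * k) :
    ∑ j ∈ Finset.range (k + 1), (padeCoeff k j : ℚ) * P.eval (3 * (j : ℚ) + 1) =
      ∑ j ∈ Finset.range (k + 1), (padeCoeff k (k - j) : ℚ) * P.eval (3 * (j : ℚ)) := by
  set s := (Finset.range (k + 1)).disjSum (Finset.range (k + 1))
  have hcard : s.card = 2 * k + 2 := by simp [s, Finset.card_disjSum]; ring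
  have hdeg : P.degree < s.card := by
    rw [hcard]
    refine lt_of_le_of_lt (degree_le_natDegree) ?_
    exact_mod_cast (by omega : P.natDegree < 2 * k + 2)
  have h := Lagrange.coeff_eq_sum (s := s) (v := padeNode) padeNode_injective.injOn hdeg
  rw [coeff_eq_zero_of_natDegree_lt (by omega), Finset.sum_disjSum] at h
  have hS : padeScale k ≠ 0 := by
    have := apProd_pos (u := 1) (by norm_num) (k + 1)
    have := apProd_pos (u := 2) (by norm_num) k
    unfold padeScale; positivity
  have hne : ∀ i ∈ s, ∏ j ∈ s.erase i, (padeNode i - padeNode j) ≠ 0 := fun i _ =>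
    Finset.prod_ne_zero_iff.2 fun j hj => sub_ne_zero.2 fun he =>
      (Finset.mem_erase.1 hj).1 (padeNode_injective he).symm
  rw [← sub_eq_zero, ← mul_zero (padeScale k), h, mul_add, Finset.mul_sum, Finset.mul_sum,
    sub_eq_add_neg, ← Finset.sum_neg_distrib]
  congr 1
  · refine Finset.sum_congr rfl fun j hj => ?_
    obtain ⟨m, rfl⟩ := Nat.exists_eq_add_of_le (Nat.lt_succ_iff.1 (Finset.mem_range.1 hj))
    have := prod_erase_inl j m
    have hn := hne (Sum.inl j) (by simp [s])
    simp only [s] at hn ⊢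
    rw [← this, mul_assoc, mul_div_cancel₀ _ hn]; rfl
  · refine Finset.sum_congr rfl fun j hj => ?_
    obtain ⟨m, rfl⟩ := Nat.exists_eq_add_of_le (Nat.lt_succ_iff.1 (Finset.mem_range.1 hj))
    have := prod_erase_inr j m
    have hn := hne (Sum.inr j) (by simp [s])
    simp only [s] at hn ⊢
    rw [← neg_neg (padeScale (j + m)), ← this, neg_mul, mul_assoc, mul_div_cancel₀ _ hn,
      Nat.add_sub_cancel_left]; rfl

/-- The homogeneous Padé form of degree `k`. -/
def padeForm {R : Type*} [CommRing R] (k : ℕ) (x y : R) : R :=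
  ∑ j ∈ Finset.range (k + 1), (padeCoeff k j : R) * (x ^ j * y ^ (k - j))

/-- The Taylor coefficients at `1` of `x * padeForm k (x ^ 3) 1 - padeForm k 1 (x ^ 3)`. -/
def padeTaylor (k r : ℕ) : ℤ :=
  ∑ j ∈ Finset.range (k + 1), ((padeCoeff k j * (3 * j + 1).choose r : ℕ) : ℤ) -
    ∑ j ∈ Finset.range (k + 1), ((padeCoeff k (k - j) * (3 * j).choose r : ℕ) : ℤ)

theorem map_padeForm {R S : Type*} [CommRing R] [CommRing S] (f : R →+* S) (k : ℕ) (x y : R) :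
    f (padeForm k x y) = padeForm k (f x) (f y) := by
  simp [padeForm]

theorem padeForm_mul {R : Type*} [CommRing R] (k : ℕ) (c x y : R) :
    padeForm k (c * x) (c * y) = c ^ k * padeForm k x y := by
  simp only [padeForm, Finset.mul_sum]
  refine Finset.sum_congr rfl fun j hj => ?_
  have : k = j + (k - j) := by have := Finset.mem_range.1 hj; omega
  conv_rhs => rw [this, pow_add, ← this]
  ring

theorem padeTaylor_eq_zero {k r : ℕ} (hr : r ≤ 2 * k) : padeTaylor k r = 0 := by
  have h := sum_padeCoeff_eval k (descPochhammer ℚ r) (by rwa [descPochhammer_natDegree])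
  have hr0 : (r.factorial : ℚ) ≠ 0 := by exact_mod_cast r.factorial_ne_zero
  have e (n : ℕ) : (descPochhammer ℚ r).eval (n : ℚ) = r.factorial * n.choose r := by
    rw [descPochhammer_eval_eq_descFactorial, Nat.descFactorial_eq_factorial_mul_choose]
    push_cast; rfl
  have e1 (j : ℕ) := e (3 * j + 1)
  have e2 (j : ℕ) := e (3 * j)
  push_cast at e1 e2
  simp only [e1, e2, mul_left_comm _ (r.factorial : ℚ), ← Finset.mul_sum] at h
  have h := mul_left_cancel₀ hr0 h
  rw [padeTaylor, sub_eq_zero]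
  exact_mod_cast h

theorem one_add_pow_eq_sum {R : Type*} [CommRing R] (δ : R) {e N : ℕ} (h : e < N) :
    (1 + δ) ^ e = ∑ r ∈ Finset.range N, (e.choose r : R) * δ ^ r := by
  rw [add_comm, add_pow]
  refine (Finset.sum_subset (Finset.range_mono h) fun r _ hr => ?_).trans
    (Finset.sum_congr rfl fun r _ => ?_)
  · rw [Nat.choose_eq_zero_of_lt (by simpa using hr)]; simp
  · simp [mul_comm]

theorem pade_remainder {R : Type*} [CommRing R] (k : ℕ) (δ : R) :
    (1 + δ) * padeForm k ((1 + δ) ^ 3) 1 - padeForm k 1 ((1 + δ) ^ 3) =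
      ∑ r ∈ Finset.range (3 * k + 2), (padeTaylor k r : R) * δ ^ r := by
  have h1 : (1 + δ) * padeForm k ((1 + δ) ^ 3) 1 = ∑ r ∈ Finset.range (3 * k + 2),
      ∑ j ∈ Finset.range (k + 1), (padeCoeff k j : R) * ((3 * j + 1).choose r) * δ ^ r := by
    rw [Finset.sum_comm, padeForm, Finset.mul_sum]
    refine Finset.sum_congr rfl fun j hj => ?_
    have := Finset.mem_range.1 hj
    simp_rw [mul_assoc, ← Finset.mul_sum]
    rw [← one_add_pow_eq_sum δ (show 3 * j + 1 < 3 * k + 2 by omega), ← pow_mul]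
    ring
  have h2 : padeForm k 1 ((1 + δ) ^ 3) = ∑ r ∈ Finset.range (3 * k + 2),
      ∑ j ∈ Finset.range (k + 1), (padeCoeff k (k - j) : R) * ((3 * j).choose r) * δ ^ r := by
    rw [Finset.sum_comm, padeForm, ← Finset.sum_range_reflect]
    refine Finset.sum_congr rfl fun j hj => ?_
    have := Finset.mem_range.1 hj
    simp_rw [mul_assoc, ← Finset.mul_sum]
    rw [← one_add_pow_eq_sum δ (show 3 * j < 3 * k + 2 by omega),
      show k + 1 - 1 - j = k - j by omega, show k - (k - j) = j by omega, ← pow_mul]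
    ring
  rw [h1, h2, ← Finset.sum_sub_distrib]
  refine Finset.sum_congr rfl fun r _ => ?_
  rw [padeTaylor]
  push_cast
  rw [sub_mul, Finset.sum_mul, Finset.sum_mul]

theorem norm_padeForm_le (k : ℕ) (x y : ℂ) {B : ℝ} (hx : ‖x‖ ≤ B) (hy : ‖y‖ ≤ B) :
    ‖padeForm k x y‖ ≤ 576 ^ (k + 1) * B ^ k := by
  have hB : 0 ≤ B := (norm_nonneg _).trans hx
  have hk : ((k + 1 : ℕ) : ℝ) ≤ 2 ^ k := by
    exact_mod_cast Nat.lt_two_pow_self (n := k)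
  calc ‖padeForm k x y‖ ≤ ∑ j ∈ Finset.range (k + 1), (4 * 36 ^ k * B ^ k : ℝ) := by
        refine norm_sum_le_of_le _ fun j hj => ?_
        have hj := Nat.lt_succ_iff.1 (Finset.mem_range.1 hj)
        rw [norm_mul, norm_mul, norm_pow, norm_pow, Complex.norm_natCast]
        have h1 : (padeCoeff k j : ℝ) ≤ 4 * 36 ^ k := by exact_mod_cast padeCoeff_le hj
        have h2 : ‖x‖ ^ j * ‖y‖ ^ (k - j) ≤ B ^ k := by
          calc _ ≤ B ^ j * B ^ (k - j) := by gcongr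
            _ = B ^ k := by rw [← pow_add]; congr 1; omega
        gcongr
    _ = (k + 1 : ℕ) * (4 * 36 ^ k * B ^ k) := by
        rw [Finset.sum_const, Finset.card_range, nsmul_eq_mul]
    _ ≤ 2 ^ k * (4 * 36 ^ k * B ^ k) := by gcongr
    _ = 4 * (2 * 36) ^ k * B ^ k := by rw [mul_pow]; ring
    _ ≤ 576 * 576 ^ k * B ^ k := by gcongr <;> norm_num
    _ = _ := by ring

theorem sum_norm_padeTaylor_le (k : ℕ) :
    ∑ r ∈ Finset.range (3 * k + 2), ‖(padeTaylor k r : ℂ)‖ ≤ 576 ^ (k + 1) := by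
  have hch : ∀ e < 3 * k + 2, ∑ r ∈ Finset.range (3 * k + 2), (e.choose r : ℝ) ≤ 2 * 8 ^ k := by
    intro e he
    have := one_add_pow_eq_sum (1 : ℝ) he
    simp only [one_pow, mul_one] at this
    rw [← this]
    calc ((1 : ℝ) + 1) ^ e ≤ (1 + 1) ^ (3 * k + 1) :=
          pow_le_pow_right₀ (by norm_num) (by omega)
      _ = 2 * 8 ^ k := by rw [pow_succ, pow_mul]; norm_num; ring
  have hk : ((k + 1 : ℕ) : ℝ) ≤ 2 ^ k := by
    exact_mod_cast Nat.lt_two_pow_self (n := k)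
  have h1 : ∀ r, ‖(padeTaylor k r : ℂ)‖ ≤
      ∑ j ∈ Finset.range (k + 1), (4 * 36 ^ k : ℝ) * ((3 * j + 1).choose r : ℝ) +
      ∑ j ∈ Finset.range (k + 1), (4 * 36 ^ k : ℝ) * ((3 * j).choose r : ℝ) := by
    intro r
    rw [padeTaylor]
    push_cast
    refine (norm_sub_le _ _).trans (add_le_add ?_ ?_)
    · refine norm_sum_le_of_le _ fun j hj => ?_
      have hj := Nat.lt_succ_iff.1 (Finset.mem_range.1 hj)
      rw [norm_mul, Complex.norm_natCast, Complex.norm_natCast]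
      gcongr
      exact_mod_cast padeCoeff_le hj
    · refine norm_sum_le_of_le _ fun j hj => ?_
      rw [norm_mul, Complex.norm_natCast, Complex.norm_natCast]
      gcongr
      exact_mod_cast padeCoeff_le (Nat.sub_le k j)
  have h2 : ∀ f : ℕ → ℕ, (∀ j ≤ k, f j < 3 * k + 2) →
      ∑ r ∈ Finset.range (3 * k + 2), ∑ j ∈ Finset.range (k + 1),
        (4 * 36 ^ k : ℝ) * ((f j).choose r : ℝ) ≤ 8 * 576 ^ k := by
    intro f hf
    rw [Finset.sum_comm]
    calc _ ≤ ∑ j ∈ Finset.range (k + 1), (4 * 36 ^ k : ℝ) * (2 * 8 ^ k) := by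
          refine Finset.sum_le_sum fun j hj => ?_
          have hj := Nat.lt_succ_iff.1 (Finset.mem_range.1 hj)
          rw [← Finset.mul_sum]
          gcongr
          exact hch _ (hf j hj)
      _ = (k + 1 : ℕ) * (4 * 36 ^ k * (2 * 8 ^ k)) := by
          rw [Finset.sum_const, Finset.card_range, nsmul_eq_mul]
      _ ≤ 2 ^ k * (4 * 36 ^ k * (2 * 8 ^ k)) := by gcongr
      _ = 8 * (2 * 36 * 8) ^ k := by rw [mul_pow, mul_pow]; ring
      _ = _ := by norm_num
  calc _ ≤ _ := Finset.sum_le_sum fun r _ => h1 r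
    _ ≤ 8 * 576 ^ k + 8 * 576 ^ k := by
        rw [Finset.sum_add_distrib]
        exact add_le_add (h2 _ fun j hj => by omega) (h2 _ fun j hj => by omega)
    _ = 16 * 576 ^ k := by ring
    _ ≤ 576 * 576 ^ k := by gcongr; norm_num
    _ = _ := by ring

/-- The Padé forms approximate the ratio of cube roots. -/
theorem norm_pade_approx_le (k : ℕ) (x y : ℂ) (hxy : ‖x - y‖ ≤ ‖y‖) :
    ‖x * padeForm k (x ^ 3) (y ^ 3) - y * padeForm k (y ^ 3) (x ^ 3)‖ ≤
      576 ^ (k + 1) * (‖x - y‖ ^ (2 * k + 1) * ‖y‖ ^ k) := by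
  by_cases hy : y = 0
  · subst hy
    have : x = 0 := by simpa using hxy
    subst this
    simp only [zero_mul, sub_self, norm_zero]; positivity
  set δ := (x - y) / y with hδ
  have hx : x = y * (1 + δ) := by rw [hδ]; field_simp; ring
  have hδ1 : ‖δ‖ ≤ 1 := by
    rw [hδ, norm_div]; exact div_le_one_of_le₀ hxy (norm_nonneg _)
  have h1 : x * padeForm k (x ^ 3) (y ^ 3) - y * padeForm k (y ^ 3) (x ^ 3) =
      y ^ (3 * k + 1) * ∑ r ∈ Finset.range (3 * k + 2), (padeTaylor k r : ℂ) * δ ^ r := by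
    rw [← pade_remainder, hx, mul_pow]
    conv_lhs => rw [show padeForm k (y ^ 3 * (1 + δ) ^ 3) (y ^ 3) =
      padeForm k (y ^ 3 * (1 + δ) ^ 3) (y ^ 3 * 1) by rw [mul_one], padeForm_mul,
      show padeForm k (y ^ 3) (y ^ 3 * (1 + δ) ^ 3) =
      padeForm k (y ^ 3 * 1) (y ^ 3 * (1 + δ) ^ 3) by rw [mul_one], padeForm_mul]
    ring
  have h2 : ‖∑ r ∈ Finset.range (3 * k + 2), (padeTaylor k r : ℂ) * δ ^ r‖ ≤
      576 ^ (k + 1) * ‖δ‖ ^ (2 * k + 1) := by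
    calc _ ≤ ∑ r ∈ Finset.range (3 * k + 2), ‖(padeTaylor k r : ℂ)‖ * ‖δ‖ ^ (2 * k + 1) := by
          refine norm_sum_le_of_le _ fun r _ => ?_
          rw [norm_mul, norm_pow]
          rcases Nat.lt_or_ge (2 * k) r with h | h
          · exact mul_le_mul_of_nonneg_left (pow_le_pow_of_le_one (norm_nonneg _) hδ1 h)
              (norm_nonneg _)
          · rw [padeTaylor_eq_zero h]; simp
      _ ≤ _ := by
          rw [← Finset.sum_mul]
          gcongr
          exact sum_norm_padeTaylor_le k
  rw [h1, norm_mul, norm_pow]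
  calc _ ≤ ‖y‖ ^ (3 * k + 1) * (576 ^ (k + 1) * ‖δ‖ ^ (2 * k + 1)) := by gcongr
    _ = 576 ^ (k + 1) * ((‖δ‖ * ‖y‖) ^ (2 * k + 1) * ‖y‖ ^ k) := by rw [mul_pow]; ring
    _ = _ := by rw [← norm_mul, hδ, div_mul_cancel₀ _ hy]

theorem X_sub_one_pow_dvd_pade (k : ℕ) :
    ((X : ℚ[X]) - 1) ^ (2 * k + 1) ∣ X * padeForm k (X ^ 3) 1 - padeForm k 1 (X ^ 3) := by
  have h := pade_remainder k ((X : ℚ[X]) - 1)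
  rw [add_sub_cancel] at h
  rw [h]
  refine Finset.dvd_sum fun r _ => ?_
  rcases Nat.lt_or_ge (2 * k) r with hr | hr
  · exact (pow_dvd_pow _ hr).mul_left _
  · rw [padeTaylor_eq_zero hr]; simp

/-- The determinant of two consecutive pairs of Padé approximants. -/
def padeDet {R : Type*} [CommRing R] (k : ℕ) (x y : R) : R :=
  padeForm k x y * padeForm (k + 1) y x - padeForm (k + 1) x y * padeForm k y x

theorem X_sub_one_pow_dvd_of_comp {E : ℚ[X]} {n : ℕ}
    (h : ((X : ℚ[X]) - 1) ^ n ∣ E.comp (X ^ 3)) : ((X : ℚ[X]) - 1) ^ n ∣ E := by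
  rcases eq_or_ne E 0 with rfl | hE
  · exact dvd_zero _
  obtain ⟨F, hF, hF1⟩ := E.exists_eq_pow_rootMultiplicity_mul_and_not_dvd hE 1
  set m := E.rootMultiplicity 1
  rw [map_one] at hF hF1
  have hprime : Prime ((X : ℚ[X]) - 1) := by simpa using prime_X_sub_C (1 : ℚ)
  have e3 : ((X : ℚ[X]) ^ 3 - 1) = (X - 1) * (X ^ 2 + X + 1) := by ring
  have h1 : E.comp (X ^ 3) = (X - 1) ^ m * ((X ^ 2 + X + 1) ^ m * F.comp (X ^ 3)) := by
    conv_lhs => rw [hF]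
    simp only [mul_comp, pow_comp, sub_comp, X_comp, one_comp, e3, mul_pow, mul_assoc]
  have h2 : ¬ (X - 1 : ℚ[X]) ∣ (X ^ 2 + X + 1) ^ m * F.comp (X ^ 3) := by
    have key (P : ℚ[X]) : (X - 1 : ℚ[X]) ∣ P ↔ P.eval 1 = 0 := by
      have := dvd_iff_isRoot (p := P) (a := 1)
      simpa using this
    rw [key] at hF1 ⊢
    simp only [eval_mul, eval_pow, eval_add, eval_X, eval_one, eval_comp]
    norm_num
    exact hF1
  have h3 : n ≤ m := by
    by_contra hlt
    push Not at hlt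
    have h4 : (X - 1 : ℚ[X]) ^ (m + 1) ∣ (X - 1) ^ m * ((X ^ 2 + X + 1) ^ m * F.comp (X ^ 3)) :=
      h1 ▸ (pow_dvd_pow _ hlt).trans h
    rw [pow_succ] at h4
    exact h2 ((mul_dvd_mul_iff_left (pow_ne_zero _ hprime.ne_zero)).1 h4)
  rw [hF]
  exact (pow_dvd_pow _ h3).mul_right _

theorem X_sub_one_pow_dvd_padeDet (k : ℕ) :
    ((X : ℚ[X]) - 1) ^ (2 * k + 1) ∣ padeDet k X 1 := by
  apply X_sub_one_pow_dvd_of_comp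
  have h : (padeDet k (X : ℚ[X]) 1).comp (X ^ 3) = padeDet k (X ^ 3) 1 := by
    have e (m : ℕ) (x y : ℚ[X]) : (padeForm m x y).comp (X ^ 3) =
        padeForm m (x.comp (X ^ 3)) (y.comp (X ^ 3)) :=
      map_padeForm (compRingHom (X ^ 3)) m x y
    simp only [padeDet, sub_comp, mul_comp, e, X_comp, one_comp]
  rw [h]
  have h0 := X_sub_one_pow_dvd_pade k
  have h1 := (pow_dvd_pow ((X : ℚ[X]) - 1) (show 2 * k + 1 ≤ 2 * (k + 1) + 1 by omega)).trans
    (X_sub_one_pow_dvd_pade (k + 1))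
  have := dvd_sub (h0.mul_left (padeForm (k + 1) (X ^ 3) 1)) (h1.mul_left (padeForm k (X ^ 3) 1))
  convert this using 1
  rw [padeDet]; ring

theorem coeff_padeForm_X_one (k j : ℕ) (hj : j ≤ k) :
    (padeForm k (X : ℚ[X]) 1).coeff j = padeCoeff k j := by
  simp only [padeForm, one_pow, mul_one, finsetSum_coeff, coeff_natCast_mul, coeff_X_pow]
  rw [Finset.sum_eq_single j]
  · simp
  · intro b _ hb; simp [hb.symm]
  · intro h; simp at h; omega

theorem padeForm_one_X (k : ℕ) : padeForm k (1 : ℚ[X]) X =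
    ∑ j ∈ Finset.range (k + 1), (padeCoeff k (k - j) : ℚ[X]) * X ^ j := by
  rw [padeForm, ← Finset.sum_range_reflect]
  refine Finset.sum_congr rfl fun j hj => ?_
  have := Finset.mem_range.1 hj
  rw [show k + 1 - 1 - j = k - j by omega, show k - (k - j) = j by omega]
  simp

theorem coeff_padeForm_one_X (k j : ℕ) (hj : j ≤ k) :
    (padeForm k (1 : ℚ[X]) X).coeff j = padeCoeff k (k - j) := by
  simp only [padeForm_one_X, finsetSum_coeff, coeff_natCast_mul, coeff_X_pow]
  rw [Finset.sum_eq_single j]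
  · simp
  · intro b _ hb; simp [hb.symm]
  · intro h; simp at h; omega

theorem natDegree_padeForm_X_one (k : ℕ) : (padeForm k (X : ℚ[X]) 1).natDegree ≤ k := by
  refine natDegree_sum_le_of_forall_le _ _ fun j hj => ?_
  have := Finset.mem_range.1 hj
  rw [one_pow, mul_one]
  refine natDegree_mul_le.trans ?_
  simp; omega

theorem natDegree_padeForm_one_X (k : ℕ) : (padeForm k (1 : ℚ[X]) X).natDegree ≤ k := by
  rw [padeForm_one_X]
  refine natDegree_sum_le_of_forall_le _ _ fun j hj => ?_
  have := Finset.mem_range.1 hj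
  refine natDegree_mul_le.trans ?_
  simp; omega

theorem padeCoeff_zero (k : ℕ) : padeCoeff k 0 * k.factorial = 3 ^ k * apProd 4 k := by
  have := padeCoeff_mul 0 k
  simpa [apProd] using this

theorem padeCoeff_self (k : ℕ) : padeCoeff k k * k.factorial = 3 ^ k * apProd 2 k := by
  have := padeCoeff_mul k 0
  simpa [apProd] using this

theorem padeDet_coeff_ne_zero (k : ℕ) : (padeDet k (X : ℚ[X]) 1).coeff (2 * k + 1) ≠ 0 := by
  have e1 : (padeForm k (X : ℚ[X]) 1 * padeForm (k + 1) 1 X).coeff (k + (k + 1)) =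
      (padeCoeff k k * padeCoeff (k + 1) 0 : ℚ) := by
    rw [coeff_mul_add_eq_of_natDegree_le (natDegree_padeForm_X_one k)
        (natDegree_padeForm_one_X (k + 1)),
      coeff_padeForm_X_one k k le_rfl, coeff_padeForm_one_X (k + 1) (k + 1) le_rfl, Nat.sub_self]
  have e2 : (padeForm (k + 1) (X : ℚ[X]) 1 * padeForm k 1 X).coeff (k + 1 + k) =
      (padeCoeff (k + 1) (k + 1) * padeCoeff k 0 : ℚ) := by
    rw [coeff_mul_add_eq_of_natDegree_le (natDegree_padeForm_X_one (k + 1))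
        (natDegree_padeForm_one_X k),
      coeff_padeForm_X_one (k + 1) (k + 1) le_rfl, coeff_padeForm_one_X k k le_rfl, Nat.sub_self]
  rw [padeDet, coeff_sub, show 2 * k + 1 = k + (k + 1) by ring, e1,
    show k + (k + 1) = k + 1 + k by ring, e2, sub_ne_zero]
  intro h
  have h : padeCoeff k k * padeCoeff (k + 1) 0 = padeCoeff (k + 1) (k + 1) * padeCoeff k 0 := by
    exact_mod_cast h
  have a1 : apProd 4 (k + 1) = apProd 4 k * (4 + 3 * k) := by
    simp [apProd, Finset.prod_range_succ]
  have a2 : apProd 2 (k + 1) = apProd 2 k * (2 + 3 * k) := by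
    simp [apProd, Finset.prod_range_succ]
  have p1 := apProd_pos (u := 4) (by norm_num) k
  have p2 := apProd_pos (u := 2) (by norm_num) k
  have h2 : (3 ^ k * apProd 2 k) * (3 ^ (k + 1) * apProd 4 (k + 1)) =
      (3 ^ (k + 1) * apProd 2 (k + 1)) * (3 ^ k * apProd 4 k) := by
    rw [← padeCoeff_zero, ← padeCoeff_zero, ← padeCoeff_self, ← padeCoeff_self]
    linear_combination (k.factorial * (k + 1).factorial) * h
  rw [a1, a2] at h2
  have h3 : (3 ^ k * apProd 2 k * 3 ^ (k + 1) * apProd 4 k) * (4 + 3 * k) =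
      (3 ^ k * apProd 2 k * 3 ^ (k + 1) * apProd 4 k) * (2 + 3 * k) := by
    linear_combination h2
  have := Nat.eq_of_mul_eq_mul_left (by positivity) h3
  omega

theorem padeDet_X_one (k : ℕ) : ∃ κ : ℚ, κ ≠ 0 ∧
    padeDet k (X : ℚ[X]) 1 = C κ * (X - 1) ^ (2 * k + 1) := by
  obtain ⟨Q, hQ⟩ := X_sub_one_pow_dvd_padeDet k
  have hne := padeDet_coeff_ne_zero k
  have hdeg : (padeDet k (X : ℚ[X]) 1).natDegree ≤ 2 * k + 1 := by
    refine (natDegree_sub_le _ _).trans (max_le ?_ ?_)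
    · refine natDegree_mul_le.trans ?_
      have := natDegree_padeForm_X_one k
      have := natDegree_padeForm_one_X (k + 1)
      omega
    · refine natDegree_mul_le.trans ?_
      have := natDegree_padeForm_X_one (k + 1)
      have := natDegree_padeForm_one_X k
      omega
  have h0 : padeDet k (X : ℚ[X]) 1 ≠ 0 := fun h => hne (by rw [h]; simp)
  have hQ0 : Q ≠ 0 := by rintro rfl; exact h0 (by rw [hQ, mul_zero])
  have hX : (X - 1 : ℚ[X]) = X - C 1 := by simp
  have hd : Q.natDegree = 0 := by
    rw [hQ, natDegree_mul (pow_ne_zero _ (hX ▸ X_sub_C_ne_zero 1)) hQ0, natDegree_pow, hX,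
      natDegree_X_sub_C] at hdeg
    omega
  rw [natDegree_eq_zero] at hd
  obtain ⟨κ, rfl⟩ := hd
  exact ⟨κ, by simpa using hQ0, by rw [hQ, mul_comm]⟩

theorem padeDet_ne_zero {M : Type*} [Field M] [CharZero M] (k : ℕ) {x y : M} (h : x ≠ y) :
    padeDet k x y ≠ 0 := by
  obtain ⟨κ, hκ, hdet⟩ := padeDet_X_one k
  have hone (z : M) : padeDet k z 1 = (κ : M) * (z - 1) ^ (2 * k + 1) := by
    have := congrArg (eval₂RingHom (algebraMap ℚ M) z) hdet
    simp only [padeDet, map_sub, map_mul, map_padeForm, map_one, map_pow] at this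
    simpa [padeDet] using this
  have hκ' : (κ : M) ≠ 0 := by exact_mod_cast hκ
  rcases eq_or_ne y 0 with rfl | hy
  · have hx : padeDet k x 0 = x ^ (2 * k + 1) * padeDet k 1 0 := by
      have e (m : ℕ) : padeForm m x 0 = x ^ m * padeForm m 1 0 := by
        rw [← padeForm_mul, mul_one, mul_zero]
      have e' (m : ℕ) : padeForm m 0 x = x ^ m * padeForm m 0 1 := by
        rw [← padeForm_mul, mul_one, mul_zero]
      simp only [padeDet, e, e']; ring
    have h0 : padeDet k (1 : M) 0 = - padeDet k 0 1 := by simp only [padeDet]; ring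
    rw [hx, h0, hone, zero_sub]
    refine mul_ne_zero (pow_ne_zero _ h) (neg_ne_zero.2 (mul_ne_zero hκ' (pow_ne_zero _ ?_)))
    simp
  · have hx : padeDet k x y = y ^ (2 * k + 1) * padeDet k (x / y) 1 := by
      have e (m : ℕ) : padeForm m x y = y ^ m * padeForm m (x / y) 1 := by
        rw [← padeForm_mul, mul_one, mul_div_cancel₀ _ hy]
      have e' (m : ℕ) : padeForm m y x = y ^ m * padeForm m 1 (x / y) := by
        rw [← padeForm_mul, mul_one, mul_div_cancel₀ _ hy]
      simp only [padeDet, e, e']; ring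
    rw [hx, hone]
    refine mul_ne_zero (pow_ne_zero _ hy) (mul_ne_zero hκ' (pow_ne_zero _ ?_))
    rwa [sub_ne_zero, ne_eq, div_eq_one_iff_eq hy]

theorem exists_cube_root_close {ω x y E : ℂ} (hω : ω ^ 2 + ω + 1 = 0) (h : x ^ 3 - y ^ 3 = E) :
    ∃ j : Fin 3, ‖x - ω ^ (j : ℕ) * y‖ * ‖y‖ ^ 2 ≤ 2 * ‖E‖ := by
  have hω3 : ω ^ 3 = 1 := by linear_combination (ω - 1) * hω
  have hωn : ‖ω‖ = 1 := by
    have : ‖ω‖ ^ 3 = 1 := by rw [← norm_pow, hω3, norm_one]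
    exact (pow_eq_one_iff_of_nonneg (norm_nonneg _) (by norm_num)).1 this
  have hω1 : 3 / 2 ≤ ‖1 - ω‖ ∧ 3 / 2 ≤ ‖1 - ω ^ 2‖ := by
    have h1 : ‖1 - ω‖ * ‖1 - ω ^ 2‖ = 3 := by
      rw [← norm_mul, show (1 - ω) * (1 - ω ^ 2) = 3 by linear_combination (ω - 2) * hω]
      norm_num
    have h2 : ‖1 - ω‖ ≤ 2 := (norm_sub_le _ _).trans (by rw [hωn]; norm_num)
    have h3 : ‖1 - ω ^ 2‖ ≤ 2 := (norm_sub_le _ _).trans (by rw [norm_pow, hωn]; norm_num)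
    constructor <;> nlinarith [norm_nonneg (1 - ω), norm_nonneg (1 - ω ^ 2)]
  have main : ∀ u : ℂ, ‖u‖ = ‖y‖ → x ^ 3 - u ^ 3 = E → ‖x - u‖ ≤ ‖x - ω * u‖ →
      ‖x - u‖ ≤ ‖x - ω ^ 2 * u‖ → ‖x - u‖ * ‖y‖ ^ 2 ≤ 2 * ‖E‖ := by
    intro u hu he h1 h2
    have e1 : ‖1 - ω‖ * ‖u‖ ≤ ‖x - ω * u‖ + ‖x - u‖ := by
      rw [← norm_mul, show (1 - ω) * u = (x - ω * u) - (x - u) by ring]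
      exact norm_sub_le _ _
    have e2 : ‖1 - ω ^ 2‖ * ‖u‖ ≤ ‖x - ω ^ 2 * u‖ + ‖x - u‖ := by
      rw [← norm_mul, show (1 - ω ^ 2) * u = (x - ω ^ 2 * u) - (x - u) by ring]
      exact norm_sub_le _ _
    have hE : ‖E‖ = ‖x - u‖ * (‖x - ω * u‖ * ‖x - ω ^ 2 * u‖) := by
      rw [← norm_mul, ← norm_mul, ← he]
      congr 1
      linear_combination (x ^ 2 * u - ω * x * u ^ 2 + (ω - 1) * u ^ 3) * hω
    have hn := norm_nonneg u
    have f1 : 3 / 4 * ‖u‖ ≤ ‖x - ω * u‖ := by nlinarith [hω1.1]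
    have f2 : 3 / 4 * ‖u‖ ≤ ‖x - ω ^ 2 * u‖ := by nlinarith [hω1.2]
    have f3 : (3 / 4 * ‖u‖) * (3 / 4 * ‖u‖) ≤ ‖x - ω * u‖ * ‖x - ω ^ 2 * u‖ :=
      mul_le_mul f1 f2 (by positivity) (by positivity)
    rw [hE, ← hu]
    nlinarith [norm_nonneg (x - u), mul_le_mul_of_nonneg_left f3 (norm_nonneg (x - u)),
      mul_nonneg (norm_nonneg (x - u)) (sq_nonneg ‖u‖)]
  obtain ⟨j, hj⟩ := Finite.exists_min fun j : Fin 3 => ‖x - ω ^ (j : ℕ) * y‖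
  have hj0 := hj 0
  have hj1 := hj 1
  have hj2 := hj 2
  refine ⟨j, main (ω ^ (j : ℕ) * y) (by rw [norm_mul, norm_pow, hωn, one_pow, one_mul])
    ?_ ?_ ?_⟩
  · rw [mul_pow, ← pow_mul, mul_comm (j : ℕ), pow_mul, hω3, one_pow, one_mul, h]
  · rw [← mul_assoc]
    fin_cases j
    · simpa using hj1
    · simpa [pow_two] using hj2
    · have : ω * ω ^ 2 = 1 := by rw [← hω3]; ring
      simpa [this] using hj0
  · rw [← mul_assoc]
    fin_cases j
    · simpa using hj2
    · have : ω ^ 2 * ω = 1 := by rw [← hω3]; ring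
      simpa [this] using hj0
    · have : ω ^ 2 * ω ^ 2 = ω := by
        calc ω ^ 2 * ω ^ 2 = ω ^ 3 * ω := by ring
          _ = ω := by rw [hω3, one_mul]
      simpa [this] using hj1

theorem cube_approx_bounds {b E x y t m : ℝ} (hb : 0 < b) (hE : 0 ≤ E) (ht : 0 ≤ t)
    {δ : ℝ} (hy : y = b * t) (hm : m = max 1 t)
    (hxδ : x ≤ y + δ) (hδx : δ ≤ x + y) (hx3 : x ^ 3 ≤ y ^ 3 + E) (hδy : δ * y ^ 2 ≤ 2 * E)
    {c₁ c : ℝ} (hc₁ : c₁ = 2 * E / b ^ 2 + 2 * b + E + 1) (hc : c = c₁ + b + c₁ / b + 1) :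
    δ ≤ c / m ^ 2 ∧ x ≤ c * m ∧ y ≤ c * m ∧ (y < δ → m ≤ c) := by
  have hE2 : 0 ≤ 2 * E / b ^ 2 := by positivity
  have hc1 : 1 ≤ c₁ := by linarith
  have hcb : 0 ≤ c₁ / b := by positivity
  have hcc : c₁ ≤ c := by linarith
  have hm1 : 1 ≤ m := hm ▸ le_max_left _ _
  have hm0 : 0 < m := by linarith
  have hmt : t ≤ m := hm ▸ le_max_right _ _
  have hd : δ ≤ c₁ / m ^ 2 := by
    rcases le_total t 1 with h | h
    · rw [max_eq_left h] at hm
      have hyb : y ≤ b := by rw [hy]; nlinarith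
      have hy0 : 0 ≤ y := by rw [hy]; positivity
      have : x ≤ b + E + 1 := by
        refine le_of_pow_le_pow_left₀ (n := 3) (by norm_num) (by positivity) ?_
        have : y ^ 3 ≤ b ^ 3 := by gcongr
        nlinarith [mul_pos hb hb, mul_nonneg hb.le hE, mul_nonneg hE hE,
          mul_nonneg (mul_nonneg hE hE) hE, mul_nonneg (mul_nonneg hb.le hE) hE,
          mul_nonneg (mul_nonneg hb.le hb.le) hE]
      rw [hm]; simp only [one_pow, div_one]; linarith
    · rw [max_eq_right h] at hm
      rw [le_div_iff₀ (by positivity), hm]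
      have : δ * t ^ 2 ≤ 2 * E / b ^ 2 := by
        rw [le_div_iff₀ (by positivity)]
        calc _ = δ * y ^ 2 := by rw [hy]; ring
          _ ≤ _ := hδy
      linarith
  have hdc : δ ≤ c₁ := hd.trans (div_le_self (by linarith) (one_le_pow₀ hm1))
  have hyb : y ≤ b * m := by rw [hy]; gcongr
  refine ⟨hd.trans (by gcongr), ?_, ?_, fun hlt => ?_⟩
  · nlinarith
  · nlinarith
  · rcases le_total t 1 with h | h
    · rw [max_eq_left h] at hm; linarith
    · rw [max_eq_right h] at hm
      have h1 : b * m < c₁ / m ^ 2 := by rw [hm, ← hy, ← hm]; linarith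
      rw [lt_div_iff₀ (by positivity)] at h1
      have h2 : m * b ≤ c₁ := by nlinarith [one_le_pow₀ hm1 (n := 2), mul_pos hm0 hb]
      have := (le_div_iff₀ hb).2 h2
      linarith

theorem pade_product_bound {c m m₀ : ℝ} (hc : 1 ≤ c) (hm : 1 ≤ m) (hm₀ : 1 ≤ m₀) (k : ℕ)
    {x y x₀ y₀ : ℂ} (h1 : ‖x - y‖ ≤ c / m ^ 2) (h2 : ‖y‖ ≤ c * m)
    (h3 : ‖x₀ - y₀‖ ≤ c / m₀ ^ 2) (h4 : ‖x₀‖ ≤ c * m₀) (h5 : ‖y₀‖ ≤ c * m₀)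
    (h6 : ‖y₀‖ < ‖x₀ - y₀‖ → m₀ ≤ c) :
    ‖x₀ * y * padeForm k (x₀ ^ 3) (y₀ ^ 3) - x * y₀ * padeForm k (y₀ ^ 3) (x₀ ^ 3)‖ ≤
      2 * 576 ^ (k + 1) * c ^ (9 * k + 5) * (m / m₀ ^ (3 * k + 2) + m₀ ^ (3 * k + 1) / m ^ 2) := by
  have hx3 : ‖x₀ ^ 3‖ ≤ (c * m₀) ^ 3 := by rw [norm_pow]; gcongr
  have hy3 : ‖y₀ ^ 3‖ ≤ (c * m₀) ^ 3 := by rw [norm_pow]; gcongr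
  have hF := norm_padeForm_le k _ _ hx3 hy3
  have hF' := norm_padeForm_le k _ _ hy3 hx3
  set F := padeForm k (x₀ ^ 3) (y₀ ^ 3)
  set F' := padeForm k (y₀ ^ 3) (x₀ ^ 3)
  have hc0 : 0 < c := by linarith
  have hm0 : 0 < m := by linarith
  have hm00 : 0 < m₀ := by linarith
  have e : x₀ * y * F - x * y₀ * F' = y * (x₀ * F - y₀ * F') + (y - x) * y₀ * F' := by ring
  have t2 : ‖(y - x) * y₀ * F'‖ ≤
      2 * 576 ^ (k + 1) * c ^ (9 * k + 5) * (m₀ ^ (3 * k + 1) / m ^ 2) := by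
    rw [norm_mul, norm_mul, norm_sub_rev]
    calc _ ≤ c / m ^ 2 * (c * m₀) * (576 ^ (k + 1) * ((c * m₀) ^ 3) ^ k) := by gcongr
      _ = 1 * 576 ^ (k + 1) * c ^ (3 * k + 2) * (m₀ ^ (3 * k + 1) / m ^ 2) := by
          rw [← pow_mul, mul_pow]; ring
      _ ≤ _ := by
          gcongr ?_ * _ * c ^ ?_ * _
          · norm_num
          · omega
  have t1' : ‖x₀ * F - y₀ * F'‖ ≤
      2 * 576 ^ (k + 1) * c ^ (9 * k + 4) * (1 / m₀ ^ (3 * k + 2)) := by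
    rcases le_or_gt ‖x₀ - y₀‖ ‖y₀‖ with h | h
    · refine (norm_pade_approx_le k x₀ y₀ h).trans ?_
      calc _ ≤ 576 ^ (k + 1) * ((c / m₀ ^ 2) ^ (2 * k + 1) * (c * m₀) ^ k) := by gcongr
        _ = 1 * 576 ^ (k + 1) * c ^ (3 * k + 1) * (1 / m₀ ^ (3 * k + 2)) := by
            rw [div_pow, mul_pow]
            field_simp
            ring
        _ ≤ _ := by
            gcongr ?_ * _ * c ^ ?_ * _
            · norm_num
            · omega
    · have hmc := h6 h
      calc _ ≤ ‖x₀‖ * ‖F‖ + ‖y₀‖ * ‖F'‖ := by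
            rw [← norm_mul, ← norm_mul]; exact norm_sub_le _ _
        _ ≤ (c * m₀) * (576 ^ (k + 1) * ((c * m₀) ^ 3) ^ k) +
            (c * m₀) * (576 ^ (k + 1) * ((c * m₀) ^ 3) ^ k) := by gcongr
        _ = 2 * 576 ^ (k + 1) * (c ^ (3 * k + 1) * m₀ ^ (6 * k + 3)) *
            (1 / m₀ ^ (3 * k + 2)) := by
            field_simp
            ring
        _ ≤ 2 * 576 ^ (k + 1) * (c ^ (3 * k + 1) * c ^ (6 * k + 3)) *
            (1 / m₀ ^ (3 * k + 2)) := by gcongr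
        _ = _ := by ring
  have t1 : ‖y * (x₀ * F - y₀ * F')‖ ≤
      2 * 576 ^ (k + 1) * c ^ (9 * k + 5) * (m / m₀ ^ (3 * k + 2)) := by
    rw [norm_mul]
    calc _ ≤ c * m * (2 * 576 ^ (k + 1) * c ^ (9 * k + 4) * (1 / m₀ ^ (3 * k + 2))) := by gcongr
      _ = _ := by ring
  rw [e, mul_add]
  exact (norm_add_le _ _).trans (add_le_add t1 t2)

/-- The linear form in Padé approximants used to separate two solutions of the cubic equation
`a s³ + b t³ = e`. -/
def padeDelta {R : Type*} [CommRing R] (k : ℕ) (a b : R) (z z₀ : R × R) : R :=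
  z₀.1 * z.2 * padeForm k (a * z₀.1 ^ 3) (-b * z₀.2 ^ 3) -
    z.1 * z₀.2 * padeForm k (-b * z₀.2 ^ 3) (a * z₀.1 ^ 3)

theorem map_padeDelta {R S : Type*} [CommRing R] [CommRing S] (f : R →+* S) (k : ℕ) (a b : R)
    (z z₀ : R × R) : f (padeDelta k a b z z₀) =
      padeDelta k (f a) (f b) (f z.1, f z.2) (f z₀.1, f z₀.2) := by
  simp [padeDelta, map_padeForm]

theorem le_pow_mul_of_mul_le {A c Q D : ℝ} (hA : 0 < A) (hc : 1 ≤ c) (hQ : 0 ≤ Q) {k : ℕ}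
    (hD : 0 ≤ D) (h : A * D ≤ 2 * 576 ^ (k + 1) * c ^ (9 * k + 5) * Q) :
    D ≤ (2 * 576 * c ^ 9 * (1 + 1 / A)) ^ (k + 1) * Q := by
  have hA' : 0 < 1 / A := by positivity
  have hinv : A⁻¹ ≤ (1 + 1 / A) ^ (k + 1) := by
    calc A⁻¹ ≤ 1 + 1 / A := by rw [one_div]; linarith
      _ ≤ _ := le_self_pow₀ (by linarith) (by omega)
  calc D = A⁻¹ * (A * D) := by field_simp
    _ ≤ (1 + 1 / A) ^ (k + 1) * (2 * 576 ^ (k + 1) * c ^ (9 * k + 5) * Q) := by gcongr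
    _ ≤ (1 + 1 / A) ^ (k + 1) * (2 ^ (k + 1) * 576 ^ (k + 1) * c ^ (9 * (k + 1)) * Q) := by
        gcongr _ * (?_ * _ * c ^ ?_ * _)
        · exact le_self_pow₀ (by norm_num) (by omega)
        · omega
    _ = _ := by rw [mul_pow, mul_pow, mul_pow, ← pow_mul]; ring

theorem exists_local_bound {a b E : ℂ} (ha : a ≠ 0) (hb : b ≠ 0) :
    ∃ Λ : ℝ, 1 ≤ Λ ∧ ∃ cls : ℂ × ℂ → Fin 3, ∀ z z₀ : ℂ × ℂ,
      a * z.1 ^ 3 + b * z.2 ^ 3 = E → a * z₀.1 ^ 3 + b * z₀.2 ^ 3 = E → cls z = cls z₀ →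
      ∀ k, ‖padeDelta k a b z z₀‖ ≤ Λ ^ (k + 1) *
        (max 1 ‖z.2‖ / max 1 ‖z₀.2‖ ^ (3 * k + 2) +
          max 1 ‖z₀.2‖ ^ (3 * k + 1) / max 1 ‖z.2‖ ^ 2) := by
  obtain ⟨ω, hω⟩ : ∃ ω : ℂ, ω ^ 2 + ω + 1 = 0 := by
    obtain ⟨ω, hω⟩ := IsAlgClosed.exists_root (X ^ 2 + X + 1 : ℂ[X])
      (by rw [show (X ^ 2 + X + 1 : ℂ[X]).degree = 2 by compute_degree!]; norm_num)
    exact ⟨ω, by simpa using hω⟩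
  have hω3 : ω ^ 3 = 1 := by linear_combination (ω - 1) * hω
  have hωn : ‖ω‖ = 1 := by
    have : ‖ω‖ ^ 3 = 1 := by rw [← norm_pow, hω3, norm_one]
    exact (pow_eq_one_iff_of_nonneg (norm_nonneg _) (by norm_num)).1 this
  obtain ⟨α, hα⟩ := IsAlgClosed.exists_pow_nat_eq a (n := 3) (by norm_num)
  obtain ⟨β, hβ⟩ := IsAlgClosed.exists_pow_nat_eq (-b) (n := 3) (by norm_num)
  have hα0 : α ≠ 0 := by rintro rfl; exact ha (by simpa using hα.symm)
  have hβ0 : β ≠ 0 := by rintro rfl; exact hb (by simpa using hβ.symm)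
  have hex : ∀ z : ℂ × ℂ, ∃ j : Fin 3, a * z.1 ^ 3 + b * z.2 ^ 3 = E →
      ‖α * z.1 - ω ^ (j : ℕ) * (β * z.2)‖ * ‖β * z.2‖ ^ 2 ≤ 2 * ‖E‖ := by
    intro z
    by_cases h : a * z.1 ^ 3 + b * z.2 ^ 3 = E
    · obtain ⟨j, hj⟩ := exists_cube_root_close (x := α * z.1) (y := β * z.2) (E := E) hω
        (by rw [mul_pow, mul_pow, hα, hβ, ← h]; ring)
      exact ⟨j, fun _ => hj⟩
    · exact ⟨0, fun h' => absurd h' h⟩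
  choose cls hcls using hex
  set c₁ : ℝ := 2 * ‖E‖ / ‖β‖ ^ 2 + 2 * ‖β‖ + ‖E‖ + 1 with hc₁
  set c : ℝ := c₁ + ‖β‖ + c₁ / ‖β‖ + 1 with hc
  have hβp : 0 < ‖β‖ := norm_pos_iff.2 hβ0
  have hαp : 0 < ‖α‖ := norm_pos_iff.2 hα0
  have hc1 : 1 ≤ c := by
    have : 0 ≤ c₁ := by positivity
    have : 0 ≤ c₁ / ‖β‖ := by positivity
    linarith
  have hbd : ∀ z : ℂ × ℂ, a * z.1 ^ 3 + b * z.2 ^ 3 = E → ∀ y, y = ω ^ (cls z : ℕ) * (β * z.2) →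
      ‖α * z.1 - y‖ ≤ c / max 1 ‖z.2‖ ^ 2 ∧ ‖α * z.1‖ ≤ c * max 1 ‖z.2‖ ∧
      ‖y‖ ≤ c * max 1 ‖z.2‖ ∧ (‖y‖ < ‖α * z.1 - y‖ → max 1 ‖z.2‖ ≤ c) := by
    intro z hz y hy
    have hyn : ‖y‖ = ‖β‖ * ‖z.2‖ := by
      rw [hy, norm_mul, norm_pow, hωn, one_pow, one_mul, norm_mul]
    have hy3 : (α * z.1) ^ 3 = y ^ 3 + E := by
      rw [hy, mul_pow, mul_pow, mul_pow, hα, hβ, ← pow_mul, mul_comm _ 3, pow_mul, hω3, one_pow,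
        ← hz]
      ring
    refine cube_approx_bounds hβp (norm_nonneg E) (norm_nonneg z.2) hyn rfl ?_
      (norm_sub_le _ _) ?_ ?_ hc₁ hc
    · simpa using norm_add_le y (α * z.1 - y)
    · rw [← norm_pow, ← norm_pow, hy3]; exact norm_add_le _ _
    · have := hcls z hz
      rwa [← hy, norm_mul β, ← hyn] at this
  refine ⟨2 * 576 * c ^ 9 * (1 + 1 / (‖α‖ * ‖β‖)), ?_, cls, ?_⟩
  · have h1 : 1 ≤ c ^ 9 := one_le_pow₀ hc1
    have h2 : 0 ≤ 1 / (‖α‖ * ‖β‖) := by positivity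
    exact one_le_mul_of_one_le_of_one_le
      (one_le_mul_of_one_le_of_one_le (by norm_num) h1) (le_add_of_nonneg_right h2)
  intro z z₀ hz hz₀ hj k
  have b1 := hbd z hz _ rfl
  have b2 := hbd z₀ hz₀ _ rfl
  set m := max 1 ‖z.2‖
  set m₀ := max 1 ‖z₀.2‖
  have hm : 1 ≤ m := le_max_left _ _
  have hm₀ : 1 ≤ m₀ := le_max_left _ _
  have key := pade_product_bound hc1 hm hm₀ k b1.1 b1.2.2.1 b2.1 b2.2.1 b2.2.2.1 b2.2.2.2
  have hω3' : (ω ^ (cls z₀ : ℕ)) ^ 3 = 1 := by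
    rw [← pow_mul, mul_comm, pow_mul, hω3, one_pow]
  have hΔ : α * z₀.1 * (ω ^ (cls z : ℕ) * (β * z.2)) *
      padeForm k ((α * z₀.1) ^ 3) ((ω ^ (cls z₀ : ℕ) * (β * z₀.2)) ^ 3) -
      α * z.1 * (ω ^ (cls z₀ : ℕ) * (β * z₀.2)) *
      padeForm k ((ω ^ (cls z₀ : ℕ) * (β * z₀.2)) ^ 3) ((α * z₀.1) ^ 3) =
      (α * β * ω ^ (cls z₀ : ℕ)) * padeDelta k a b z z₀ := by
    have e1 : (α * z₀.1) ^ 3 = a * z₀.1 ^ 3 := by rw [mul_pow, hα]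
    have e2 : (ω ^ (cls z₀ : ℕ) * (β * z₀.2)) ^ 3 = -b * z₀.2 ^ 3 := by
      rw [mul_pow, hω3', one_mul, mul_pow, hβ]
    rw [hj, e1, e2, padeDelta]
    ring
  rw [hΔ, norm_mul, norm_mul, norm_mul, norm_pow, hωn, one_pow, mul_one] at key
  exact le_pow_mul_of_mul_le (mul_pos hαp hβp) hc1 (by positivity) (norm_nonneg _) key

theorem pade_exponent_sum_neg {ι : Type*} [Fintype ι] [Nonempty ι] {L L₀ : ι → ℝ}
    (hL₀ : ∀ i, 0 ≤ L₀ i) {ℓ h h₀ : ℝ} (hℓ : 0 ≤ ℓ)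
    (hh₀ : ∑ i, L₀ i = h₀) (hlarge : 8 * Fintype.card ι * (ℓ + 1) < h₀) (hgap : 16 * h₀ ≤ h)
    (hclose : ∀ i, |L i / h - L₀ i / h₀| ≤ 1 / (16 * Fintype.card ι)) :
    ∃ k₀ : ℕ, ∀ k : ℕ, k₀ ≤ k → k ≤ k₀ + 1 →
      ∑ i, ((k + 1) * ℓ + Real.log 2 + max (L i - (3 * k + 2) * L₀ i)
        ((3 * k + 1) * L₀ i - 2 * L i)) < 0 := by
  set D : ℝ := ((Fintype.card ι : ℕ) : ℝ) with hD
  have hD0 : 0 < D := by rw [hD]; exact_mod_cast Fintype.card_pos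
  have h₀0 : 0 < h₀ := lt_of_le_of_lt (by positivity) hlarge
  have h0 : 0 < h := by linarith
  set ρ := h / h₀ with hρ
  have hρ16 : 16 ≤ ρ := by rw [hρ, le_div_iff₀ h₀0]; exact hgap
  refine ⟨⌊ρ / 2⌋₊, fun k hk1 hk2 => ?_⟩
  have hkl : ρ / 2 - 1 ≤ k := by
    have := Nat.lt_floor_add_one (ρ / 2)
    have : (⌊ρ / 2⌋₊ : ℝ) ≤ k := by exact_mod_cast hk1
    linarith
  have hku : (k : ℝ) ≤ ρ / 2 + 1 := by
    have := Nat.floor_le (show 0 ≤ ρ / 2 by linarith)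
    have : (k : ℝ) ≤ ⌊ρ / 2⌋₊ + 1 := by exact_mod_cast hk2
    linarith
  have hlog : Real.log 2 ≤ 1 := by
    have := Real.log_two_lt_d9; linarith
  have hterm : ∀ i, (k + 1) * ℓ + Real.log 2 + max (L i - (3 * k + 2) * L₀ i)
      ((3 * k + 1) * L₀ i - 2 * L i) ≤
      (ρ * (ℓ + 1) + 2 * (ρ * h₀ / (16 * D))) + (4 - ρ / 2) * L₀ i := by
    intro i
    have hc := abs_le.1 (hclose i)
    have e : ρ * h₀ = h := by rw [hρ]; field_simp
    have h1 : |L i - ρ * L₀ i| ≤ ρ * h₀ / (16 * D) := by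
      have : L i - ρ * L₀ i = (L i / h - L₀ i / h₀) * h := by rw [hρ]; field_simp
      rw [this, abs_mul, abs_of_pos h0, e, div_eq_inv_mul h, ← one_div]
      exact mul_le_mul_of_nonneg_right (hclose i) h0.le
    obtain ⟨h2, h3⟩ := abs_le.1 h1
    have h4 := hL₀ i
    have h5 : (ρ / 2 - 1) * L₀ i ≤ k * L₀ i := by gcongr
    have h6 : k * L₀ i ≤ (ρ / 2 + 1) * L₀ i := by gcongr
    have h7 : (k + 1) * ℓ ≤ (ρ - 1) * ℓ := by gcongr; linarith
    have h8 : max (L i - (3 * k + 2) * L₀ i) ((3 * k + 1) * L₀ i - 2 * L i) ≤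
        2 * (ρ * h₀ / (16 * D)) + (4 - ρ / 2) * L₀ i := by
      have : 0 ≤ ρ * h₀ / (16 * D) := by positivity
      apply max_le
      · linarith
      · linarith
    nlinarith
  calc _ ≤ ∑ i, ((ρ * (ℓ + 1) + 2 * (ρ * h₀ / (16 * D))) + (4 - ρ / 2) * L₀ i) :=
        Finset.sum_le_sum fun i _ => hterm i
    _ = D * (ρ * (ℓ + 1) + 2 * (ρ * h₀ / (16 * D))) + (4 - ρ / 2) * h₀ := by
        rw [Finset.sum_add_distrib, ← Finset.mul_sum, hh₀, Finset.sum_const, nsmul_eq_mul,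
          Finset.card_univ]
    _ = ρ * (D * (ℓ + 1)) + ρ * h₀ / 8 + (4 - ρ / 2) * h₀ := by field_simp; ring
    _ < 0 := by nlinarith

theorem one_le_prod_norm_embeddings {M : Type*} [Field M] [NumberField M]
    {x : NumberField.RingOfIntegers M} (hx : x ≠ 0) :
    1 ≤ ∏ σ : M →ₐ[ℚ] ℂ, ‖σ (x : M)‖ := by
  rw [← norm_prod, ← Algebra.norm_eq_prod_embeddings]
  have h1 : Algebra.norm ℤ x ≠ 0 := Algebra.norm_ne_zero_iff.2 hx
  have h2 := Algebra.coe_norm_int x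
  rw [← h2]
  simp only [map_intCast]
  rw [Complex.norm_intCast]
  exact_mod_cast Int.one_le_abs h1

open NumberField in
/-- The logarithmic size of the second coordinate. -/
noncomputable def logSize {M : Type*} [Field M] [NumberField M] (z : 𝓞 M × 𝓞 M) : ℝ :=
  ∑ σ : M →ₐ[ℚ] ℂ, Real.log (max 1 ‖σ (z.2 : M)‖)

open NumberField in
theorem finite_cubic_of_logSize_le {M : Type*} [Field M] [NumberField M] {a b e : 𝓞 M}
    (ha : a ≠ 0) (H : ℝ) :
    {z : 𝓞 M × 𝓞 M | a * z.1 ^ 3 + b * z.2 ^ 3 = e ∧ logSize z ≤ H}.Finite := by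
  have hT : {t : 𝓞 M | ∀ σ : M →+* ℂ, ‖σ (t : M)‖ ≤ Real.exp H}.Finite := by
    refine Set.Finite.of_finite_image
      ((NumberField.Embeddings.finite_of_norm_le M ℂ (Real.exp H)).subset ?_)
      (NumberField.RingOfIntegers.coe_injective.injOn)
    rintro _ ⟨t, ht, rfl⟩
    exact ⟨t.isIntegral_coe, ht⟩
  have hS : ∀ c : 𝓞 M, {s : 𝓞 M | a * s ^ 3 = c}.Finite := by
    intro c
    have hne : (C a * X ^ 3 - C c : (𝓞 M)[X]) ≠ 0 := by
      intro h
      have := congrArg (fun p => p.coeff 3) h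
      simp at this
      exact ha this
    refine (Polynomial.finite_setOfPred_isRoot hne).subset fun s hs => ?_
    simp only [Set.mem_ofPred_eq, IsRoot, eval_sub, eval_mul, eval_C, eval_pow, eval_X] at hs ⊢
    rw [hs, sub_self]
  refine (hT.biUnion (t := fun t => {s : 𝓞 M | a * s ^ 3 = e - b * t ^ 3} ×ˢ {t})
    fun t _ => (hS _).prod (Set.finite_singleton t)).subset ?_
  rintro ⟨s, t⟩ ⟨h1, h2⟩
  simp only [Set.mem_iUnion, Set.mem_prod, Set.mem_singleton_iff, Set.mem_ofPred_eq]
  refine ⟨t, fun σ => ?_, by simp only at h1; rw [← h1]; ring, rfl⟩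
  have hle : Real.log (max 1 ‖σ (t : M)‖) ≤ H := by
    refine le_trans ?_ h2
    exact Finset.single_le_sum (f := fun σ : M →ₐ[ℚ] ℂ => Real.log (max 1 ‖σ (t : M)‖))
      (fun τ _ => Real.log_nonneg (le_max_left _ _)) (Finset.mem_univ σ.toRatAlgHom)
  rw [Real.log_le_iff_le_exp (by positivity)] at hle
  exact (le_max_right _ _).trans hle

open NumberField in
/-- Thue's theorem for binary binomial cubic forms over rings of integers. -/
theorem finite_cubic {M : Type*} [Field M] [NumberField M] {a b e : 𝓞 M}
    (ha : a ≠ 0) (hb : b ≠ 0) (he : e ≠ 0) :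
    {z : 𝓞 M × 𝓞 M | a * z.1 ^ 3 + b * z.2 ^ 3 = e ∧ z.1 ≠ 0 ∧ z.2 ≠ 0}.Finite := by
  by_contra hinf
  change Set.Infinite _ at hinf
  set S := {z : 𝓞 M × 𝓞 M | a * z.1 ^ 3 + b * z.2 ^ 3 = e ∧ z.1 ≠ 0 ∧ z.2 ≠ 0} with hS
  have hloc : ∀ σ : M →ₐ[ℚ] ℂ, _ := fun σ => exists_local_bound (E := σ (e : M))
    (a := σ (a : M)) (b := σ (b : M)) (by simpa using ha) (by simpa using hb)
  choose Λ hΛ1 cls hcls using hloc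
  set N : ℕ := 16 * Fintype.card (M →ₐ[ℚ] ℂ) with hN
  have hι : 0 < Fintype.card (M →ₐ[ℚ] ℂ) := by
    rw [AlgHom.card]; exact Module.finrank_pos
  have : Nonempty (M →ₐ[ℚ] ℂ) := Fintype.card_pos_iff.1 hι
  set L : 𝓞 M × 𝓞 M → (M →ₐ[ℚ] ℂ) → ℝ := fun z σ => Real.log (max 1 ‖σ (z.2 : M)‖) with hL
  have hL0 : ∀ z σ, 0 ≤ L z σ := fun z σ => Real.log_nonneg (le_max_left _ _)
  have hLle : ∀ z σ, L z σ / logSize z ≤ 1 := fun z σ => div_le_one_of_le₀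
    (Finset.single_le_sum (fun τ _ => hL0 z τ) (Finset.mem_univ σ))
    (Finset.sum_nonneg fun τ _ => hL0 z τ)
  have hLnn : ∀ z σ, 0 ≤ L z σ / logSize z := fun z σ =>
    div_nonneg (hL0 z σ) (Finset.sum_nonneg fun τ _ => hL0 z τ)
  have hfl : ∀ z σ, ⌊N * (L z σ / logSize z)⌋₊ < N + 1 := fun z σ => by
    rw [Nat.floor_lt' (by omega)]
    have := hLle z σ
    push_cast
    nlinarith [(Nat.cast_nonneg N : (0 : ℝ) ≤ N)]
  have : Infinite S := hinf.to_subtype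
  obtain ⟨y, hy⟩ := Finite.exists_infinite_fiber fun (z : S) (σ : M →ₐ[ℚ] ℂ) =>
    (cls σ (σ (z.1.1 : M), σ (z.1.2 : M)),
      (⟨⌊N * (L z.1 σ / logSize z.1)⌋₊, hfl z.1 σ⟩ : Fin (N + 1)))
  have hlarge : ∀ H : ℝ, ∃ z ∈ S, H < logSize z ∧ ∀ σ,
      cls σ (σ (z.1 : M), σ (z.2 : M)) = (y σ).1 ∧
      ⌊N * (L z σ / logSize z)⌋₊ = ((y σ).2 : ℕ) := by
    intro H
    by_contra hno
    push Not at hno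
    have hfin : (Subtype.val '' ((fun (z : S) (σ : M →ₐ[ℚ] ℂ) =>
      (cls σ (σ (z.1.1 : M), σ (z.1.2 : M)),
      (⟨⌊N * (L z.1 σ / logSize z.1)⌋₊, hfl z.1 σ⟩ : Fin (N + 1)))) ⁻¹' {y})).Finite := by
      refine (finite_cubic_of_logSize_le (b := b) (e := e) ha H).subset ?_
      rintro _ ⟨z, hz, rfl⟩
      refine ⟨z.2.1, ?_⟩
      by_contra hlt
      push Not at hlt
      obtain ⟨σ, hσ⟩ := hno z.1 z.2 hlt
      have hz := congrFun (Set.mem_singleton_iff.1 hz) σ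
      exact hσ (by rw [← hz]) (by rw [← hz])
    exact (Set.infinite_coe_iff.1 hy) (Set.Finite.of_finite_image hfin
      Subtype.val_injective.injOn)
  set Λ' : ℝ := 1 + ∑ σ, Λ σ
  have hΛ'le : ∀ σ, Λ σ ≤ Λ' := fun σ => by
    have := Finset.single_le_sum (f := Λ) (fun τ _ => zero_le_one.trans (hΛ1 τ))
      (Finset.mem_univ σ)
    simp only [Λ']; linarith
  have hΛ' : 1 ≤ Λ' := (hΛ1 (Classical.arbitrary (M →ₐ[ℚ] ℂ))).trans (hΛ'le _)
  obtain ⟨z₀, hz₀, hz₀h, hz₀y⟩ := hlarge (8 * Fintype.card (M →ₐ[ℚ] ℂ) * (Real.log Λ' + 1))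
  obtain ⟨z, hz, hzh, hzy⟩ := hlarge (16 * logSize z₀)
  have hclose : ∀ σ, |L z σ / logSize z - L z₀ σ / logSize z₀| ≤
      1 / (16 * Fintype.card (M →ₐ[ℚ] ℂ)) := by
    intro σ
    have hfe := (hzy σ).2.trans (hz₀y σ).2.symm
    have hN0 : (0 : ℝ) < N := by rw [hN]; exact_mod_cast (by omega)
    have hb1 := Nat.floor_le (mul_nonneg hN0.le (hLnn z σ))
    have hb2 := Nat.lt_floor_add_one (N * (L z σ / logSize z))
    have hb3 := Nat.floor_le (mul_nonneg hN0.le (hLnn z₀ σ))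
    have hb4 := Nat.lt_floor_add_one (N * (L z₀ σ / logSize z₀))
    rw [hfe] at hb1 hb2
    have : (16 * Fintype.card (M →ₐ[ℚ] ℂ) : ℝ) = N := by rw [hN]; push_cast; rfl
    rw [this, le_div_iff₀ hN0, ← abs_of_pos hN0, ← abs_mul, abs_le]
    constructor <;> nlinarith
  obtain ⟨k₀, hk₀⟩ := pade_exponent_sum_neg (hL0 z₀) (Real.log_nonneg hΛ') rfl hz₀h hzh.le hclose
  have hzero : ∀ k, k₀ ≤ k → k ≤ k₀ + 1 → padeDelta k a b z z₀ = 0 := by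
    intro k h1 h2
    by_contra hne
    have hprod := one_le_prod_norm_embeddings hne
    have hbound : ∀ σ : M →ₐ[ℚ] ℂ, ‖σ ((padeDelta k a b z z₀ : 𝓞 M) : M)‖ ≤
        Real.exp ((k + 1) * Real.log Λ' + Real.log 2 + max (L z σ - (3 * k + 2) * L z₀ σ)
        ((3 * k + 1) * L z₀ σ - 2 * L z σ)) := by
      intro σ
      have hmap : σ ((padeDelta k a b z z₀ : 𝓞 M) : M) =
          padeDelta k (σ (a : M)) (σ (b : M)) (σ (z.1 : M), σ (z.2 : M))
            (σ (z₀.1 : M), σ (z₀.2 : M)) :=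
        map_padeDelta ((σ : M →+* ℂ).comp (algebraMap (𝓞 M) M)) k a b z z₀
      have heq : ∀ w : 𝓞 M × 𝓞 M, a * w.1 ^ 3 + b * w.2 ^ 3 = e →
          σ (a : M) * σ (w.1 : M) ^ 3 + σ (b : M) * σ (w.2 : M) ^ 3 = σ (e : M) := by
        intro w hw
        rw [← hw]; simp
      have hbd := hcls σ (σ (z.1 : M), σ (z.2 : M)) (σ (z₀.1 : M), σ (z₀.2 : M))
        (heq z hz.1) (heq z₀ hz₀.1) ((hzy σ).1.trans (hz₀y σ).1.symm) k
      rw [hmap]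
      refine hbd.trans ?_
      have em : ∀ w : 𝓞 M × 𝓞 M, max 1 ‖σ (w.2 : M)‖ = Real.exp (L w σ) := fun w =>
        (Real.exp_log (by positivity)).symm
      simp only [em]
      have e1 : Real.exp (L z σ) / Real.exp (L z₀ σ) ^ (3 * k + 2) =
          Real.exp (L z σ - (3 * k + 2) * L z₀ σ) := by
        rw [← Real.exp_nat_mul, ← Real.exp_sub]; push_cast; rfl
      have e2 : Real.exp (L z₀ σ) ^ (3 * k + 1) / Real.exp (L z σ) ^ 2 =
          Real.exp ((3 * k + 1) * L z₀ σ - 2 * L z σ) := by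
        rw [← Real.exp_nat_mul, ← Real.exp_nat_mul, ← Real.exp_sub]; push_cast; rfl
      have e3 : Real.exp ((k + 1) * Real.log Λ') = Λ' ^ (k + 1) := by
        have := Real.exp_nat_mul (Real.log Λ') (k + 1)
        rw [Real.exp_log (by linarith)] at this
        rw [← this]; push_cast; rfl
      rw [e1, e2, Real.exp_add, Real.exp_add, e3, Real.exp_log (by norm_num : (0 : ℝ) < 2),
        mul_assoc]
      have e4 := Real.exp_le_exp.2 (le_max_left (L z σ - (3 * k + 2) * L z₀ σ)
        ((3 * k + 1) * L z₀ σ - 2 * L z σ))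
      have e5 := Real.exp_le_exp.2 (le_max_right (L z σ - (3 * k + 2) * L z₀ σ)
        ((3 * k + 1) * L z₀ σ - 2 * L z σ))
      have e6 := pow_le_pow_left₀ (zero_le_one.trans (hΛ1 σ)) (hΛ'le σ) (k + 1)
      exact mul_le_mul e6 (by linarith) (by positivity) (by positivity)
    have h3 := Finset.prod_le_prod (s := Finset.univ) (fun σ _ => norm_nonneg _)
      fun σ _ => hbound σ
    rw [← Real.exp_sum] at h3
    have h4 := Real.exp_lt_one_iff.2 (hk₀ k h1 h2)
    exact absurd (hprod.trans h3) (not_le.2 h4)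
  have hd0 := hzero k₀ le_rfl (by omega)
  have hd1 := hzero (k₀ + 1) (by omega) le_rfl
  simp only [padeDelta] at hd0 hd1
  set x := a * z₀.1 ^ 3
  set w := -b * z₀.2 ^ 3
  have hdet : padeDet k₀ x w = 0 := by
    have h1 : z₀.1 * z.2 * padeDet k₀ x w = 0 := by
      rw [padeDet]
      linear_combination (padeForm (k₀ + 1) w x) * hd0 - (padeForm k₀ w x) * hd1
    exact (mul_eq_zero.1 h1).resolve_left (mul_ne_zero hz₀.2.1 hz.2.2)
  have hxw : (x : M) ≠ w := by
    intro h
    have h : x = w := NumberField.RingOfIntegers.coe_injective h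
    apply he
    rw [← hz₀.1]
    linear_combination h
  apply padeDet_ne_zero k₀ hxw
  have : (padeDet k₀ (x : M) (w : M)) = ((padeDet k₀ x w : 𝓞 M) : M) := by
    simp only [padeDet, map_sub, map_mul, map_padeForm]
  rw [this, hdet]
  rfl

open NumberField in
theorem exists_finite_unit_representatives (K : Type*) [Field K] [NumberField K] {n : ℕ}
    (hn : n ≠ 0) : ∃ R : Set (𝓞 K)ˣ, R.Finite ∧ ∀ u, ∃ r ∈ R, ∃ w, u = r * w ^ n := by
  have hfg : Group.FG (𝓞 K)ˣ := Group.fg_iff_monoid_fg.2 inferInstance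
  have := Subgroup.finiteIndex_iff_finite_quotient.1
    (Subgroup.finiteIndex_range_powMonoidHom_of_fg (𝓞 K)ˣ hn)
  refine ⟨Set.range (Quotient.out : _ ⧸ (powMonoidHom n : (𝓞 K)ˣ →* _).range → (𝓞 K)ˣ),
    Set.finite_range _, fun u => ⟨_, ⟨QuotientGroup.mk u, rfl⟩, ?_⟩⟩
  obtain ⟨w, hw⟩ := QuotientGroup.eq.1
    (Quotient.out_eq (u : (𝓞 K)ˣ ⧸ (powMonoidHom n : (𝓞 K)ˣ →* _).range))
  refine ⟨w, ?_⟩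
  rw [powMonoidHom_apply] at hw
  rw [hw]
  simp

open NumberField in
theorem finite_unit_equation {K : Type*} [Field K] [NumberField K] {a b e : 𝓞 K}
    (ha : a ≠ 0) (hb : b ≠ 0) (he : e ≠ 0) :
    {z : (𝓞 K)ˣ × (𝓞 K)ˣ | a * z.1 + b * z.2 = e}.Finite := by
  obtain ⟨R, hR, hrep⟩ := exists_finite_unit_representatives K (n := 3) (by norm_num)
  have hinj : Function.Injective fun z : (𝓞 K)ˣ × (𝓞 K)ˣ => ((z.1 : 𝓞 K), (z.2 : 𝓞 K)) := by
    rintro ⟨x, y⟩ ⟨x', y'⟩ h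
    simp only [Prod.mk.injEq, Units.val_inj] at h
    exact Prod.ext h.1 h.2
  refine Set.Finite.of_finite_image (f := fun z => ((z.1 : 𝓞 K), (z.2 : 𝓞 K))) ?_ hinj.injOn
  refine ((hR.prod hR).biUnion (t := fun r => (fun z : 𝓞 K × 𝓞 K =>
    ((r.1 : 𝓞 K) * z.1 ^ 3, (r.2 : 𝓞 K) * z.2 ^ 3)) ''
      {z : 𝓞 K × 𝓞 K | (a * r.1) * z.1 ^ 3 + (b * r.2) * z.2 ^ 3 = e ∧ z.1 ≠ 0 ∧ z.2 ≠ 0})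
    fun r _ => (finite_cubic (mul_ne_zero ha r.1.ne_zero) (mul_ne_zero hb r.2.ne_zero)
      he).image _).subset ?_
  rintro _ ⟨⟨u, v⟩, huv, rfl⟩
  obtain ⟨r, hr, w, rfl⟩ := hrep u
  obtain ⟨s, hs, y, rfl⟩ := hrep v
  simp only [Set.mem_iUnion]
  refine ⟨(r, s), ⟨hr, hs⟩, ((w : 𝓞 K), (y : 𝓞 K)), ⟨?_, w.ne_zero, y.ne_zero⟩, by simp⟩
  simp only [Set.mem_ofPred_eq, Units.val_mul, Units.val_pow_eq_pow_val] at huv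
  rw [← huv]
  ring

open NumberField in
theorem exists_finite_divisor_representatives {K : Type*} [Field K] [NumberField K] {a : 𝓞 K}
    (ha : a ≠ 0) : ∃ R : Set (𝓞 K), R.Finite ∧ ∀ x, x ∣ a → ∃ r ∈ R, r ≠ 0 ∧
      ∃ u : (𝓞 K)ˣ, x = r * u := by
  have ha' : Ideal.span {a} ≠ 0 := by simpa using ha
  have hfin : {I : Ideal (𝓞 K) | I ∣ Ideal.span {a}}.Finite :=
    Set.finite_coe_iff.1 (@Finite.of_fintype _ (UniqueFactorizationMonoid.fintypeSubtypeDvd _ ha'))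
  classical
  refine ⟨(fun I => if h : ∃ x, x ∣ a ∧ I = Ideal.span {x} then h.choose else 0) '' _,
    hfin.image _, fun x hx => ?_⟩
  have hxs : ∃ y, y ∣ a ∧ Ideal.span {x} = Ideal.span {y} := ⟨x, hx, rfl⟩
  refine ⟨_, ⟨Ideal.span {x},
    Ideal.dvd_iff_le.2 (Ideal.span_singleton_le_span_singleton.2 hx), rfl⟩, ?_⟩
  simp only [dif_pos hxs]
  obtain ⟨h1, h2⟩ := hxs.choose_spec
  refine ⟨ne_zero_of_dvd_ne_zero ha h1, ?_⟩
  obtain ⟨u, hu⟩ := Ideal.span_singleton_eq_span_singleton.1 h2.symm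
  exact ⟨u, hu.symm⟩

open NumberField in
theorem finite_int_three_squares {K : Type*} [Field K] [NumberField K] {α₁ α₂ α₃ : 𝓞 K}
    (h₁₂ : α₁ ≠ α₂) (h₂₃ : α₂ ≠ α₃) (h₃₁ : α₃ ≠ α₁) :
    {x : ℤ | (∃ w, (x : 𝓞 K) - α₁ = w ^ 2) ∧ (∃ w, (x : 𝓞 K) - α₂ = w ^ 2) ∧
      ∃ w, (x : 𝓞 K) - α₃ = w ^ 2}.Finite := by
  obtain ⟨R₁, hR₁, hrep₁⟩ := exists_finite_divisor_representatives (sub_ne_zero.2 h₁₂.symm)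
  obtain ⟨R₂, hR₂, hrep₂⟩ := exists_finite_divisor_representatives (sub_ne_zero.2 h₂₃.symm)
  obtain ⟨R₃, hR₃, hrep₃⟩ := exists_finite_divisor_representatives (sub_ne_zero.2 h₃₁.symm)
  set F : K → K := fun ρ =>
    (((α₃ : K) - α₂) ^ 2 * ((ρ + 1) / (((α₂ : K) - α₁) / ρ - (α₃ - α₂))) +
      2 * ((α₃ : K) - α₂) + (((α₂ : K) - α₁) / ρ - (α₃ - α₂)) / (ρ + 1)) / 4 + α₂ with hF
  refine Set.Finite.of_finite_image (f := fun x : ℤ => (x : K)) ?_ Int.cast_injective.injOn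
  have hfin : ∀ r : 𝓞 K × 𝓞 K × 𝓞 K, ({z : (𝓞 K)ˣ × (𝓞 K)ˣ |
      r.1 ≠ 0 ∧ r.2.1 ≠ 0 ∧ r.2.2 ≠ 0 ∧ r.1 * z.1 + r.2.1 * z.2 = -r.2.2}).Finite := by
    intro r
    by_cases h : r.1 ≠ 0 ∧ r.2.1 ≠ 0 ∧ r.2.2 ≠ 0
    · exact (finite_unit_equation h.1 h.2.1 (neg_ne_zero.2 h.2.2)).subset fun z hz => hz.2.2.2
    · convert Set.finite_empty
      ext z
      simp only [Set.mem_ofPred_eq, Set.mem_empty_iff_false, iff_false]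
      tauto
  refine ((hR₁.prod (hR₂.prod hR₃)).biUnion (t := fun r =>
    (fun z : (𝓞 K)ˣ × (𝓞 K)ˣ => F ((r.1 * z.1 : 𝓞 K) / (r.2.1 * z.2 : 𝓞 K))) '' _)
    fun r _ => (hfin r).image _).subset ?_
  rintro _ ⟨x, ⟨⟨w₁, hw₁⟩, ⟨w₂, hw₂⟩, ⟨w₃, hw₃⟩⟩, rfl⟩
  obtain ⟨r₁, hr₁, hr₁0, u₁, hu₁⟩ := hrep₁ (w₁ - w₂) ⟨w₁ + w₂, by linear_combination hw₁ - hw₂⟩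
  obtain ⟨r₂, hr₂, hr₂0, u₂, hu₂⟩ := hrep₂ (w₂ - w₃) ⟨w₂ + w₃, by linear_combination hw₂ - hw₃⟩
  obtain ⟨r₃, hr₃, hr₃0, u₃, hu₃⟩ := hrep₃ (w₃ - w₁) ⟨w₃ + w₁, by linear_combination hw₃ - hw₁⟩
  simp only [Set.mem_iUnion]
  have huinv : ((u₃⁻¹ : (𝓞 K)ˣ) : 𝓞 K) * u₃ = 1 := by simp
  refine ⟨(r₁, r₂, r₃), ⟨hr₁, hr₂, hr₃⟩, (u₁ * u₃⁻¹, u₂ * u₃⁻¹), ⟨hr₁0, hr₂0, hr₃0, ?_⟩, ?_⟩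
  · push_cast
    have : r₁ * u₁ + r₂ * u₂ = - r₃ * u₃ := by rw [neg_mul, ← hu₁, ← hu₂, ← hu₃]; ring
    linear_combination ((u₃⁻¹ : (𝓞 K)ˣ) : 𝓞 K) * this - r₃ * huinv
  · have hp : w₁ - w₂ ≠ 0 := by rw [hu₁]; exact mul_ne_zero hr₁0 u₁.ne_zero
    have hq : w₂ - w₃ ≠ 0 := by rw [hu₂]; exact mul_ne_zero hr₂0 u₂.ne_zero
    have hs : w₃ - w₁ ≠ 0 := by rw [hu₃]; exact mul_ne_zero hr₃0 u₃.ne_zero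
    have hv : (((u₃⁻¹ : (𝓞 K)ˣ) : 𝓞 K) : K) ≠ 0 := by
      rw [NumberField.RingOfIntegers.coe_ne_zero_iff]; exact Units.ne_zero _
    have e1 := congrArg (algebraMap (𝓞 K) K) hw₁
    have e2 := congrArg (algebraMap (𝓞 K) K) hw₂
    have e3 := congrArg (algebraMap (𝓞 K) K) hw₃
    have e4 := congrArg (algebraMap (𝓞 K) K) hu₁
    have e5 := congrArg (algebraMap (𝓞 K) K) hu₂
    rw [← NumberField.RingOfIntegers.coe_ne_zero_iff] at hp hq hs
    simp only [map_sub, map_mul, map_pow, map_intCast] at e1 e2 e3 e4 e5 hp hq hs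
    have hρ : ((r₁ * (u₁ * u₃⁻¹ : (𝓞 K)ˣ) : 𝓞 K) : K) / ((r₂ * (u₂ * u₃⁻¹ : (𝓞 K)ˣ) : 𝓞 K) : K)
        = (algebraMap (𝓞 K) K w₁ - algebraMap (𝓞 K) K w₂) /
          (algebraMap (𝓞 K) K w₂ - algebraMap (𝓞 K) K w₃) := by
      simp only [Units.val_mul, map_mul, ← mul_assoc, ← e4, ← e5]
      rw [mul_div_mul_right _ _ hv]
    simp only [hρ, hF]
    generalize algebraMap (𝓞 K) K w₁ = a at *
    generalize algebraMap (𝓞 K) K w₂ = b at *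
    generalize algebraMap (𝓞 K) K w₃ = e at *
    have hA : (α₂ : K) - α₁ = (a - b) * (a + b) := by linear_combination e1 - e2
    have hB : (α₃ : K) - α₂ = (b - e) * (b + e) := by linear_combination e2 - e3
    have hρ1 : (a - b) / (b - e) + 1 = (a - e) / (b - e) := by field_simp; ring
    have hae : a - e ≠ 0 := fun h => hs (by linear_combination -h)
    have hden : (a - b) * (a + b) / ((a - b) / (b - e)) - (b - e) * (b + e) =
        (b - e) * (a - e) := by field_simp; ring
    rw [hA, hB, hden, hρ1]
    field_simp
    linear_combination -4 * e2

open UniqueFactorizationMonoid in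
theorem Ideal.eq_sq_mul_prod_odd {R : Type*} [CommRing R] [IsDedekindDomain R]
    [DecidableEq (Ideal R)] {I : Ideal R} (hI : I ≠ 0) :
    I = (∏ p ∈ (normalizedFactors I).toFinset, p ^ ((normalizedFactors I).count p / 2)) ^ 2 *
      ∏ p ∈ (normalizedFactors I).toFinset.filter (fun p => Odd ((normalizedFactors I).count p)),
        p := by
  conv_lhs => rw [← prod_normalizedFactors_eq_self hI, Finset.prod_multiset_count]
  rw [Finset.prod_filter, ← Finset.prod_pow, ← Finset.prod_mul_distrib]
  refine Finset.prod_congr rfl fun p _ => ?_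
  split_ifs with h
  · rw [← pow_mul, ← pow_succ]
    congr 1
    rw [Nat.odd_iff] at h
    omega
  · rw [← pow_mul, mul_one]
    congr 1
    rw [Nat.not_odd_iff] at h
    omega

open NumberField UniqueFactorizationMonoid in
theorem exists_finite_square_class_representatives {K : Type*} [Field K] [NumberField K]
    {N : 𝓞 K} (hN : N ≠ 0) :
    ∃ R : Set (𝓞 K), R.Finite ∧ ∀ x : 𝓞 K, x ≠ 0 →
      (∀ p : Ideal (𝓞 K), Prime p → ¬ p ∣ Ideal.span {N} →
        Even ((normalizedFactors (Ideal.span {x})).count p)) →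
      ∃ r ∈ R, r ≠ 0 ∧ ∃ a b : 𝓞 K, a ≠ 0 ∧ b ≠ 0 ∧ x * a ^ 2 = r * b ^ 2 := by
  classical
  have hN' : Ideal.span {N} ≠ 0 := by simpa using hN
  set A : Set (𝓞 K) := {x | x ≠ 0 ∧ ∀ p : Ideal (𝓞 K), Prime p → ¬ p ∣ Ideal.span {N} →
        Even ((normalizedFactors (Ideal.span {x})).count p)} with hA
  set T : 𝓞 K → Finset (Ideal (𝓞 K)) := fun x =>
    (normalizedFactors (Ideal.span {x})).toFinset.filter
      (fun p => Odd ((normalizedFactors (Ideal.span {x})).count p)) with hT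
  set J : 𝓞 K → Ideal (𝓞 K) := fun x => ∏ p ∈ (normalizedFactors (Ideal.span {x})).toFinset,
    p ^ ((normalizedFactors (Ideal.span {x})).count p / 2) with hJ
  have hJT : ∀ x, x ≠ 0 → Ideal.span {x} = J x ^ 2 * ∏ p ∈ T x, p := fun x hx =>
    Ideal.eq_sq_mul_prod_odd (by simpa using hx)
  have hJ0 : ∀ x, J x ≠ 0 := fun x => Finset.prod_ne_zero_iff.2 fun p hp =>
    pow_ne_zero _ (prime_of_normalized_factor p (Multiset.mem_toFinset.1 hp)).ne_zero
  have hTS : ∀ x ∈ A, T x ∈ (normalizedFactors (Ideal.span {N})).toFinset.powerset := by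
    intro x hx
    rw [Finset.mem_powerset]
    intro p hp
    rw [hT, Finset.mem_filter, Multiset.mem_toFinset] at hp
    have hp' := prime_of_normalized_factor p hp.1
    rw [Multiset.mem_toFinset, mem_normalizedFactors_iff' hN']
    refine ⟨hp'.irreducible, normalize_eq p, ?_⟩
    by_contra h
    exact (Nat.not_even_iff_odd.2 hp.2) (hx.2 p hp' h)
  set f : 𝓞 K → Finset (Ideal (𝓞 K)) × ClassGroup (𝓞 K) := fun x =>
    (T x, ClassGroup.mk0 ⟨J x, mem_nonZeroDivisors_of_ne_zero (hJ0 x)⟩) with hf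
  obtain ⟨B, hBA, hB⟩ := Set.exists_subset_bijOn A f
  have hBfin : B.Finite := by
    refine (hB.finite_iff_finite).2 ((Set.Finite.prod
      ((normalizedFactors (Ideal.span {N})).toFinset.powerset).finite_toSet
      (Set.toFinite (Set.univ : Set (ClassGroup (𝓞 K))))).subset ?_)
    rintro _ ⟨x, hx, rfl⟩
    exact ⟨hTS x hx, trivial⟩
  obtain ⟨U, hU, hrep⟩ := exists_finite_unit_representatives K (n := 2) (by norm_num)
  refine ⟨(fun z : 𝓞 K × (𝓞 K)ˣ => z.1 * z.2) '' (B ×ˢ U), (hBfin.prod hU).image _,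
    fun x hx0 hx => ?_⟩
  obtain ⟨y, hyB, hy⟩ := hB.surjOn ⟨x, ⟨hx0, hx⟩, rfl⟩
  have hy0 := (hBA hyB).1
  simp only [hf, Prod.mk.injEq] at hy
  obtain ⟨a, b, ha, hb, hab⟩ := (ClassGroup.mk0_eq_mk0_iff).1 hy.2
  simp only at hab
  have h1 : Ideal.span {y * a ^ 2} = Ideal.span {x * b ^ 2} := by
    rw [← Ideal.span_singleton_mul_span_singleton, ← Ideal.span_singleton_mul_span_singleton,
      ← Ideal.span_singleton_pow, ← Ideal.span_singleton_pow, hJT x hx0, hJT y hy0, hy.1]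
    calc _ = (Ideal.span {a} * J y) ^ 2 * ∏ p ∈ T x, p := by ring
      _ = _ := by rw [hab]; ring
  obtain ⟨u, hu⟩ := Ideal.span_singleton_eq_span_singleton.1 h1
  obtain ⟨v, hv, w, rfl⟩ := hrep u
  refine ⟨y * v, ⟨(y, v), ⟨hyB, hv⟩, rfl⟩, mul_ne_zero hy0 v.ne_zero, b, a * w, hb,
    mul_ne_zero ha w.ne_zero, ?_⟩
  rw [← hu]
  push_cast
  ring

open NumberField in
theorem finite_int_three_square_classes {K : Type*} [Field K] [NumberField K]
    {α₁ α₂ α₃ r₁ r₂ r₃ : 𝓞 K} (h₁₂ : α₁ ≠ α₂) (h₂₃ : α₂ ≠ α₃) (h₃₁ : α₃ ≠ α₁) :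
    {x : ℤ | (∃ a b : 𝓞 K, a ≠ 0 ∧ ((x : 𝓞 K) - α₁) * a ^ 2 = r₁ * b ^ 2) ∧
      (∃ a b : 𝓞 K, a ≠ 0 ∧ ((x : 𝓞 K) - α₂) * a ^ 2 = r₂ * b ^ 2) ∧
      ∃ a b : 𝓞 K, a ≠ 0 ∧ ((x : 𝓞 K) - α₃) * a ^ 2 = r₃ * b ^ 2}.Finite := by
  set f : 𝓞 K → K[X] := fun r => X ^ 2 - C (r : K) with hf
  set M := (f r₁ * f r₂ * f r₃).SplittingField
  have : NumberField M := NumberField.of_module_finite K M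
  have hf0 : ∀ r, f r ≠ 0 := fun r => X_pow_sub_C_ne_zero (by norm_num) _
  have hsplit : ∀ r, f r ∣ f r₁ * f r₂ * f r₃ → ∃ ρ : M, ρ ^ 2 = algebraMap K M r := by
    intro r hr
    have h1 : ((f r).map (algebraMap K M)).Splits :=
      (SplittingField.splits (f r₁ * f r₂ * f r₃)).of_dvd
        ((Polynomial.map_ne_zero_iff (algebraMap K M).injective).2
          (mul_ne_zero (mul_ne_zero (hf0 _) (hf0 _)) (hf0 _))) (Polynomial.map_dvd _ hr)
    obtain ⟨ρ, hρ⟩ := h1.exists_eval_eq_zero (by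
      rw [degree_map, degree_X_pow_sub_C (by norm_num)]; norm_num)
    refine ⟨ρ, ?_⟩
    simpa [hf, sub_eq_zero] using hρ
  have key : ∀ r α : 𝓞 K, f r ∣ f r₁ * f r₂ * f r₃ → ∀ x : ℤ,
      (∃ a b : 𝓞 K, a ≠ 0 ∧ ((x : 𝓞 K) - α) * a ^ 2 = r * b ^ 2) →
      ∃ w : 𝓞 M, (x : 𝓞 M) - algebraMap (𝓞 K) (𝓞 M) α = w ^ 2 := by
    rintro r α hr x ⟨a, b, ha, hab⟩
    obtain ⟨ρ, hρ⟩ := hsplit r hr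
    have ha' : algebraMap K M (a : K) ≠ 0 := by
      rw [_root_.map_ne_zero, RingOfIntegers.coe_ne_zero_iff]; exact ha
    have h1 : algebraMap K M ((x : K) - α) * (algebraMap K M a) ^ 2 =
        ρ ^ 2 * (algebraMap K M b) ^ 2 := by
      have := congrArg (algebraMap (𝓞 K) K) hab
      simp only [map_mul, map_sub, map_pow, map_intCast] at this
      have := congrArg (algebraMap K M) this
      rw [map_mul, map_mul, map_pow, map_pow] at this
      rw [hρ]
      exact this
    have h2 : (ρ * algebraMap K M b / algebraMap K M a) ^ 2 =
        algebraMap (𝓞 M) M ((x : 𝓞 M) - algebraMap (𝓞 K) (𝓞 M) α) := by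
      rw [div_pow, mul_pow, ← h1, mul_div_assoc, div_self (pow_ne_zero _ ha'), mul_one]
      simp only [map_sub, map_intCast]
      rfl
    have h3 : IsIntegral ℤ (ρ * algebraMap K M b / algebraMap K M a) := by
      refine IsIntegral.of_pow (n := 2) (by norm_num) ?_
      rw [h2]
      exact RingOfIntegers.isIntegral_coe _
    refine ⟨⟨_, h3⟩, RingOfIntegers.coe_injective ?_⟩
    rw [← h2]
    rfl
  have hinj : Function.Injective (algebraMap (𝓞 K) (𝓞 M)) :=
    FaithfulSMul.algebraMap_injective (𝓞 K) (𝓞 M)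
  refine (finite_int_three_squares (hinj.ne h₁₂) (hinj.ne h₂₃) (hinj.ne h₃₁)).subset ?_
  rintro x ⟨hx₁, hx₂, hx₃⟩
  exact ⟨key r₁ α₁ ⟨f r₂ * f r₃, by ring⟩ x hx₁, key r₂ α₂ ⟨f r₁ * f r₃, by ring⟩ x hx₂,
    key r₃ α₃ ⟨f r₁ * f r₂, by ring⟩ x hx₃⟩

open NumberField UniqueFactorizationMonoid in
theorem finite_int_prod_eq_mul_sq {K : Type*} [Field K] [NumberField K] {ι : Type*} [Fintype ι]
    (hι : 3 ≤ Fintype.card ι) {α : ι → 𝓞 K} (hα : Function.Injective α) {e : 𝓞 K} (he : e ≠ 0) :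
    {x : ℤ | ∃ t : 𝓞 K, ∏ i, ((x : 𝓞 K) - α i) = e * t ^ 2}.Finite := by
  classical
  obtain ⟨i₁, i₂, i₃, h₁₂, h₁₃, h₂₃⟩ := Fintype.two_lt_card_iff.1 hι
  set N : 𝓞 K := e * ∏ z ∈ Finset.univ.offDiag, (α z.1 - α z.2) with hN
  have hN0 : N ≠ 0 := mul_ne_zero he (Finset.prod_ne_zero_iff.2 fun z hz =>
    sub_ne_zero.2 (hα.ne (Finset.mem_offDiag.1 hz).2.2))
  obtain ⟨R, hR, hrep⟩ := exists_finite_square_class_representatives hN0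
  have hfin1 : {x : ℤ | ∃ i, (x : 𝓞 K) = α i}.Finite := by
    refine Set.Finite.of_finite_image (f := fun x : ℤ => (x : 𝓞 K))
      ((Set.finite_range α).subset ?_) Int.cast_injective.injOn
    rintro _ ⟨x, ⟨i, hi⟩, rfl⟩
    exact ⟨i, hi.symm⟩
  refine (hfin1.union ((hR.prod (hR.prod hR)).biUnion (t := fun r =>
    {x : ℤ | (∃ a b : 𝓞 K, a ≠ 0 ∧ ((x : 𝓞 K) - α i₁) * a ^ 2 = r.1 * b ^ 2) ∧
      (∃ a b : 𝓞 K, a ≠ 0 ∧ ((x : 𝓞 K) - α i₂) * a ^ 2 = r.2.1 * b ^ 2) ∧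
      ∃ a b : 𝓞 K, a ≠ 0 ∧ ((x : 𝓞 K) - α i₃) * a ^ 2 = r.2.2 * b ^ 2})
    fun r _ => finite_int_three_square_classes (hα.ne h₁₂) (hα.ne h₂₃)
      (hα.ne h₁₃.symm))).subset ?_
  rintro x ⟨t, ht⟩
  by_cases hx : ∃ i, (x : 𝓞 K) = α i
  · exact Or.inl hx
  push Not at hx
  have hx0 : ∀ i, (x : 𝓞 K) - α i ≠ 0 := fun i => sub_ne_zero.2 (hx i)
  have ht0 : t ≠ 0 := by
    rintro rfl
    rw [zero_pow two_ne_zero, mul_zero] at ht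
    exact Finset.prod_ne_zero_iff.2 (fun i _ => hx0 i) ht
  have hcount : ∀ (y z : 𝓞 K) (p : Ideal (𝓞 K)), y ≠ 0 → z ≠ 0 →
      (normalizedFactors (Ideal.span {y * z})).count p =
      (normalizedFactors (Ideal.span {y})).count p +
        (normalizedFactors (Ideal.span {z})).count p := by
    intro y z p hy hz
    rw [← Ideal.span_singleton_mul_span_singleton, normalizedFactors_mul (by simpa using hy)
      (by simpa using hz), Multiset.count_add]
  have hcount0 : ∀ (y : 𝓞 K) (p : Ideal (𝓞 K)), y ∉ p →
      (normalizedFactors (Ideal.span {y})).count p = 0 := by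
    intro y p hy
    rw [Multiset.count_eq_zero]
    intro h
    exact hy ((Ideal.dvd_span_singleton).1 (dvd_of_mem_normalizedFactors h))
  have heven : ∀ i, ∀ p : Ideal (𝓞 K), Prime p → ¬ p ∣ Ideal.span {N} →
      Even ((normalizedFactors (Ideal.span {(x : 𝓞 K) - α i})).count p) := by
    intro i p hp hpN
    have hpp : p.IsPrime := Ideal.isPrime_of_prime hp
    rw [Ideal.dvd_span_singleton] at hpN
    by_cases hxi : (x : 𝓞 K) - α i ∈ p
    · have h1 : ∏ j ∈ Finset.univ.erase i, ((x : 𝓞 K) - α j) ∉ p := by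
        rw [hpp.prod_mem_iff]
        rintro ⟨j, hj, hxj⟩
        apply hpN
        rw [hN]
        refine Ideal.mul_mem_left _ _ ?_
        rw [← Finset.mul_prod_erase _ _ (show (j, i) ∈ Finset.univ.offDiag by
          simpa using (Finset.mem_erase.1 hj).1)]
        refine Ideal.mul_mem_right _ _ ?_
        have := p.sub_mem hxi hxj
        rwa [sub_sub_sub_cancel_left] at this
      have h2 : e ∉ p := fun h => hpN (Ideal.mul_mem_right _ _ h)
      have h3 := congrArg (fun y => (normalizedFactors (Ideal.span {y})).count p) ht
      simp only [← Finset.mul_prod_erase _ _ (Finset.mem_univ i), sq] at h3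
      rw [hcount _ _ _ (hx0 i) (Finset.prod_ne_zero_iff.2 fun j _ => hx0 j), hcount0 _ _ h1,
        hcount _ _ _ he (mul_ne_zero ht0 ht0), hcount0 _ _ h2, hcount _ _ _ ht0 ht0, zero_add,
        add_zero] at h3
      exact ⟨_, h3⟩
    · rw [hcount0 _ _ hxi]
      exact Even.zero
  right
  simp only [Set.mem_iUnion]
  obtain ⟨r₁, hr₁, -, a₁, b₁, ha₁, -, h₁⟩ := hrep _ (hx0 i₁) (heven i₁)
  obtain ⟨r₂, hr₂, -, a₂, b₂, ha₂, -, h₂⟩ := hrep _ (hx0 i₂) (heven i₂)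
  obtain ⟨r₃, hr₃, -, a₃, b₃, ha₃, -, h₃⟩ := hrep _ (hx0 i₃) (heven i₃)
  exact ⟨(r₁, r₂, r₃), ⟨hr₁, hr₂, hr₃⟩, ⟨a₁, b₁, ha₁, h₁⟩, ⟨a₂, b₂, ha₂, h₂⟩, ⟨a₃, b₃, ha₃, h₃⟩⟩

open NumberField in
/-- Siegel's theorem on integral points of `s y² = P(x)`. -/
theorem finite_int_eval_eq_mul_sq {P : ℤ[X]} (hsq : Squarefree (P.map (algebraMap ℤ ℚ)))
    (hdeg : 3 ≤ P.natDegree) {s : ℤ} (hs : s ≠ 0) :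
    {c : ℤ | ∃ t : ℤ, P.eval c = s * t ^ 2}.Finite := by
  classical
  set Q := P.map (algebraMap ℤ ℚ) with hQ
  set K := Q.SplittingField
  have : NumberField K := NumberField.of_module_finite ℚ K
  have hP0 : P ≠ 0 := by rintro rfl; simp at hdeg
  have hℓ : P.leadingCoeff ≠ 0 := leadingCoeff_ne_zero.2 hP0
  have hQdeg : Q.natDegree = P.natDegree :=
    natDegree_map_eq_of_injective (algebraMap ℤ ℚ).injective_int P
  set Z := Q.map (algebraMap ℚ K) with hZ
  have hsplit : Z.Splits := SplittingField.splits Q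
  have hZP : Z = P.map (algebraMap ℤ K) :=
    (Polynomial.map_map (algebraMap ℤ ℚ) (algebraMap ℚ K) P).trans (by congr 1)
  have hnodup : Z.roots.Nodup := nodup_roots ((PerfectField.separable_iff_squarefree.2 hsq).map)
  have hcard : Fintype.card {β // β ∈ Z.roots.toFinset} = P.natDegree := by
    rw [Fintype.card_coe, Multiset.toFinset_card_of_nodup hnodup, ← hsplit.natDegree_eq_card_roots,
      natDegree_map, hQdeg]
  have heval : ∀ x : K, Z.eval x = aeval x P := fun x => by
    rw [hZP, eval_map_algebraMap]
  have hint : ∀ β : {β // β ∈ Z.roots.toFinset}, ∃ α : 𝓞 K, (α : K) = P.leadingCoeff * β.1 := by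
    intro β
    have hr : aeval β.1 P = 0 := by
      rw [← heval]
      exact (mem_roots'.1 (Multiset.mem_toFinset.1 β.2)).2
    have := isIntegral_leadingCoeff_smul P β.1 hr
    exact ⟨⟨_, this⟩, zsmul_eq_mul _ _⟩
  choose α hα using hint
  have hℓK : (P.leadingCoeff : K) ≠ 0 := Int.cast_ne_zero.2 hℓ
  have hαinj : Function.Injective α := by
    intro β γ h
    have := congrArg (algebraMap (𝓞 K) K) h
    simp only [hα] at this
    exact Subtype.ext (mul_left_cancel₀ hℓK this)
  have he : ((P.leadingCoeff : 𝓞 K) ^ (P.natDegree - 1) * s) ≠ 0 := by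
    refine mul_ne_zero (pow_ne_zero _ (Int.cast_ne_zero.2 hℓ)) (Int.cast_ne_zero.2 hs)
  have hfin := finite_int_prod_eq_mul_sq (by rw [hcard]; exact hdeg) hαinj he
  refine Set.Finite.of_finite_image (f := fun c : ℤ => P.leadingCoeff * c) (hfin.subset ?_)
    (mul_right_injective₀ hℓ).injOn
  rintro _ ⟨c, ⟨t, ht⟩, rfl⟩
  refine ⟨(t : 𝓞 K), RingOfIntegers.coe_injective ?_⟩
  have h1 : ((P.eval c : ℤ) : K) = P.leadingCoeff *
      ∏ β : {β // β ∈ Z.roots.toFinset}, ((c : K) - β.1) := by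
    have h2 : Z.eval (c : K) = ((P.eval c : ℤ) : K) := by
      rw [heval]
      exact (aeval_algebraMap_apply K c P).trans (by simp)
    rw [← h2]
    conv_lhs => rw [hsplit.eq_prod_roots]
    rw [eval_mul, eval_C, eval_multiset_prod, Multiset.map_map]
    congr 1
    · rw [hZP, leadingCoeff_map_of_injective (FaithfulSMul.algebraMap_injective ℤ K)]
      simp
    · rw [Finset.prod_coe_sort Z.roots.toFinset (fun β => (c : K) - β), Finset.prod,
        Multiset.toFinset_val, Multiset.dedup_eq_self.2 hnodup]
      congr 1
      exact Multiset.map_congr rfl fun β _ => by simp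
  have h3 : ∏ β, ((P.leadingCoeff : K) * c - α β) = P.leadingCoeff ^ P.natDegree *
      ∏ β : {β // β ∈ Z.roots.toFinset}, ((c : K) - β.1) := by
    rw [← hcard, ← Finset.card_univ, ← Finset.prod_const, ← Finset.prod_mul_distrib]
    exact Finset.prod_congr rfl fun β _ => by rw [hα]; ring
  have h4 : (P.leadingCoeff : K) ^ P.natDegree = P.leadingCoeff ^ (P.natDegree - 1) *
      P.leadingCoeff := by rw [← pow_succ]; congr 1; omega
  simp only [map_prod, map_mul, map_sub, map_intCast, map_pow, Int.cast_mul]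
  have h5 : ((s * t ^ 2 : ℤ) : K) = s * t ^ 2 :=
    (Int.cast_mul _ _).trans (congrArg _ (Int.cast_pow _ _))
  rw [h3, h4, mul_assoc, ← h1, ht]
  exact (congrArg _ h5).trans (mul_assoc _ _ _).symm

theorem exists_eq_mul_sq_of_even_padicValInt {a N : ℤ} (ha : a ≠ 0)
    (h : ∀ p : ℕ, p.Prime → ¬ (p : ℤ) ∣ N → Even (padicValInt p a)) :
    ∃ s t : ℤ, a = s * t ^ 2 ∧ s ∣ N := by
  obtain ⟨s, t, hst, hs⟩ := Nat.sq_mul_squarefree a.natAbs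
  have hs0 : s ≠ 0 := hs.ne_zero
  have ht0 : t ≠ 0 := by
    rintro rfl
    apply ha
    rw [← Int.natAbs_eq_zero, ← hst]
    ring
  refine ⟨a.sign * s, t, ?_, ?_⟩
  · conv_lhs => rw [← Int.sign_mul_natAbs a, ← hst]
    push_cast
    ring
  · have h1 : (s : ℤ) ∣ N := by
      rw [Int.natCast_dvd, ← Nat.prod_primeFactors_of_squarefree hs]
      refine Finset.prod_primes_dvd _ (fun p hp => (Nat.prime_of_mem_primeFactors hp).prime)
        fun p hp' => ?_
      have hp := Nat.prime_of_mem_primeFactors hp'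
      have hps := Nat.dvd_of_mem_primeFactors hp'
      rw [← Int.natCast_dvd]
      by_contra hpN
      have := Fact.mk hp
      have h2 := h p hp hpN
      rw [padicValInt, ← hst, padicValNat.mul (pow_ne_zero _ ht0) hs0, padicValNat.pow,
        Nat.even_add] at h2
      have h3 : padicValNat p s = 1 := by
        have h4 := hs.natFactorization_le_one p
        rw [Nat.factorization_def _ hp] at h4
        have h5 := one_le_padicValNat_of_dvd hs0 hps
        omega
      rw [h3] at h2
      simp at h2
    rcases lt_trichotomy a 0 with h2 | h2 | h2
    · rw [Int.sign_eq_neg_one_of_neg h2]; simpa using h1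
    · exact absurd h2 ha
    · rw [Int.sign_eq_one_of_pos h2]; simpa using h1

theorem Polynomial.squarefree_map_rat_of_map_zmod {P : ℤ[X]} {p : ℕ} [Fact p.Prime]
    (hsq : Squarefree (P.map (Int.castRingHom (ZMod p))))
    (hdeg : (P.map (Int.castRingHom (ZMod p))).natDegree = P.natDegree) :
    Squarefree (P.map (algebraMap ℤ ℚ)) := by
  have hP0 : P ≠ 0 := by rintro rfl; simp at hsq
  intro f hf
  have hf0 : f ≠ 0 := by
    rintro rfl
    rw [zero_mul, zero_dvd_iff, Polynomial.map_eq_zero_iff (algebraMap ℤ ℚ).injective_int] at hf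
    exact hP0 hf
  set g := IsLocalization.integerNormalization (nonZeroDivisors ℤ) f with hg
  obtain ⟨b, hbm, hb⟩ := IsLocalization.integerNormalization_spec (nonZeroDivisors ℤ) f
  have hb0 : algebraMap ℤ ℚ b ≠ 0 := by
    simpa using nonZeroDivisors.ne_zero hbm
  have hgf : g.map (algebraMap ℤ ℚ) = C (algebraMap ℤ ℚ b) * f := by
    rw [hb, ← smul_eq_C_mul, algebraMap_smul]
  have hg0 : g ≠ 0 := by
    intro h
    rw [h, Polynomial.map_zero, eq_comm, mul_eq_zero, C_eq_zero] at hgf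
    tauto
  set q := g.primPart
  have hq : q.IsPrimitive := g.isPrimitive_primPart
  have hqf : q.map (algebraMap ℤ ℚ) ∣ f := by
    have h1 : q.map (algebraMap ℤ ℚ) ∣ g.map (algebraMap ℤ ℚ) :=
      Polynomial.map_dvd _ g.primPart_dvd
    rw [hgf] at h1
    exact (IsUnit.dvd_mul_left (by rwa [isUnit_C, isUnit_iff_ne_zero])).1 h1
  have hqdeg : q.natDegree = f.natDegree := by
    rw [natDegree_primPart, ← natDegree_map_eq_of_injective (algebraMap ℤ ℚ).injective_int g, hgf,
      natDegree_C_mul hb0]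
  have hqP : q * q ∣ P := by
    refine (hq.mul hq).dvd_of_fraction_map_dvd_fraction_map (K := ℚ) ?_
    rw [Polynomial.map_mul]
    exact (mul_dvd_mul hqf hqf).trans hf
  obtain ⟨h, hh⟩ := hqP
  have h1 := hsq (q.map (Int.castRingHom (ZMod p))) (by
    rw [← Polynomial.map_mul, hh]; exact Polynomial.map_dvd _ (dvd_mul_right _ _))
  have h2 := natDegree_eq_zero_of_isUnit h1
  have hq0 : q ≠ 0 := hq.ne_zero
  have hh0 : h ≠ 0 := by rintro rfl; rw [mul_zero] at hh; exact hP0 hh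
  have h3 : P.natDegree ≤ h.natDegree := by
    rw [← hdeg, hh, Polynomial.map_mul, Polynomial.map_mul]
    refine natDegree_mul_le.trans ((add_le_add_left natDegree_mul_le _).trans ?_)
    rw [h2, zero_add, zero_add]
    exact natDegree_map_le
  have h4 : P.natDegree = q.natDegree + q.natDegree + h.natDegree := by
    rw [hh, natDegree_mul (mul_ne_zero hq0 hq0) hh0, natDegree_mul hq0 hq0]
  rw [Polynomial.isUnit_iff_degree_eq_zero, degree_eq_natDegree hf0, ← hqdeg]
  norm_cast
  omega

/-- The orbit of the critical point `0` under `φ_{(d,c)}`. -/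
noncomputable def critOrbit (d c m : ℕ) : ℤ := (polyIter (phiDC d c) m).eval 0

theorem critOrbit_zero (d c : ℕ) : critOrbit d c 0 = 0 := by simp [critOrbit, polyIter]

theorem critOrbit_succ (d c m : ℕ) : critOrbit d c (m + 1) = critOrbit d c m ^ d -
    c * d * critOrbit d c m ^ (d - 1) + c * (d - 1) := by
  simp [critOrbit, polyIter, phiDC]

/-- The orbit of `0` under `φ_{(d,c)}` as a family of polynomials in the parameter `c`. -/
noncomputable def critOrbitPoly (d : ℕ) : ℕ → ℤ[X]
  | 0 => 0
  | m + 1 => critOrbitPoly d m ^ d - C (d : ℤ) * X * critOrbitPoly d m ^ (d - 1) +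
      C ((d : ℤ) - 1) * X

theorem eval_critOrbitPoly (d c m : ℕ) : (critOrbitPoly d m).eval (c : ℤ) = critOrbit d c m := by
  induction m with
  | zero => simp [critOrbitPoly, critOrbit_zero]
  | succ m ih =>
    rw [critOrbit_succ, ← ih]
    simp [critOrbitPoly]
    ring

theorem critOrbitPoly_one {d : ℕ} (hd : 3 ≤ d) : critOrbitPoly d 1 = C ((d : ℤ) - 1) * X := by
  simp [critOrbitPoly, show d ≠ 0 by omega, show d - 1 ≠ 0 by omega]

theorem critOrbit_one {d : ℕ} (hd : 3 ≤ d) (c : ℕ) : critOrbit d c 1 = c * (d - 1) := by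
  simp [critOrbit_succ, critOrbit_zero, show d ≠ 0 by omega, show d - 1 ≠ 0 by omega]

theorem natDegree_critOrbitPoly_le {d : ℕ} (hd : 3 ≤ d) (m : ℕ) :
    (critOrbitPoly d (m + 1)).natDegree ≤ d ^ m := by
  induction m with
  | zero => rw [critOrbitPoly_one hd]; exact natDegree_C_mul_le _ _ |>.trans natDegree_X_le
  | succ m ih =>
    have h1 : 1 ≤ d ^ m := Nat.one_le_pow _ _ (by omega)
    have hpow : d ^ (m + 1) = d * d ^ m := by ring
    have hsub : (d - 1) * d ^ m + d ^ m = d * d ^ m := by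
      rw [← Nat.succ_mul, Nat.succ_eq_add_one, Nat.sub_add_cancel (by omega)]
    rw [critOrbitPoly]
    refine natDegree_add_le_of_degree_le ((natDegree_sub_le_of_le ?_ ?_).trans
      (max_self _).le) ?_
    · rw [hpow]
      exact natDegree_pow_le_of_le d ih
    · rw [hpow, mul_assoc]
      refine (natDegree_C_mul_le _ _).trans (natDegree_mul_le.trans ?_)
      have := natDegree_pow_le_of_le (d - 1) ih
      have := natDegree_X_le (R := ℤ)
      omega
    · refine (natDegree_C_mul_le _ _).trans (natDegree_X_le.trans ?_)
      exact Nat.one_le_pow _ _ (by omega)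

theorem map_zmod_critOrbitPoly_succ {d p : ℕ} (hpd : p ∣ d) (m : ℕ) :
    (critOrbitPoly d (m + 1)).map (Int.castRingHom (ZMod p)) =
      (critOrbitPoly d m).map (Int.castRingHom (ZMod p)) ^ d - X := by
  have h0 : ((d : ℕ) : ZMod p) = 0 := (ZMod.natCast_eq_zero_iff d p).2 hpd
  simp [critOrbitPoly, Polynomial.map_sub, Polynomial.map_add, Polynomial.map_mul,
    Polynomial.map_pow]
  have : ((d : ℕ) : (ZMod p)[X]) = 0 := by rw [← C_eq_natCast, h0, C_0]
  rw [this]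
  ring

theorem natDegree_map_zmod_critOrbitPoly {d p : ℕ} [Fact p.Prime] (hd : 3 ≤ d) (hpd : p ∣ d)
    (m : ℕ) : ((critOrbitPoly d (m + 1)).map (Int.castRingHom (ZMod p))).natDegree = d ^ m := by
  induction m with
  | zero =>
    rw [map_zmod_critOrbitPoly_succ hpd]
    simp [critOrbitPoly, show d ≠ 0 by omega]
  | succ m ih =>
    have h1 : 1 ≤ d ^ m := Nat.one_le_pow _ _ (by omega)
    have hpow : d ^ (m + 1) = d * d ^ m := by ring
    rw [map_zmod_critOrbitPoly_succ hpd, natDegree_sub_eq_left_of_natDegree_lt, natDegree_pow, ih,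
      hpow]
    rw [natDegree_pow, ih, natDegree_X]
    nlinarith

theorem natDegree_critOrbitPoly {d : ℕ} (hd : 3 ≤ d) (m : ℕ) :
    (critOrbitPoly d (m + 1)).natDegree = d ^ m := by
  obtain ⟨p, hp, hpd⟩ := Nat.exists_prime_and_dvd (show d ≠ 1 by omega)
  have := Fact.mk hp
  refine le_antisymm (natDegree_critOrbitPoly_le hd m) ?_
  rw [← natDegree_map_zmod_critOrbitPoly hd hpd m]
  exact natDegree_map_le

theorem squarefree_critOrbitPoly {d : ℕ} (hd : 3 ≤ d) (m : ℕ) :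
    Squarefree ((critOrbitPoly d (m + 1)).map (algebraMap ℤ ℚ)) := by
  obtain ⟨p, hp, hpd⟩ := Nat.exists_prime_and_dvd (show d ≠ 1 by omega)
  have := Fact.mk hp
  refine squarefree_map_rat_of_map_zmod (p := p) (Separable.squarefree ?_) (by
    rw [natDegree_map_zmod_critOrbitPoly hd hpd, natDegree_critOrbitPoly hd])
  have h0 : ((d : ℕ) : (ZMod p)[X]) = 0 := by
    rw [← C_eq_natCast, (ZMod.natCast_eq_zero_iff d p).2 hpd, C_0]
  have : derivative ((critOrbitPoly d (m + 1)).map (Int.castRingHom (ZMod p))) = -1 := by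
    rw [map_zmod_critOrbitPoly_succ hpd, derivative_sub, derivative_pow, derivative_X]
    simp [h0]
  rw [separable_def, this]
  exact ⟨0, -1, by ring⟩

theorem Polynomial.exists_map_eq_C_mul (f : ℚ[X]) :
    ∃ (b : ℤ) (g : ℤ[X]), b ≠ 0 ∧ g.map (algebraMap ℤ ℚ) = C (b : ℚ) * f := by
  obtain ⟨b, hbm, hb⟩ := IsLocalization.integerNormalization_spec (nonZeroDivisors ℤ) f
  refine ⟨b, IsLocalization.integerNormalization (nonZeroDivisors ℤ) f,
    nonZeroDivisors.ne_zero hbm, ?_⟩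
  rw [hb, ← smul_eq_C_mul, ← algebraMap_smul ℚ b f]
  simp

theorem padicValInt_eq_zero_of_not_dvd {p : ℕ} {a : ℤ} (h : ¬ (p : ℤ) ∣ a) :
    padicValInt p a = 0 := by
  rw [padicValInt]
  exact padicValNat.eq_zero_of_not_dvd (by rwa [← Int.natCast_dvd])

theorem finite_int_even_padicValInt_eval {G T : ℤ[X]}
    (hG : Squarefree (G.map (algebraMap ℤ ℚ))) (hT : T ≠ 0)
    (hdeg : T.natDegree + 3 ≤ G.natDegree) {M : ℤ} (hM : M ≠ 0) :
    {c : ℤ | ∀ p : ℕ, p.Prime → ¬ (p : ℤ) ∣ M → ¬ (p : ℤ) ∣ T.eval c →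
      Even (padicValInt p (G.eval c))}.Finite := by
  classical
  have hinj : Function.Injective (algebraMap ℤ ℚ) := (algebraMap ℤ ℚ).injective_int
  set Gq := G.map (algebraMap ℤ ℚ) with hGq
  set Tq := T.map (algebraMap ℤ ℚ) with hTq
  have hGq0 : Gq ≠ 0 := hG.ne_zero
  have hTq0 : Tq ≠ 0 := (Polynomial.map_ne_zero_iff hinj).2 hT
  set g := EuclideanDomain.gcd Gq Tq with hg
  obtain ⟨Pq, hPq⟩ : g ∣ Gq := EuclideanDomain.gcd_dvd_left _ _
  obtain ⟨Wq, hWq⟩ : g ∣ Tq := EuclideanDomain.gcd_dvd_right _ _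
  have hg0 : g ≠ 0 := by intro h; rw [h, zero_mul] at hPq; exact hGq0 hPq
  have hPq0 : Pq ≠ 0 := by intro h; rw [h, mul_zero] at hPq; exact hGq0 hPq
  have hWq0 : Wq ≠ 0 := by intro h; rw [h, mul_zero] at hWq; exact hTq0 hWq
  have hPqsq : Squarefree Pq := hG.squarefree_of_dvd (hPq ▸ dvd_mul_left _ _)
  have hcop : IsCoprime Pq Tq := by
    refine isCoprime_of_prime_dvd (fun h => hPq0 h.1) fun z hz h1 h2 => ?_
    have h3 : z ∣ g := EuclideanDomain.dvd_gcd (h1.trans (hPq ▸ dvd_mul_left _ _)) h2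
    exact hz.not_isUnit (hG z (by rw [hPq]; exact mul_dvd_mul h3 h1))
  obtain ⟨u, v, huv⟩ := hcop
  obtain ⟨b₁, P, hb₁, hP⟩ := exists_map_eq_C_mul Pq
  obtain ⟨b₂, Q, hb₂, hQ⟩ := exists_map_eq_C_mul g
  obtain ⟨b₃, W, hb₃, hW⟩ := exists_map_eq_C_mul Wq
  obtain ⟨b₄, U, hb₄, hU⟩ := exists_map_eq_C_mul u
  obtain ⟨b₅, V, hb₅, hV⟩ := exists_map_eq_C_mul v
  have hPQ : C (b₁ * b₂) * G = P * Q := by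
    apply Polynomial.map_injective _ hinj
    simp only [Polynomial.map_mul, map_C, hP, hQ, ← hGq, hPq, C_mul, eq_intCast (algebraMap ℤ ℚ)]
    ring
  have hQW : C (b₂ * b₃) * T = Q * W := by
    apply Polynomial.map_injective _ hinj
    simp only [Polynomial.map_mul, map_C, hQ, hW, ← hTq, hWq, C_mul, eq_intCast (algebraMap ℤ ℚ)]
    ring
  have hUV : C b₅ * U * P + C (b₁ * b₄) * V * T = C (b₁ * b₄ * b₅) := by
    apply Polynomial.map_injective _ hinj
    simp only [Polynomial.map_mul, Polynomial.map_add, map_C, hP, hU, hV, ← hTq, C_mul,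
      eq_intCast (algebraMap ℤ ℚ)]
    linear_combination C (b₁ : ℚ) * C (b₄ : ℚ) * C (b₅ : ℚ) * huv
  have hb₁' : (b₁ : ℚ) ≠ 0 := by exact_mod_cast hb₁
  have hPsq : Squarefree (P.map (algebraMap ℤ ℚ)) := by
    rw [hP]
    exact ((associated_unit_mul_left Pq _ (isUnit_C.2 hb₁'.isUnit)).squarefree_iff).2 hPqsq
  have hPdeg : 3 ≤ P.natDegree := by
    have h1 : P.natDegree = Pq.natDegree := by
      rw [← natDegree_map_eq_of_injective hinj P, hP, natDegree_C_mul hb₁']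
    have h2 : G.natDegree = g.natDegree + Pq.natDegree := by
      rw [← natDegree_map_eq_of_injective hinj G, ← hGq, hPq, natDegree_mul hg0 hPq0]
    have h3 : T.natDegree = g.natDegree + Wq.natDegree := by
      rw [← natDegree_map_eq_of_injective hinj T, ← hTq, hWq, natDegree_mul hg0 hWq0]
    omega
  set S := M * b₁ * b₂ * b₃ * b₄ * b₅ with hS
  have hS0 : S ≠ 0 := by simp [hS, hM, hb₁, hb₂, hb₃, hb₄, hb₅]
  have hP0 : P ≠ 0 := by rintro rfl; simp at hPdeg
  have hfin : ({c : ℤ | P.eval c = 0} ∪ ⋃ s ∈ {s : ℤ | s ∣ S},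
      {c : ℤ | ∃ t : ℤ, P.eval c = s * t ^ 2}).Finite := by
    refine (finite_setOfPred_isRoot hP0).union (Set.Finite.biUnion ?_ fun s hs => ?_)
    · refine (Set.finite_Icc (-|S|) |S|).subset fun s hs => ?_
      exact abs_le.1 (Int.le_of_dvd (abs_pos.2 hS0) (by simpa using hs))
    · refine finite_int_eval_eq_mul_sq hPsq hPdeg ?_
      rintro rfl
      exact hS0 (zero_dvd_iff.1 hs)
  refine hfin.subset fun c hc => ?_
  by_cases hPc : P.eval c = 0
  · exact Or.inl hPc
  refine Or.inr ?_
  suffices h : ∀ p : ℕ, p.Prime → ¬ (p : ℤ) ∣ S → Even (padicValInt p (P.eval c)) by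
    obtain ⟨s, t, hst, hs⟩ := exists_eq_mul_sq_of_even_padicValInt hPc h
    exact Set.mem_biUnion (show s ∈ {s : ℤ | s ∣ S} from hs) ⟨t, hst⟩
  intro p hp hpS
  have := Fact.mk hp
  have hp' : Prime (p : ℤ) := Nat.prime_iff_prime_int.1 hp
  by_cases hpP : (p : ℤ) ∣ P.eval c
  swap
  · rw [padicValInt_eq_zero_of_not_dvd hpP]; exact Even.zero
  simp only [hS, hp'.dvd_mul, not_or] at hpS
  obtain ⟨⟨⟨⟨⟨hpM, hp₁⟩, hp₂⟩, hp₃⟩, hp₄⟩, hp₅⟩ := hpS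
  have hpT : ¬ (p : ℤ) ∣ T.eval c := by
    intro h
    have h1 := congrArg (eval c) hUV
    simp only [eval_add, eval_mul, eval_C] at h1
    have h2 : (p : ℤ) ∣ b₁ * b₄ * b₅ := by
      rw [← h1]
      exact dvd_add (hpP.mul_left _) (h.mul_left _)
    simp only [hp'.dvd_mul] at h2
    tauto
  have hpQ : ¬ (p : ℤ) ∣ Q.eval c := by
    intro h
    have h1 := congrArg (eval c) hQW
    simp only [eval_mul, eval_C] at h1
    have h2 : (p : ℤ) ∣ b₂ * b₃ * T.eval c := by
      rw [h1]
      exact h.mul_right _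
    simp only [hp'.dvd_mul] at h2
    tauto
  have h1 := congrArg (eval c) hPQ
  simp only [eval_mul, eval_C] at h1
  have hQ0 : Q.eval c ≠ 0 := by intro h; rw [h] at hpQ; simp at hpQ
  have hG0 : G.eval c ≠ 0 := by
    intro h
    rw [h, mul_zero] at h1
    exact mul_ne_zero hPc hQ0 h1.symm
  have h2 := congrArg (padicValInt p) h1
  rw [padicValInt.mul (mul_ne_zero hb₁ hb₂) hG0, padicValInt.mul hPc hQ0,
    padicValInt.mul hb₁ hb₂, padicValInt_eq_zero_of_not_dvd hp₁,
    padicValInt_eq_zero_of_not_dvd hp₂, padicValInt_eq_zero_of_not_dvd hpQ] at h2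
  have h3 := hc p hp hpM hpT
  rw [show padicValInt p (P.eval c) = padicValInt p (G.eval c) by omega]
  exact h3

theorem critOrbit_add_modEq (d c m j : ℕ) :
    critOrbit d c (m + j) ≡ critOrbit d c m [ZMOD critOrbit d c j] := by
  induction m with
  | zero => rw [critOrbit_zero, zero_add]; exact (Int.modEq_zero_iff_dvd.2 dvd_rfl)
  | succ m ih =>
    rw [add_right_comm, critOrbit_succ, critOrbit_succ]
    gcongr

theorem exists_dvd_critOrbit_le_half {d c m : ℕ} {p : ℤ} (hpm : p ∣ critOrbit d c m) {j : ℕ}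
    (hj : 1 ≤ j) (hjm : j < m) (hpj : p ∣ critOrbit d c j) :
    ∃ i, 1 ≤ i ∧ i ≤ m / 2 ∧ p ∣ critOrbit d c i := by
  by_cases h : j ≤ m / 2
  · exact ⟨j, hj, h, hpj⟩
  · refine ⟨m - j, by omega, by omega, ?_⟩
    have h1 := critOrbit_add_modEq d c (m - j) j
    rw [Nat.sub_add_cancel hjm.le] at h1
    have h2 := (h1.of_dvd hpj)
    exact (Int.modEq_zero_iff_dvd.1 (h2.symm.trans (Int.modEq_zero_iff_dvd.2 hpm)))

/-- A prime witnessing that the discriminant of the `m`-th iterate contributes new ramification: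
it does not divide `d` nor earlier elements of the critical orbit, but divides
`critOrbit d c m` to an odd power. -/
def IsGoodPrime (d c m p : ℕ) : Prop :=
  p.Prime ∧ ¬ p ∣ d ∧ (∀ j, 1 ≤ j → j < m → ¬ (p : ℤ) ∣ critOrbit d c j) ∧
    Odd (padicValInt p (critOrbit d c m))

theorem even_padicValInt_of_not_exists_isGoodPrime {d c m p : ℕ}
    (h : ¬ ∃ p, IsGoodPrime d c m p) (hp : p.Prime) (hpd : ¬ (p : ℤ) ∣ d)
    (hpj : ¬ (p : ℤ) ∣ ∏ j ∈ Finset.Icc 1 (m / 2), critOrbit d c j) :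
    Even (padicValInt p (critOrbit d c m)) := by
  by_cases hpm : (p : ℤ) ∣ critOrbit d c m
  swap
  · rw [padicValInt_eq_zero_of_not_dvd hpm]; exact Even.zero
  by_contra hodd
  refine h ⟨p, hp, by exact_mod_cast hpd, fun j hj hjm hpj' => ?_, Nat.not_even_iff_odd.1 hodd⟩
  obtain ⟨i, hi, him, hpi⟩ := exists_dvd_critOrbit_le_half hpm hj hjm hpj'
  exact hpj (hpi.trans (Finset.dvd_prod_of_mem _ (Finset.mem_Icc.2 ⟨hi, him⟩)))

theorem finite_not_exists_isGoodPrime {d m : ℕ} (hd : 3 ≤ d) (hm : 2 ≤ m)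
    (hdm : d ≠ 3 ∨ m ≠ 2) : {c : ℕ | ¬ ∃ p, IsGoodPrime d c m p}.Finite := by
  obtain ⟨m, rfl⟩ : ∃ k, m = k + 1 := ⟨m - 1, by omega⟩
  set T := ∏ j ∈ Finset.Icc 1 ((m + 1) / 2), critOrbitPoly d j with hTdef
  have hG0 : ∀ j, critOrbitPoly d (j + 1) ≠ 0 := fun j h => by
    have := (squarefree_critOrbitPoly hd j).ne_zero
    rw [h, Polynomial.map_zero] at this
    exact this rfl
  have hT0 : T ≠ 0 := by
    refine Finset.prod_ne_zero_iff.2 fun j hj => ?_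
    rw [Finset.mem_Icc] at hj
    rw [show j = j - 1 + 1 by omega]
    exact hG0 _
  have hTdeg : T.natDegree + 3 ≤ d ^ m := by
    rcases Nat.lt_or_ge m 3 with h | h
    · have hm' : m = 1 ∨ m = 2 := by omega
      rcases hm' with rfl | rfl
      · rw [hTdef, show (1 + 1) / 2 = 1 by rfl, Finset.Icc_self, Finset.prod_singleton,
          natDegree_critOrbitPoly hd 0]
        simp
        omega
      · rw [hTdef, show (2 + 1) / 2 = 1 by rfl, Finset.Icc_self, Finset.prod_singleton,
          natDegree_critOrbitPoly hd 0]
        nlinarith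
    · have h1 : T.natDegree < d ^ ((m + 1) / 2) := by
        rw [hTdef, natDegree_prod _ _ fun j hj => by
          rw [Finset.mem_Icc] at hj
          rw [show j = j - 1 + 1 by omega]
          exact hG0 _]
        have h2 : ∑ j ∈ Finset.Icc 1 ((m + 1) / 2), (critOrbitPoly d j).natDegree =
            ∑ j ∈ Finset.range ((m + 1) / 2), d ^ j := by
          rw [Finset.range_eq_Ico, ← Finset.Ico_add_one_right_eq_Icc,
            show Finset.Ico 1 ((m + 1) / 2 + 1) = Finset.Ico (0 + 1) ((m + 1) / 2 + 1) from rfl,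
            ← Finset.sum_Ico_add']
          simp only [natDegree_critOrbitPoly hd]
        rw [h2]
        exact Nat.geomSum_lt (by omega) fun k hk => Finset.mem_range.1 hk
      have h2 : d ^ ((m + 1) / 2) * d ≤ d ^ m := by
        rw [← pow_succ]
        exact Nat.pow_le_pow_right (by omega) (by omega)
      have h3 : 3 ≤ d ^ ((m + 1) / 2) :=
        hd.trans (Nat.le_self_pow (by omega) d)
      nlinarith
  have hfin := finite_int_even_padicValInt_eval (squarefree_critOrbitPoly hd m) hT0
    (by rwa [natDegree_critOrbitPoly hd]) (M := d) (by exact_mod_cast (by omega : d ≠ 0))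
  refine (hfin.preimage (f := ((↑) : ℕ → ℤ)) (Nat.cast_injective.injOn)).subset fun c hc => ?_
  intro p hp hpd hpT
  rw [eval_critOrbitPoly]
  refine even_padicValInt_of_not_exists_isGoodPrime hc hp hpd ?_
  rw [hTdef, eval_prod] at hpT
  simpa only [eval_critOrbitPoly] using hpT

theorem natDegree_phiDC {d : ℕ} (hd : 3 ≤ d) (c : ℕ) : (phiDC d c).natDegree = d := by
  rw [phiDC, natDegree_add_C, natDegree_sub_eq_left_of_natDegree_lt, natDegree_X_pow]
  rw [natDegree_X_pow]
  exact (natDegree_C_mul_X_pow_le _ _).trans_lt (by omega)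

theorem monic_phiDC {d : ℕ} (hd : 3 ≤ d) (c : ℕ) : (phiDC d c).Monic := by
  rw [Monic, leadingCoeff, natDegree_phiDC hd]
  rw [phiDC, coeff_add, coeff_sub, coeff_X_pow_self, coeff_C_mul_X_pow, coeff_C,
    if_neg (by omega), if_neg (by omega), sub_zero, add_zero]

theorem natDegree_polyIter {R : Type*} [CommRing R] [NoZeroDivisors R] [Nontrivial R]
    (φ : R[X]) (n : ℕ) : (polyIter φ n).natDegree = φ.natDegree ^ n := by
  induction n with
  | zero => simp [polyIter]
  | succ n ih => rw [polyIter, natDegree_comp, ih, pow_succ']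

theorem critOrbit_ne_zero {d c m : ℕ} (hd : 3 ≤ d) (hm : 1 ≤ m)
    (hirr : Irreducible ((polyIter (phiDC d c) m).map (algebraMap ℤ ℚ))) :
    critOrbit d c m ≠ 0 := by
  intro h
  have h1 : IsRoot ((polyIter (phiDC d c) m).map (algebraMap ℤ ℚ)) 0 := by
    rw [critOrbit] at h
    rw [IsRoot, ← map_zero (algebraMap ℤ ℚ), eval_map_apply, h, map_zero]
  have h2 := degree_eq_one_of_irreducible_of_root hirr h1
  have h3 : _ = 1 := natDegree_eq_of_degree_eq_some h2
  rw [natDegree_map_eq_of_injective (algebraMap ℤ ℚ).injective_int,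
    natDegree_polyIter, natDegree_phiDC hd] at h3
  have := Nat.le_self_pow (show m ≠ 0 by omega) d
  omega

theorem abs_critOrbit_le {d c : ℕ} (hd : 3 ≤ d) (hc : 1 ≤ c) (j : ℕ) :
    |critOrbit d c (j + 1)| + c * d ≤ (2 * d * c) ^ d ^ j := by
  have hcd : (3 : ℤ) ≤ c * d := by
    have : 1 * 3 ≤ c * d := Nat.mul_le_mul hc hd
    exact_mod_cast this
  have hc' : (1 : ℤ) ≤ c := by exact_mod_cast hc
  have hd' : (3 : ℤ) ≤ d := by exact_mod_cast hd
  induction j with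
  | zero =>
    rw [critOrbit_one hd, abs_of_nonneg (by nlinarith)]
    simp
    nlinarith
  | succ j ih =>
    set x := critOrbit d c (j + 1) with hx
    obtain ⟨e, rfl⟩ : ∃ e, d = e + 1 := ⟨d - 1, by omega⟩
    have h1 : |critOrbit (e + 1) c (j + 1 + 1)| ≤
        |x| ^ e * (|x| + c * (e + 1 : ℕ)) + c * e := by
      rw [critOrbit_succ, ← hx]
      have : x ^ (e + 1) - c * (e + 1 : ℕ) * x ^ (e + 1 - 1) + c * (((e + 1 : ℕ) : ℤ) - 1) =
          x ^ e * (x - c * (e + 1 : ℕ)) + c * e := by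
        simp; ring
      rw [this]
      refine (abs_add_le _ _).trans (add_le_add ?_ (abs_of_nonneg (by positivity)).le)
      rw [abs_mul, abs_pow]
      refine mul_le_mul_of_nonneg_left ?_ (by positivity)
      refine (abs_sub _ _).trans (by rw [abs_of_nonneg (by positivity : (0 : ℤ) ≤ c * (e + 1 : ℕ))])
    have h2 : |x| ^ e + (c * (e + 1 : ℕ) : ℤ) ^ e ≤ (|x| + c * (e + 1 : ℕ)) ^ e :=
      pow_add_pow_le (abs_nonneg _) (by positivity) (by omega)
    have h3 : (|x| + c * (e + 1 : ℕ)) ^ (e + 1) ≤ (2 * (e + 1 : ℕ) * c) ^ (e + 1) ^ (j + 1) := by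
      rw [pow_succ (e + 1) j, pow_mul]
      exact pow_le_pow_left₀ (by positivity) ih _
    refine le_trans ?_ h3
    have h4 : (c * (e + 1 : ℕ) : ℤ) ≤ (c * (e + 1 : ℕ) : ℤ) ^ e :=
      le_self_pow₀ (by linarith) (by omega)
    rw [pow_succ]
    have h5 := abs_nonneg x
    push_cast at *
    set D : ℤ := c * (e + 1) with hD
    have : (c * e : ℤ) ≤ D := by rw [hD]; nlinarith
    nlinarith [mul_le_mul_of_nonneg_right h2 (by positivity : 0 ≤ |x| + D)]

theorem le_abs_critOrbit {d c : ℕ} (hd : 3 ≤ d) (hc : 2 ≤ c) (j : ℕ) :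
    (c * d : ℤ) + (2 * d * c) ^ d ^ j ≤ |critOrbit d c (j + 2)| := by
  have hcd : (6 : ℤ) ≤ c * d := by
    have : 2 * 3 ≤ c * d := Nat.mul_le_mul hc hd
    exact_mod_cast this
  have hc' : (2 : ℤ) ≤ c := by exact_mod_cast hc
  have hd' : (3 : ℤ) ≤ d := by exact_mod_cast hd
  induction j with
  | zero =>
    obtain ⟨e, rfl⟩ : ∃ e, d = e + 1 := ⟨d - 1, by omega⟩
    rw [critOrbit_succ, critOrbit_one hd]
    have h0 : ((c : ℤ) * (((e + 1 : ℕ) : ℤ) - 1)) ^ (e + 1) - c * (e + 1 : ℕ) *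
        ((c : ℤ) * (((e + 1 : ℕ) : ℤ) - 1)) ^ (e + 1 - 1) + c * (((e + 1 : ℕ) : ℤ) - 1) =
        - (c * ((c * e) ^ e - e)) := by
      simp; ring
    rw [h0, abs_neg]
    refine le_trans ?_ (le_abs_self _)
    have h1 : ((c : ℤ) * e) ^ 2 ≤ (c * e) ^ e := by
      refine pow_le_pow_right₀ ?_ (by omega)
      push_cast at hd'
      nlinarith
    push_cast at *
    have h3 : (4 * (e + 1) : ℤ) ≤ (c * e) ^ e := by
      refine le_trans ?_ h1
      nlinarith [mul_le_mul hc' hc' (by norm_num) (by linarith), sq_nonneg ((e : ℤ) - 2)]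
    rw [pow_zero, pow_one]
    nlinarith [mul_le_mul_of_nonneg_left h3 (by linarith : (0 : ℤ) ≤ c)]
  | succ j ih =>
    set x := critOrbit d c (j + 2) with hx
    obtain ⟨e, rfl⟩ : ∃ e, d = e + 1 := ⟨d - 1, by omega⟩
    have h1 : |x| ^ e * (|x| - c * (e + 1 : ℕ)) - c * e ≤
        |critOrbit (e + 1) c (j + 2 + 1)| := by
      rw [critOrbit_succ, ← hx]
      have : x ^ (e + 1) - c * (e + 1 : ℕ) * x ^ (e + 1 - 1) + c * (((e + 1 : ℕ) : ℤ) - 1) =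
          x ^ e * (x - c * (e + 1 : ℕ)) - (- (c * e)) := by
        simp; ring
      rw [this]
      refine le_trans ?_ (abs_sub_abs_le_abs_sub _ _)
      rw [abs_neg, abs_of_nonneg (by positivity : (0 : ℤ) ≤ c * e)]
      refine sub_le_sub_right ?_ _
      rw [abs_mul, abs_pow]
      refine mul_le_mul_of_nonneg_left ?_ (by positivity)
      refine le_trans (by rw [abs_of_nonneg (by positivity : (0 : ℤ) ≤ c * (e + 1 : ℕ))])
        (abs_sub_abs_le_abs_sub _ _)
    refine le_trans ?_ h1
    rw [pow_succ (e + 1) j, pow_mul]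
    set B : ℤ := (2 * (e + 1 : ℕ) * c) ^ (e + 1) ^ j with hB
    have hB1 : 1 ≤ B := one_le_pow₀ (by nlinarith)
    have h2 : (c * (e + 1 : ℕ) : ℤ) ^ e + B ^ e ≤ (c * (e + 1 : ℕ) + B) ^ e :=
      pow_add_pow_le (by positivity) (by positivity) (by omega)
    have h4 : (c * (e + 1 : ℕ) : ℤ) ^ 2 ≤ (c * (e + 1 : ℕ) : ℤ) ^ e :=
      pow_le_pow_right₀ (by linarith) (by omega)
    have h5 : (c * (e + 1 : ℕ) + B) ^ e ≤ |x| ^ e := pow_le_pow_left₀ (by positivity) ih _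
    have h6 : (c * (e + 1 : ℕ) + B) ^ e * B ≤ |x| ^ e * (|x| - c * (e + 1 : ℕ)) :=
      mul_le_mul h5 (by linarith) (by positivity) (by positivity)
    rw [pow_succ B]
    push_cast at *
    set D : ℤ := c * (e + 1) with hD
    have : (c * e : ℤ) ≤ D := by rw [hD]; nlinarith
    nlinarith [mul_le_mul_of_nonneg_right h2 (by positivity : 0 ≤ B)]

theorem intPolyHeight_le {f : ℤ[X]} {B : ℝ} (hB : 1 ≤ B)
    (h : ∀ i, |(f.coeff i : ℝ)| ≤ B) : intPolyHeight f ≤ Real.log B := by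
  rcases Nat.eq_zero_or_pos (f.support.sup fun i => (f.coeff i).natAbs) with h0 | h0
  · rw [intPolyHeight, h0]
    simpa using Real.log_nonneg hB
  · refine Real.log_le_log (by exact_mod_cast h0) ?_
    rw [← Nat.le_floor_iff (by linarith)]
    refine Finset.sup_le fun i _ => ?_
    rw [Nat.le_floor_iff (by linarith), Nat.cast_natAbs, Int.cast_abs]
    exact h i

theorem intPolyHeight_nonneg (f : ℤ[X]) : 0 ≤ intPolyHeight f := Real.log_natCast_nonneg _

theorem abs_coeff_phiDC_le {d : ℕ} (hd : 3 ≤ d) {c : ℕ} (hc : 1 ≤ c) (i : ℕ) :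
    |(phiDC d c).coeff i| ≤ c * d := by
  have h1 : (1 : ℤ) ≤ c := by exact_mod_cast hc
  have h2 : (3 : ℤ) ≤ d := by exact_mod_cast hd
  rw [phiDC, coeff_add, coeff_sub, coeff_X_pow, coeff_C_mul_X_pow, coeff_C]
  split_ifs <;> first | omega | (rw [abs_le]; constructor <;> nlinarith)

theorem prod_abs_critOrbit_le {d c : ℕ} (hd : 3 ≤ d) (hc : 1 ≤ c) (k : ℕ) :
    |∏ j ∈ Finset.Icc 1 k, critOrbit d c j| ≤ (2 * d * c) ^ d ^ k := by
  have h1 : (1 : ℤ) ≤ c := by exact_mod_cast hc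
  have h2 : (3 : ℤ) ≤ d := by exact_mod_cast hd
  have hA : (1 : ℤ) ≤ 2 * d * c := by nlinarith
  have h3 : |∏ j ∈ Finset.Icc 1 k, critOrbit d c j| ≤
      (2 * d * c) ^ ∑ j ∈ Finset.range k, d ^ j := by
    induction k with
    | zero => simp
    | succ k ih =>
      rw [Finset.prod_Icc_succ_top (by omega), abs_mul, Finset.sum_range_succ, pow_add]
      refine mul_le_mul ih ?_ (abs_nonneg _) (by positivity)
      have := abs_critOrbit_le hd hc k
      nlinarith
  exact h3.trans (pow_le_pow_right₀ hA
    (Nat.geomSum_lt (by omega) fun k hk => Finset.mem_range.1 hk).le)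

theorem vojta_height_inequality {d c m : ℕ} {C₁ C₂ : ℝ} (hd : 3 ≤ d) (hc : 2 ≤ c) (hm : 3 ≤ m)
    (hV : ∀ f : ℤ[X], f.natDegree = d → Squarefree (f.map (algebraMap ℤ ℚ)) →
      ∀ x y : ℤ, y ^ 2 = f.eval x → Real.log (max 1 |(x : ℝ)|) ≤ C₁ * intPolyHeight f + C₂)
    (hirr : ∀ n, 1 ≤ n → Irreducible ((polyIter (phiDC d c) n).map (algebraMap ℤ ℚ)))
    (hbad : ¬ ∃ p, IsGoodPrime d c m p) :
    (d : ℝ) ^ (m - 3) ≤ (|C₁| + |C₂|) * (3 * d ^ (m / 2)) := by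
  have hc1 : 1 ≤ c := by omega
  have hx : critOrbit d c m ≠ 0 := critOrbit_ne_zero hd (by omega) (hirr m (by omega))
  obtain ⟨s, t, hst, hs⟩ := exists_eq_mul_sq_of_even_padicValInt (a := critOrbit d c m)
    (N := d * ∏ j ∈ Finset.Icc 1 (m / 2), critOrbit d c j) hx fun p hp hpN =>
      even_padicValInt_of_not_exists_isGoodPrime hbad hp
        (fun h => hpN (h.mul_right _)) (fun h => hpN (h.mul_left _))
  have hs0 : s ≠ 0 := by rintro rfl; rw [zero_mul] at hst; exact hx hst
  have hd0 : (d : ℤ) ≠ 0 := by exact_mod_cast (by omega : d ≠ 0)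
  have hsle : |s| ≤ d * (2 * d * c) ^ d ^ (m / 2) := by
    have hN0 : (d * ∏ j ∈ Finset.Icc 1 (m / 2), critOrbit d c j : ℤ) ≠ 0 := by
      refine mul_ne_zero hd0 (Finset.prod_ne_zero_iff.2 fun j hj => ?_)
      rw [Finset.mem_Icc] at hj
      exact critOrbit_ne_zero hd hj.1 (hirr j hj.1)
    refine (Int.le_of_dvd (abs_pos.2 hN0) (by rwa [dvd_abs, abs_dvd])).trans ?_
    rw [abs_mul, Nat.abs_cast]
    exact mul_le_mul_of_nonneg_left (prod_abs_critOrbit_le hd hc1 _) (by positivity)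
  have h1 : (2 : ℝ) ≤ c := by exact_mod_cast hc
  have h2 : (3 : ℝ) ≤ d := by exact_mod_cast hd
  set A : ℝ := 2 * d * c with hA
  have hA12 : 12 ≤ A := by nlinarith
  have hL : 1 ≤ Real.log A := by
    rw [Real.le_log_iff_exp_le (by linarith)]
    linarith [Real.exp_one_lt_d9]
  set f : ℤ[X] := C s * phiDC d c with hf
  have hfdeg : f.natDegree = d := by rw [hf, natDegree_C_mul hs0, natDegree_phiDC hd]
  have hfsq : Squarefree (f.map (algebraMap ℤ ℚ)) := by
    have h3 := (hirr 1 le_rfl).squarefree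
    simp only [polyIter, comp_X] at h3
    rw [hf, Polynomial.map_mul, map_C]
    refine ((associated_unit_mul_left _ _ (isUnit_C.2 ?_)).squarefree_iff).2 h3
    rw [isUnit_iff_ne_zero]
    simpa using hs0
  have hfx : (s * t) ^ 2 = f.eval (critOrbit d c (m - 1)) := by
    have h3 : (phiDC d c).eval (critOrbit d c (m - 1)) = critOrbit d c m := by
      obtain ⟨k, rfl⟩ : ∃ k, m = k + 1 := ⟨m - 1, by omega⟩
      simp [critOrbit, polyIter]
    rw [hf, eval_mul, eval_C, h3, hst]
    ring
  have hVf := hV f hfdeg hfsq _ _ hfx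
  have hheight : intPolyHeight f ≤ (d ^ (m / 2) + 2) * Real.log A := by
    have h3 : ((d ^ (m / 2) + 2 : ℕ) : ℝ) * Real.log A = Real.log (A ^ (d ^ (m / 2) + 2)) := by
      rw [Real.log_pow]
    push_cast at h3
    rw [h3]
    refine intPolyHeight_le (one_le_pow₀ (by linarith)) fun i => ?_
    rw [hf, coeff_C_mul, Int.cast_mul, abs_mul]
    have h4 : |((phiDC d c).coeff i : ℝ)| ≤ c * d := by
      exact_mod_cast abs_coeff_phiDC_le hd hc1 i
    have h5 : |(s : ℝ)| ≤ d * A ^ d ^ (m / 2) := by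
      rw [hA]; exact_mod_cast hsle
    calc |(s : ℝ)| * |((phiDC d c).coeff i : ℝ)| ≤ (d * A ^ d ^ (m / 2)) * (c * d) :=
          mul_le_mul h5 h4 (abs_nonneg _) (by positivity)
      _ = A ^ d ^ (m / 2) * (d * (c * d)) := by ring
      _ ≤ A ^ d ^ (m / 2) * A ^ 2 := by
          refine mul_le_mul_of_nonneg_left ?_ (by positivity)
          rw [hA]
          nlinarith [mul_nonneg (by linarith : (0 : ℝ) ≤ c) (mul_nonneg (by linarith : (0 : ℝ) ≤ d)
            (by linarith : (0 : ℝ) ≤ d)), mul_nonneg (by linarith : (0 : ℝ) ≤ c - 2)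
              (mul_nonneg (by linarith : (0 : ℝ) ≤ c) (mul_nonneg (by linarith : (0 : ℝ) ≤ d)
            (by linarith : (0 : ℝ) ≤ d)))]
      _ = _ := by rw [pow_add]
  have hlower : d ^ (m - 3) * Real.log A ≤ Real.log (max 1 |(critOrbit d c (m - 1) : ℝ)|) := by
    have h3 : ((d ^ (m - 3) : ℕ) : ℝ) * Real.log A = Real.log (A ^ d ^ (m - 3)) := by
      rw [Real.log_pow]
    push_cast at h3
    rw [h3]
    refine Real.log_le_log (by positivity) (le_max_of_le_right ?_)
    have h4 := le_abs_critOrbit hd hc (m - 3)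
    rw [show m - 3 + 2 = m - 1 by omega] at h4
    have h5 : (c * d : ℝ) + A ^ d ^ (m - 3) ≤ |(critOrbit d c (m - 1) : ℝ)| := by
      rw [hA]; exact_mod_cast h4
    nlinarith
  set L := Real.log A
  have hq : (1 : ℝ) ≤ d ^ (m / 2) := one_le_pow₀ (by linarith)
  set q : ℝ := d ^ (m / 2)
  have h6 : C₁ * intPolyHeight f ≤ |C₁| * ((q + 2) * L) :=
    (mul_le_mul_of_nonneg_right (le_abs_self _) (intPolyHeight_nonneg f)).trans
      (mul_le_mul_of_nonneg_left hheight (abs_nonneg _))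
  have h7 : (d : ℝ) ^ (m - 3) * L ≤ ((|C₁| + |C₂|) * (3 * q)) * L := by
    have h8 : C₂ ≤ |C₂| * (3 * q) * L := by
      have : 1 ≤ (3 * q) * L := by nlinarith
      nlinarith [le_abs_self C₂, abs_nonneg C₂]
    have h9 : |C₁| * ((q + 2) * L) ≤ |C₁| * ((3 * q) * L) := by
      gcongr
      linarith
    nlinarith
  exact le_of_mul_le_mul_right h7 (by linarith)

theorem exists_finite_forall_exists_isGoodPrime {d : ℕ} (hd : 3 ≤ d)
    (hVojta : ∃ C₁ C₂ : ℝ, ∀ f : Polynomial ℤ, f.natDegree = d →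
      Squarefree (f.map (algebraMap ℤ ℚ)) →
      ∀ x y : ℤ, y ^ 2 = f.eval x →
        Real.log (max 1 |(x : ℝ)|) ≤ C₁ * intPolyHeight f + C₂) :
    ∃ B : Set ℕ, B.Finite ∧ ∀ c ∉ B, 0 < c →
      (∀ n, 1 ≤ n → Irreducible ((polyIter (phiDC d c) n).map (algebraMap ℤ ℚ))) →
      ∀ m, 2 ≤ m → (d ≠ 3 ∨ m ≠ 2) → ∃ p, IsGoodPrime d c m p := by
  obtain ⟨C₁, C₂, hV⟩ := hVojta
  have hd' : (1 : ℝ) < d := by exact_mod_cast (by omega : 1 < d)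
  obtain ⟨N, hN⟩ := pow_unbounded_of_one_lt ((|C₁| + |C₂|) * 3) hd'
  refine ⟨{1} ∪ ⋃ m ∈ {m | m < 2 * N + 7 ∧ 2 ≤ m ∧ (d ≠ 3 ∨ m ≠ 2)},
    {c | ¬ ∃ p, IsGoodPrime d c m p}, (Set.finite_singleton 1).union
      (Set.Finite.biUnion ((Set.finite_lt_nat (2 * N + 7)).subset fun m hm => hm.1)
        fun m hm => finite_not_exists_isGoodPrime hd hm.2.1 hm.2.2), ?_⟩
  intro c hcB hc hirr m hm hdm
  by_contra hbad
  rcases Nat.lt_or_ge m (2 * N + 7) with h | h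
  · exact hcB (Or.inr (Set.mem_biUnion (show m ∈ {m | m < 2 * N + 7 ∧ 2 ≤ m ∧ (d ≠ 3 ∨ m ≠ 2)}
      from ⟨h, hm, hdm⟩) hbad))
  · have hc2 : 2 ≤ c := by
      rcases Nat.lt_or_ge c 2 with h1 | h1
      · exact absurd (Or.inl (show c = 1 by omega)) hcB
      · exact h1
    have h1 := vojta_height_inequality hd hc2 (by omega) hV hirr hbad
    have h2 : (d : ℝ) ^ N * d ^ (m / 2) ≤ d ^ (m - 3) := by
      rw [← pow_add]
      exact pow_le_pow_right₀ hd'.le (by omega)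
    have h3 : (0 : ℝ) < d ^ (m / 2) := by positivity
    nlinarith

theorem polyIter_succ_comp {R : Type*} [CommRing R] (φ : R[X]) (n : ℕ) :
    polyIter φ (n + 1) = (polyIter φ n).comp φ := by
  induction n with
  | zero => simp [polyIter]
  | succ n ih =>
    conv_lhs => rw [polyIter, ih, ← comp_assoc]
    rfl

theorem aeval_polyIter_succ {A : Type*} [CommRing A] (φ : ℤ[X]) (n : ℕ) (z : A) :
    aeval z (polyIter φ (n + 1)) = aeval (aeval z φ) (polyIter φ n) := by
  rw [polyIter_succ_comp, aeval_comp]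

theorem Polynomial.Monic.polyIter {φ : ℤ[X]} (hφ : φ.Monic) (hdeg : φ.natDegree ≠ 0) (n : ℕ) :
    (polyIter φ n).Monic := by
  induction n with
  | zero => exact monic_X
  | succ n ih =>
    refine hφ.comp ih ?_
    rw [natDegree_polyIter]
    exact pow_ne_zero _ hdeg

/-- The set of roots of the `n`-th iterate of `φ` in a field `Ω`. -/
def iterRoots (Ω : Type*) [Field Ω] (φ : ℤ[X]) (n : ℕ) : Set Ω :=
  (polyIter φ n).rootSet Ω

theorem finite_iterRoots (Ω : Type*) [Field Ω] (φ : ℤ[X]) (n : ℕ) : (iterRoots Ω φ n).Finite :=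
  rootSet_finite _ _

section IterRoots

variable {Ω : Type*} [Field Ω] [CharZero Ω] {φ : ℤ[X]}

theorem mem_iterRoots (hφ : φ.Monic) (hdeg : φ.natDegree ≠ 0) {n : ℕ} {z : Ω} :
    z ∈ iterRoots Ω φ n ↔ aeval z (polyIter φ n) = 0 := by
  rw [iterRoots, mem_rootSet]
  simp [(hφ.polyIter hdeg n).ne_zero]

theorem aeval_mem_iterRoots (hφ : φ.Monic) (hdeg : φ.natDegree ≠ 0) {n : ℕ}
    {z : Ω} : aeval z φ ∈ iterRoots Ω φ n ↔ z ∈ iterRoots Ω φ (n + 1) := by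
  rw [mem_iterRoots hφ hdeg, mem_iterRoots hφ hdeg, aeval_polyIter_succ]

theorem aeval_int_algEquiv (σ : Ω ≃ₐ[ℚ] Ω) (p : ℤ[X])
    (z : Ω) : aeval (σ z) p = σ (aeval z p) :=
  aeval_algHom_apply (σ.toAlgHom.restrictScalars ℤ) z p

theorem algEquiv_mem_iterRoots (hφ : φ.Monic) (hdeg : φ.natDegree ≠ 0) {n : ℕ}
    (σ : Ω ≃ₐ[ℚ] Ω) {z : Ω} :
    σ z ∈ iterRoots Ω φ n ↔ z ∈ iterRoots Ω φ n := by
  rw [mem_iterRoots hφ hdeg, mem_iterRoots hφ hdeg, aeval_int_algEquiv,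
    map_eq_zero_iff _ σ.injective]

noncomputable instance fintype_iterRoots (φ : ℤ[X]) (n : ℕ) : Fintype (iterRoots Ω φ n) :=
  rootSetFintype _ _

section AlgClosed

variable [IsAlgClosed Ω]

theorem exists_algEquiv_of_mem_iterRoots [Algebra.IsAlgebraic ℚ Ω] (hφ : φ.Monic)
    (hdeg : φ.natDegree ≠ 0) {n : ℕ}
    (hirr : Irreducible ((polyIter φ n).map (algebraMap ℤ ℚ))) {x y : Ω}
    (hx : x ∈ iterRoots Ω φ n) (hy : y ∈ iterRoots Ω φ n) :
    ∃ σ : Ω ≃ₐ[ℚ] Ω, σ x = y := by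
  have : Normal ℚ Ω := normal_iff.2 fun x =>
    ⟨Algebra.IsIntegral.isIntegral x, IsAlgClosed.splits _⟩
  have h : ∀ z ∈ iterRoots Ω φ n, (polyIter φ n).map (algebraMap ℤ ℚ) = minpoly ℚ z := by
    intro z hz
    refine minpoly.eq_of_irreducible_of_monic hirr ?_ ((hφ.polyIter hdeg n).map _)
    rw [aeval_map_algebraMap]
    exact (mem_iterRoots hφ hdeg).1 hz
  exact isConjRoot_iff_exists_algEquiv.1 (show minpoly ℚ y = minpoly ℚ x by rw [← h x hx, ← h y hy])

theorem card_iterRoots (n : ℕ)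
    (hirr : Irreducible ((polyIter φ n).map (algebraMap ℤ ℚ))) :
    Nat.card (iterRoots Ω φ n) = φ.natDegree ^ n := by
  have h1 := card_rootSet_eq_natDegree (K := Ω) hirr.separable
    (IsAlgClosed.splits _)
  rw [natDegree_map_eq_of_injective (algebraMap ℤ ℚ).injective_int, natDegree_polyIter,
    ← Nat.card_eq_fintype_card] at h1
  rw [← h1]
  congr 2
  rw [iterRoots, rootSet, rootSet, aroots_map]

theorem ncard_fiber (hφ : φ.Monic) (hdeg : φ.natDegree ≠ 0) {n : ℕ}
    (hirr : Irreducible ((polyIter φ (n + 1)).map (algebraMap ℤ ℚ))) {b : Ω}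
    (hb : b ∈ iterRoots Ω φ n) :
    {z : Ω | aeval z φ = b}.ncard = φ.natDegree := by
  set ψ := φ.map (algebraMap ℤ Ω) - C b with hψ
  have hψdeg : ψ.natDegree = φ.natDegree := by
    rw [hψ, natDegree_sub_C, natDegree_map_eq_of_injective
      (algebraMap ℤ Ω).injective_int]
  have hψ0 : ψ ≠ 0 := by rintro h; rw [h, natDegree_zero] at hψdeg; exact hdeg hψdeg.symm
  have hsep : ψ.Separable := by
    have h1 : ((polyIter φ (n + 1)).map (algebraMap ℤ Ω)).Separable := by
      have := hirr.separable.map (f := algebraMap ℚ Ω)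
      rwa [map_map, ← IsScalarTower.algebraMap_eq] at this
    refine h1.of_dvd ?_
    have h2 : X - C b ∣ (polyIter φ n).map (algebraMap ℤ Ω) := by
      rw [dvd_iff_isRoot, IsRoot, eval_map_algebraMap]
      exact (mem_iterRoots hφ hdeg).1 hb
    have h3 := _root_.map_dvd (compRingHom (φ.map (algebraMap ℤ Ω))) h2
    simp only [coe_compRingHom_apply, sub_comp, X_comp, C_comp] at h3
    rw [polyIter_succ_comp, map_comp]
    exact h3
  have h4 := card_rootSet_eq_natDegree (K := Ω) hsep (IsAlgClosed.splits _)
  rw [← hψdeg, ← h4, ← Nat.card_eq_fintype_card, Nat.card_coe_set_eq]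
  congr 1
  ext z
  rw [mem_rootSet]
  rw [hψ, map_sub, aeval_C, aeval_map_algebraMap, sub_eq_zero]
  exact ⟨fun h => ⟨hψ0, h⟩, fun h => h.2⟩

end AlgClosed

end IterRoots

section FiberSwap

variable {Ω : Type*} [Field Ω] [CharZero Ω] {φ : ℤ[X]}

/-- The transposition of `x` and `y` on the roots of the `(n+1)`-st iterate is induced by an
automorphism fixing the roots of the `n`-th iterate. -/
def FiberSwap (φ : ℤ[X]) (n : ℕ) (x y : Ω) : Prop :=
  ∃ σ : Ω ≃ₐ[ℚ] Ω, (∀ z ∈ iterRoots Ω φ n, σ z = z) ∧ σ x = y ∧ σ y = x ∧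
    ∀ z ∈ iterRoots Ω φ (n + 1), z ≠ x → z ≠ y → σ z = z

theorem FiberSwap.refl (n : ℕ) (x : Ω) : FiberSwap φ n x x :=
  ⟨1, fun _ _ => rfl, rfl, rfl, fun _ _ _ _ => rfl⟩

theorem FiberSwap.symm {n : ℕ} {x y : Ω} (h : FiberSwap φ n x y) : FiberSwap φ n y x := by
  obtain ⟨σ, h1, h2, h3, h4⟩ := h
  exact ⟨σ, h1, h3, h2, fun z hz hy hx => h4 z hz hx hy⟩

theorem FiberSwap.map (hφ : φ.Monic) (hdeg : φ.natDegree ≠ 0) {n : ℕ} {x y : Ω}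
    (h : FiberSwap φ n x y) (γ : Ω ≃ₐ[ℚ] Ω) : FiberSwap φ n (γ x) (γ y) := by
  obtain ⟨σ, h1, h2, h3, h4⟩ := h
  have hmem : ∀ k, ∀ z ∈ iterRoots Ω φ k, γ.symm z ∈ iterRoots Ω φ k := fun k z hz =>
    (algEquiv_mem_iterRoots hφ hdeg γ.symm).2 hz
  refine ⟨(γ.symm.trans σ).trans γ, fun z hz => ?_, by simp [h2], by simp [h3],
    fun z hz hx hy => ?_⟩
  · simp [h1 _ (hmem n z hz)]
  · simp [h4 _ (hmem _ z hz) (fun h => hx (by rw [← h, γ.apply_symm_apply]))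
      (fun h => hy (by rw [← h, γ.apply_symm_apply]))]

theorem FiberSwap.trans (hφ : φ.Monic) (hdeg : φ.natDegree ≠ 0) {n : ℕ} {x y z : Ω}
    (hz : z ∈ iterRoots Ω φ (n + 1))
    (hxy : FiberSwap φ n x y) (hyz : FiberSwap φ n y z) : FiberSwap φ n x z := by
  by_cases hzx : z = x
  · rw [hzx]; exact .refl n x
  by_cases hzy : z = y
  · rwa [hzy]
  obtain ⟨σ, h1, h2, h3, h4⟩ := hxy
  have := hyz.map hφ hdeg σ
  rwa [h3, h4 z hz hzx hzy] at this

variable [IsAlgClosed Ω] [Algebra.IsAlgebraic ℚ Ω]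

/-- If a full fiber consists of mutually swappable roots, then every fiber does. -/
theorem fiberSwap_of_fiber (hφ : φ.Monic) (hdeg : φ.natDegree ≠ 0) {n : ℕ}
    (hirr : Irreducible ((polyIter φ (n + 1)).map (algebraMap ℤ ℚ))) {x : Ω}
    (hx : x ∈ iterRoots Ω φ (n + 1)) (h : ∀ w, aeval w φ = aeval x φ → FiberSwap φ n x w)
    {a b : Ω} (ha : a ∈ iterRoots Ω φ (n + 1)) (hab : aeval a φ = aeval b φ) :
    FiberSwap φ n a b := by
  obtain ⟨γ, rfl⟩ := exists_algEquiv_of_mem_iterRoots hφ hdeg hirr hx ha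
  have h1 := (h (γ.symm b) (by
    rw [aeval_int_algEquiv, ← hab, aeval_int_algEquiv, γ.symm_apply_apply])).map hφ hdeg γ
  rwa [γ.apply_symm_apply] at h1

open Classical in
/-- If the degree is prime, a single nontrivial fiber swap generates all of them. -/
theorem fiberSwap_of_prime (hφ : φ.Monic) (hp : φ.natDegree.Prime) {n : ℕ}
    (hirr : Irreducible ((polyIter φ (n + 1)).map (algebraMap ℤ ℚ))) {x y : Ω}
    (hx : x ∈ iterRoots Ω φ (n + 1)) (hxy : x ≠ y) (hF : aeval x φ = aeval y φ)
    (h : FiberSwap φ n x y) {a b : Ω} (ha : a ∈ iterRoots Ω φ (n + 1))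
    (hab : aeval a φ = aeval b φ) : FiberSwap φ n a b := by
  have hdeg := hp.ne_zero
  have hfib : ∀ {z : Ω}, z ∈ iterRoots Ω φ (n + 1) → ∀ {w}, aeval w φ = aeval z φ →
      w ∈ iterRoots Ω φ (n + 1) := fun hz w hw => by
    rw [← aeval_mem_iterRoots hφ hdeg] at hz ⊢
    rwa [hw]
  set b₀ := aeval x φ with hb₀
  have hcard := ncard_fiber hφ hdeg hirr ((aeval_mem_iterRoots hφ hdeg).2 hx)
  have hfin : {z : Ω | aeval z φ = b₀}.Finite :=
    Set.finite_of_ncard_ne_zero (by rw [hcard]; exact hdeg)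
  set s := hfin.toFinset with hs
  have hmem : ∀ z, z ∈ s ↔ aeval z φ = b₀ := fun z => by simp [hs]
  rw [Set.ncard_eq_toFinset_card _ hfin] at hcard
  set cls : Ω → Finset Ω := fun z => s.filter (FiberSwap φ n z) with hcls
  have hclscard : ∀ z ∈ s, (cls z).card = (cls x).card := by
    intro z hz
    rw [hmem] at hz
    obtain ⟨γ, rfl⟩ := exists_algEquiv_of_mem_iterRoots hφ hdeg hirr hx (hfib hx hz)
    rw [aeval_int_algEquiv, ← hb₀] at hz
    refine Finset.card_bij' (fun w _ => γ.symm w) (fun w _ => γ w) ?_ ?_ (by simp) (by simp)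
    · intro w hw
      rw [Finset.mem_filter, hmem] at hw ⊢
      refine ⟨?_, by simpa using hw.2.map hφ hdeg γ.symm⟩
      rw [aeval_int_algEquiv, hw.1, ← hz, γ.symm_apply_apply, hz]
    · intro w hw
      rw [Finset.mem_filter, hmem] at hw ⊢
      refine ⟨?_, by simpa using hw.2.map hφ hdeg γ⟩
      rw [aeval_int_algEquiv, hw.1, hz]
  have hclseq : ∀ z ∈ s, ∀ w ∈ s, cls w = cls z ↔ FiberSwap φ n z w := by
    intro z hz w hw
    rw [hmem] at hz hw
    constructor
    · intro h1
      have : w ∈ cls w := by rw [Finset.mem_filter, hmem]; exact ⟨hw, .refl n w⟩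
      rw [h1, Finset.mem_filter] at this
      exact this.2
    · intro h1
      ext v
      rw [Finset.mem_filter, Finset.mem_filter, hmem]
      refine and_congr_right fun hv => ⟨fun h2 => ?_, fun h2 => ?_⟩
      · exact h1.trans hφ hdeg (hfib hx hv) h2
      · exact h1.symm.trans hφ hdeg (hfib hx hv) h2
  have hdvd : (cls x).card ∣ s.card := by
    rw [Finset.card_eq_sum_card_image cls s]
    refine Finset.dvd_sum fun t ht => ?_
    obtain ⟨z, hz, rfl⟩ := Finset.mem_image.1 ht
    rw [← hclscard z hz]
    refine dvd_of_eq ?_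
    congr 1
    ext w
    simp only [hcls, Finset.mem_filter]
    exact and_congr_right fun hw => (hclseq z hz w hw).symm
  have hxs : x ∈ s := (hmem x).2 rfl
  have hgt : 1 < (cls x).card := by
    rw [Finset.one_lt_card]
    exact ⟨x, Finset.mem_filter.2 ⟨hxs, .refl n x⟩, y,
      Finset.mem_filter.2 ⟨(hmem y).2 hF.symm, h⟩, hxy⟩
  rw [hcard] at hdvd
  have heq : cls x = s := by
    refine Finset.eq_of_subset_of_card_le (Finset.filter_subset _ _) ?_
    rw [hcard, ((Nat.dvd_prime hp).1 hdvd).resolve_left hgt.ne']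
  refine fiberSwap_of_fiber hφ hdeg hirr hx (fun w hw => ?_) ha hab
  have : w ∈ cls x := by rw [heq]; exact (hmem w).2 hw
  exact (Finset.mem_filter.1 this).2

end FiberSwap

section RelGalCard

variable {Ω : Type*} [Field Ω] [CharZero Ω] {φ : ℤ[X]}

/-- The subfield of `Ω` generated by the roots of the `n`-th iterate. -/
def iterField (Ω : Type*) [Field Ω] [CharZero Ω] (φ : ℤ[X]) (n : ℕ) : IntermediateField ℚ Ω :=
  IntermediateField.adjoin ℚ (iterRoots Ω φ n)

theorem mem_iterField_of_mem_iterRoots {n : ℕ} {z : Ω} (hz : z ∈ iterRoots Ω φ n) :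
    z ∈ iterField Ω φ n :=
  IntermediateField.subset_adjoin _ _ hz

theorem algEquiv_eq_self_of_mem_iterField {n : ℕ} {σ : Ω ≃ₐ[ℚ] Ω}
    (h : ∀ z ∈ iterRoots Ω φ n, σ z = z) {x : Ω} (hx : x ∈ iterField Ω φ n) : σ x = x := by
  have : σ.toAlgHom.comp (iterField Ω φ n).val = (iterField Ω φ n).val :=
    IntermediateField.algHom_ext_of_eq_adjoin ℚ (S := iterField Ω φ n) (s := iterRoots Ω φ n) rfl
      fun z hz => h z hz
  exact DFunLike.congr_fun this ⟨x, hx⟩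

instance iterField_normal [IsAlgClosed Ω] (φ : ℤ[X]) (n : ℕ) : Normal ℚ (iterField Ω φ n) := by
  have h : (((polyIter φ n).map (algebraMap ℤ ℚ)).map (algebraMap ℚ Ω)).Splits :=
    IsAlgClosed.splits _
  have := IntermediateField.adjoin_rootSet_isSplittingField h
  have h2 : iterField Ω φ n =
      IntermediateField.adjoin ℚ (((polyIter φ n).map (algebraMap ℤ ℚ)).rootSet Ω) := by
    rw [iterField, iterRoots, rootSet, rootSet, aroots_map]
  rw [h2]
  exact @Normal.of_isSplittingField ℚ _ _ _ _ ((polyIter φ n).map (algebraMap ℤ ℚ)) this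

theorem iterField_le_succ (hφ : φ.Monic) (hdeg : φ.natDegree ≠ 0) {n : ℕ}
    (hirr : Irreducible ((polyIter φ (n + 1)).map (algebraMap ℤ ℚ))) [IsAlgClosed Ω] :
    iterField Ω φ n ≤ iterField Ω φ (n + 1) := by
  refine IntermediateField.adjoin_le_iff.2 fun b hb => ?_
  have hcard := ncard_fiber hφ hdeg hirr hb
  obtain ⟨z, hz⟩ := Set.nonempty_of_ncard_ne_zero (hcard.trans_ne hdeg)
  have hz' : aeval z φ = b := hz
  rw [← hz', aeval_mem_iterRoots hφ hdeg] at hb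
  have h1 := aeval_algHom_apply ((iterField Ω φ (n + 1)).val.restrictScalars ℤ)
    ⟨z, mem_iterField_of_mem_iterRoots hb⟩ φ
  have h2 : aeval z φ = (iterField Ω φ (n + 1)).val
    (aeval ⟨z, mem_iterField_of_mem_iterRoots hb⟩ φ) := h1
  rw [← hz', h2]
  exact Subtype.property _

theorem exists_algEquiv_of_fiberSwap {n : ℕ}
    (h : ∀ a b : Ω, a ∈ iterRoots Ω φ (n + 1) → aeval a φ = aeval b φ → FiberSwap φ n a b)
    (π : Equiv.Perm (iterRoots Ω φ (n + 1)))
    (hπ : ∀ z, aeval (π z : Ω) φ = aeval (z : Ω) φ) :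
    ∃ σ : Ω ≃ₐ[ℚ] Ω, (∀ z ∈ iterRoots Ω φ n, σ z = z) ∧
      ∀ z : iterRoots Ω φ (n + 1), σ z = π z := by
  classical
  set S : Set (Equiv.Perm (iterRoots Ω φ (n + 1))) :=
    {f | ∃ x y : iterRoots Ω φ (n + 1), x ≠ y ∧ aeval (x : Ω) φ = aeval (y : Ω) φ ∧
      f = Equiv.swap x y} with hS
  have hmem : π ∈ Subgroup.closure S := by
    refine (mem_closure_isSwap ?_).2 ⟨Set.toFinite _, fun x => ?_⟩
    · rintro f ⟨x, y, hxy, -, rfl⟩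
      exact ⟨x, y, hxy, rfl⟩
    · by_cases hx : π x = x
      · rw [hx]; exact MulAction.mem_orbit_self x
      · refine ⟨⟨Equiv.swap x (π x), Subgroup.subset_closure
          ⟨x, π x, fun h => hx h.symm, (hπ x).symm, rfl⟩⟩, ?_⟩
        exact Equiv.swap_apply_left x (π x)
  clear hπ
  induction hmem using Subgroup.closure_induction with
  | mem f hf =>
    obtain ⟨x, y, hxy, hF, rfl⟩ := hf
    obtain ⟨σ, h1, h2, h3, h4⟩ := h x y x.2 hF
    refine ⟨σ, h1, fun z => ?_⟩
    by_cases hzx : z = x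
    · rw [hzx, Equiv.swap_apply_left, h2]
    by_cases hzy : z = y
    · rw [hzy, Equiv.swap_apply_right, h3]
    rw [Equiv.swap_apply_of_ne_of_ne hzx hzy]
    exact h4 z z.2 (fun h => hzx (Subtype.ext h)) (fun h => hzy (Subtype.ext h))
  | one => exact ⟨1, fun _ _ => rfl, fun _ => rfl⟩
  | mul f g _ _ hf hg =>
    obtain ⟨σ, h1, h2⟩ := hf
    obtain ⟨τ, h3, h4⟩ := hg
    exact ⟨σ * τ, fun z hz => by rw [AlgEquiv.mul_apply, h3 z hz, h1 z hz],
      fun z => by rw [AlgEquiv.mul_apply, h4, h2]; rfl⟩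
  | inv f _ hf =>
    obtain ⟨σ, h1, h2⟩ := hf
    refine ⟨σ⁻¹, fun z hz => ?_, fun z => ?_⟩
    · rw [AlgEquiv.aut_inv, AlgEquiv.symm_apply_eq, h1 z hz]
    · rw [AlgEquiv.aut_inv, AlgEquiv.symm_apply_eq, h2]
      simp

theorem card_perm_fiber (hφ : φ.Monic) (hdeg : φ.natDegree ≠ 0) {n : ℕ} [IsAlgClosed Ω]
    (hirr' : Irreducible ((polyIter φ n).map (algebraMap ℤ ℚ)))
    (hirr : Irreducible ((polyIter φ (n + 1)).map (algebraMap ℤ ℚ))) :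
    Nat.card {π : Equiv.Perm (iterRoots Ω φ (n + 1)) //
      ∀ z, aeval (π z : Ω) φ = aeval (z : Ω) φ} = φ.natDegree.factorial ^ φ.natDegree ^ n := by
  classical
  set f : iterRoots Ω φ (n + 1) → iterRoots Ω φ n := fun z =>
    ⟨aeval (z : Ω) φ, (aeval_mem_iterRoots hφ hdeg).2 z.2⟩ with hf
  have h1 := DomMulAct.stabilizer_card f
  have h2 : ∀ i, Fintype.card {a // f a = i} = φ.natDegree := by
    intro i
    rw [← ncard_fiber hφ hdeg hirr i.2, ← Nat.card_coe_set_eq, ← Nat.card_eq_fintype_card]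
    refine Nat.card_congr ⟨fun a => ⟨a.1.1, congrArg Subtype.val a.2⟩,
      fun a => ⟨⟨a.1, ?_⟩, Subtype.ext a.2⟩, fun _ => rfl, fun _ => rfl⟩
    have h3 : aeval a.1 φ = i := a.2
    rw [← aeval_mem_iterRoots hφ hdeg, h3]
    exact i.2
  simp only [h2] at h1
  rw [Finset.prod_const, Finset.card_univ, ← Nat.card_eq_fintype_card,
    ← Nat.card_eq_fintype_card, card_iterRoots n hirr'] at h1
  rw [← h1]
  refine Nat.card_congr (Equiv.subtypeEquivRight fun π => ?_)
  rw [funext_iff]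
  exact forall_congr' fun z => by simp [hf]

theorem card_relGal_of_fiberSwap (hφ : φ.Monic) (hdeg : φ.natDegree ≠ 0) {n : ℕ} [IsAlgClosed Ω]
    [Algebra.IsAlgebraic ℚ Ω]
    (hirr' : Irreducible ((polyIter φ n).map (algebraMap ℤ ℚ)))
    (hirr : Irreducible ((polyIter φ (n + 1)).map (algebraMap ℤ ℚ)))
    (h : ∀ a b : Ω, a ∈ iterRoots Ω φ (n + 1) → aeval a φ = aeval b φ → FiberSwap φ n a b) :
    Nat.card {σ : iterField Ω φ (n + 1) ≃ₐ[ℚ] iterField Ω φ (n + 1) //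
      ∀ (x : Ω) (_ : x ∈ iterField Ω φ n) (hx' : x ∈ iterField Ω φ (n + 1)),
        σ ⟨x, hx'⟩ = ⟨x, hx'⟩} = φ.natDegree.factorial ^ φ.natDegree ^ n := by
  have hnormal : Normal ℚ Ω := normal_iff.2 fun x =>
    ⟨Algebra.IsIntegral.isIntegral x, IsAlgClosed.splits _⟩
  rw [← card_perm_fiber (Ω := Ω) hφ hdeg hirr' hirr]
  have hlift : ∀ (σ : iterField Ω φ (n + 1) ≃ₐ[ℚ] iterField Ω φ (n + 1))
      (x : iterField Ω φ (n + 1)), σ.liftNormal Ω (x : Ω) = σ x :=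
    fun σ x => σ.liftNormal_commutes Ω x
  have hmem : ∀ (σ : iterField Ω φ (n + 1) ≃ₐ[ℚ] iterField Ω φ (n + 1))
      (z : iterRoots Ω φ (n + 1)),
      (σ ⟨z, mem_iterField_of_mem_iterRoots z.2⟩ : Ω) ∈ iterRoots Ω φ (n + 1) := by
    intro σ z
    rw [← hlift]
    exact (algEquiv_mem_iterRoots hφ hdeg _).2 z.2
  let P : (iterField Ω φ (n + 1) ≃ₐ[ℚ] iterField Ω φ (n + 1)) →
      Equiv.Perm (iterRoots Ω φ (n + 1)) := fun σ =>
    ⟨fun z => ⟨_, hmem σ z⟩, fun z => ⟨_, hmem σ.symm z⟩, fun z => by simp, fun z => by simp⟩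
  have hle := iterField_le_succ (Ω := Ω) hφ hdeg hirr
  have hP : ∀ σ : iterField Ω φ (n + 1) ≃ₐ[ℚ] iterField Ω φ (n + 1),
      (∀ (x : Ω) (_ : x ∈ iterField Ω φ n) (hx' : x ∈ iterField Ω φ (n + 1)),
        σ ⟨x, hx'⟩ = ⟨x, hx'⟩) → ∀ z, aeval (P σ z : Ω) φ = aeval (z : Ω) φ := by
    intro σ hσ z
    have h1 : (P σ z : Ω) = σ.liftNormal Ω z :=
      (hlift σ ⟨z, mem_iterField_of_mem_iterRoots z.2⟩).symm
    have h2 := mem_iterField_of_mem_iterRoots ((aeval_mem_iterRoots hφ hdeg).2 z.2)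
    rw [h1, aeval_int_algEquiv]
    have h3 := hlift σ ⟨_, hle h2⟩
    rw [hσ _ h2 (hle h2)] at h3
    exact h3
  refine Nat.card_congr (Equiv.ofBijective (fun σ => ⟨P σ.1, hP σ.1 σ.2⟩) ⟨?_, ?_⟩)
  · rintro ⟨σ, hσ⟩ ⟨τ, hτ⟩ hστ
    have h1 : P σ = P τ := congrArg Subtype.val hστ
    refine Subtype.ext (AlgEquiv.ext fun x => ?_)
    have h2 : (σ : iterField Ω φ (n + 1) →ₐ[ℚ] iterField Ω φ (n + 1)) = τ := by
      refine IntermediateField.algHom_ext_of_eq_adjoin ℚ (S := iterField Ω φ (n + 1)) rfl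
        fun z hz => Subtype.ext ?_
      exact congrArg (fun w : iterRoots Ω φ (n + 1) => (w : Ω)) (Equiv.congr_fun h1 ⟨z, hz⟩)
    exact DFunLike.congr_fun h2 x
  · rintro ⟨π, hπ⟩
    obtain ⟨σ, h1, h2⟩ := exists_algEquiv_of_fiberSwap h π hπ
    have hres : ∀ x : iterField Ω φ (n + 1),
        ((σ.restrictNormal (iterField Ω φ (n + 1)) x : iterField Ω φ (n + 1)) : Ω) = σ x :=
      fun x => σ.restrictNormal_commutes (iterField Ω φ (n + 1)) x
    refine ⟨⟨σ.restrictNormal (iterField Ω φ (n + 1)), fun x hx hx' => Subtype.ext ?_⟩,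
      Subtype.ext (Equiv.ext fun z => Subtype.ext ?_)⟩
    · rw [hres]
      exact algEquiv_eq_self_of_mem_iterField h1 hx
    · exact (hres ⟨z, mem_iterField_of_mem_iterRoots z.2⟩).trans (h2 z)

end RelGalCard

section Inertia

open NumberField

variable {L : Type*} [Field L] [NumberField L] [IsGalois ℚ L]

theorem exists_mem_inertia_ne_one {p : ℕ} (hp : p.Prime) (P : Ideal (𝓞 L)) [P.IsPrime]
    (hpP : (p : 𝓞 L) ∈ P) {a u : 𝓞 L} (hu : u ∉ P) {s : ℤ} (hs : Odd (padicValInt p s))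
    (h : a ^ 2 * u = s) : ∃ σ ∈ P.inertia (L ≃ₐ[ℚ] L), σ ≠ 1 := by
  by_contra! hcon
  have := Fact.mk hp
  have hbot : P.inertia (L ≃ₐ[ℚ] L) = ⊥ := (Subgroup.eq_bot_iff_forall _).2 hcon
  have hp0 : ((p : ℤ) : ℤ) ≠ 0 := by exact_mod_cast hp.ne_zero
  have hpmax : (Ideal.span {(p : ℤ)}).IsMaximal :=
    PrincipalIdealRing.isMaximal_of_irreducible (Nat.prime_iff_prime_int.1 hp).irreducible
  have hover : P.LiesOver (Ideal.span {(p : ℤ)}) := by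
    refine ⟨hpmax.eq_of_le ?_ ?_⟩
    · exact Ideal.IsPrime.ne_top inferInstance
    · rw [Ideal.span_singleton_le_iff_mem, Ideal.mem_comap]
      simpa using hpP
  have hcard := Ideal.card_inertia_eq_ramificationIdxIn (G := L ≃ₐ[ℚ] L) (Ideal.span {(p : ℤ)}) P
  rw [hbot, Ideal.ramificationIdxIn_eq_ramificationIdx _ P (L ≃ₐ[ℚ] L)] at hcard
  have hP0 : P ≠ ⊥ := by
    rintro rfl
    exact hp.ne_zero (by simpa using hpP)
  have hPp : Prime P := Ideal.prime_of_isPrime hP0 inferInstance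
  have hspan : (Ideal.span {(p : ℤ)}).map (algebraMap ℤ (𝓞 L)) = Ideal.span {(p : 𝓞 L)} := by
    rw [Ideal.map_span, Set.image_singleton, map_natCast]
  have hspan0 : Ideal.span {(p : 𝓞 L)} ≠ ⊥ := by
    rw [Ne, Ideal.span_singleton_eq_bot]
    exact_mod_cast hp.ne_zero
  rw [Ideal.IsDedekindDomain.ramificationIdx_eq_multiplicity (Ideal.span {(p : ℤ)}) P
    (by rwa [hspan]), hspan, Subgroup.card_bot] at hcard
  have he : emultiplicity P (Ideal.span {(p : 𝓞 L)}) = 1 := by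
    rw [(FiniteMultiplicity.of_prime_left hPp hspan0).emultiplicity_eq_multiplicity, ← hcard]
    rfl
  have hs0 : s ≠ 0 := by
    rintro rfl
    simp at hs
  obtain ⟨m, hm⟩ : (p : ℤ) ^ padicValInt p s ∣ s := padicValInt_dvd s
  have hpm : ¬ (p : ℤ) ∣ m := by
    rintro ⟨t, rfl⟩
    have h1 : (p : ℤ) ^ (padicValInt p s + 1) ∣ s := ⟨t, by rw [pow_succ, mul_assoc, ← hm]⟩
    rw [padicValInt_dvd_iff] at h1
    omega
  have hmP : (m : 𝓞 L) ∉ P := by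
    intro h1
    have h2 : m ∈ Ideal.span {(p : ℤ)} := by
      rw [hover.over, Ideal.mem_comap]
      simpa using h1
    exact hpm (Ideal.mem_span_singleton.1 h2)
  have hzero : ∀ {x : 𝓞 L}, x ∉ P → emultiplicity P (Ideal.span {x}) = 0 := fun {x} hx =>
    emultiplicity_eq_zero.2 fun h1 => hx (Ideal.dvd_span_singleton.1 h1)
  have ha0 : a ≠ 0 := by
    rintro rfl
    rw [zero_pow two_ne_zero, zero_mul, eq_comm, Int.cast_eq_zero] at h
    exact hs0 h
  have h1 := congrArg (fun x => emultiplicity P (Ideal.span {x})) h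
  have h2 : (s : 𝓞 L) = (p : 𝓞 L) ^ padicValInt p s * m := by
    conv_lhs => rw [hm]
    push_cast
    rfl
  simp only [h2, ← Ideal.span_singleton_mul_span_singleton, ← Ideal.span_singleton_pow,
    emultiplicity_mul hPp, emultiplicity_pow hPp, he, hzero hu, hzero hmP, add_zero, mul_one] at h1
  rw [(FiniteMultiplicity.of_prime_left hPp (by
    rwa [Ne, Ideal.zero_eq_bot, Ideal.span_singleton_eq_bot])).emultiplicity_eq_multiplicity] at h1
  have h3 : 2 * multiplicity P (Ideal.span {a}) = padicValInt p s := by exact_mod_cast h1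
  exact (Nat.not_even_iff_odd.2 hs) (h3 ▸ even_two_mul _)

end Inertia

section CriticalOrbit

theorem derivative_polyIter_succ {R : Type*} [CommRing R] (φ : R[X]) (n : ℕ) :
    derivative (polyIter φ (n + 1)) =
      derivative φ * ∏ i ∈ Finset.range n, (derivative φ).comp (polyIter φ (i + 1)) := by
  induction n with
  | zero => simp [polyIter]
  | succ n ih => rw [polyIter, derivative_comp, ih, Finset.prod_range_succ, polyIter]; ring

theorem derivative_phiDC {d : ℕ} (hd : 3 ≤ d) (c : ℕ) : derivative (phiDC d c) =
    (X - C (critOrbit d c 1)) * (C (d : ℤ) * X ^ (d - 2)) := by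
  obtain ⟨e, rfl⟩ : ∃ e, d = e + 3 := ⟨d - 3, by omega⟩
  rw [critOrbit_one hd]
  simp [phiDC]
  ring

theorem aeval_polyIter_add {k : Type*} [CommRing k] (φ : ℤ[X]) (m n : ℕ) (z : k) :
    aeval z (polyIter φ (m + n)) = aeval (aeval z (polyIter φ n)) (polyIter φ m) := by
  induction m with
  | zero => simp [polyIter]
  | succ m ih => rw [Nat.succ_add, polyIter, polyIter, aeval_comp, aeval_comp, ih]

theorem aeval_critOrbit {k : Type*} [CommRing k] (d c m n : ℕ) :
    aeval ((critOrbit d c n : ℤ) : k) (polyIter (phiDC d c) m) = (critOrbit d c (m + n) : ℤ) := by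
  have h := aeval_polyIter_add (phiDC d c) m n (0 : ℤ)
  simp only [coe_aeval_eq_eval] at h
  rw [critOrbit, critOrbit, h, ← eq_intCast (algebraMap ℤ k), aeval_algebraMap_apply]
  simp

/-- The cofactor of `X - α` in the derivative of the iterate. -/
noncomputable def iterDerivCofactor (d c n : ℕ) : ℤ[X] :=
  C (d : ℤ) * X ^ (d - 2) *
    ∏ i ∈ Finset.range n, (derivative (phiDC d c)).comp (polyIter (phiDC d c) (i + 1))

theorem derivative_polyIter_phiDC {d : ℕ} (hd : 3 ≤ d) (c n : ℕ) :
    derivative (polyIter (phiDC d c) (n + 1)) =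
      (X - C (critOrbit d c 1)) * iterDerivCofactor d c n := by
  rw [derivative_polyIter_succ, derivative_phiDC hd, iterDerivCofactor, ← derivative_phiDC hd]
  rw [derivative_phiDC hd]
  ring

variable {k : Type*} [CommRing k] [IsDomain k] {d c n : ℕ}

theorem aeval_iterDerivCofactor_ne_zero (hd : 3 ≤ d) (hdk : (d : k) ≠ 0)
    (hne : ∀ j, 1 ≤ j → j ≤ n + 1 → (critOrbit d c j : k) ≠ 0)
    {γ : k} (hγ : aeval γ (polyIter (phiDC d c) (n + 1)) = 0)
    : aeval γ (iterDerivCofactor d c n) ≠ 0 := by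
  have h0 : (critOrbit d c 0 : k) = 0 := by rw [critOrbit_zero]; simp
  have hz : ∀ i ≤ n, aeval γ (polyIter (phiDC d c) i) ≠ 0 := by
    intro i hi h
    have h1 := aeval_polyIter_add (phiDC d c) (n + 1 - i) i γ
    rw [Nat.sub_add_cancel (by omega), hγ, h, ← h0, aeval_critOrbit] at h1
    exact hne (n + 1 - i + 0) (by omega) (by omega) (h1.symm.trans h0)
  have hα : ∀ i, 1 ≤ i → i ≤ n → aeval γ (polyIter (phiDC d c) i) ≠ critOrbit d c 1 := by
    intro i hi1 hi h
    have h1 := aeval_polyIter_add (phiDC d c) (n + 1 - i) i γ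
    rw [Nat.sub_add_cancel (by omega), hγ, h, aeval_critOrbit] at h1
    exact hne (n + 1 - i + 1) (by omega) (by omega) h1.symm
  rw [iterDerivCofactor, map_mul, map_mul, map_prod]
  refine mul_ne_zero (mul_ne_zero (by simpa using hdk) ?_) (Finset.prod_ne_zero_iff.2 ?_)
  · rw [map_pow, aeval_X]
    exact pow_ne_zero _ (by simpa [polyIter] using hz 0 (by omega))
  · intro i hi
    rw [Finset.mem_range] at hi
    rw [derivative_phiDC hd, aeval_comp]
    simp only [map_mul, map_sub, aeval_X, map_pow, eq_intCast, map_intCast,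
      map_natCast]
    exact mul_ne_zero (sub_ne_zero.2 (hα (i + 1) (by omega) (by omega)))
      (mul_ne_zero hdk (pow_ne_zero _ (hz (i + 1) (by omega))))

theorem X_sub_C_sq_dvd_polyIter_sub (hd : 3 ≤ d) (c n : ℕ) :
    (X - C (critOrbit d c 1)) ^ 2 ∣
      polyIter (phiDC d c) (n + 1) - C (critOrbit d c (n + 2)) := by
  set f := polyIter (phiDC d c) (n + 1) - C (critOrbit d c (n + 2)) with hf
  by_cases hf0 : f = 0
  · rw [hf0]; exact dvd_zero _
  have h1 : f.IsRoot (critOrbit d c 1) := by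
    have := aeval_critOrbit (k := ℤ) d c (n + 1) 1
    simp only [Int.cast_id, coe_aeval_eq_eval] at this
    rw [IsRoot, hf, eval_sub, eval_C, this, sub_self]
  have h2 : (derivative f).IsRoot (critOrbit d c 1) := by
    rw [hf, derivative_sub, derivative_C, sub_zero, derivative_polyIter_phiDC hd]
    simp
  rw [← le_rootMultiplicity_iff hf0]
  exact (one_lt_rootMultiplicity_iff_isRoot hf0).2 ⟨h1, h2⟩

/-- A double root of the reduction of the iterate is the critical point `α`. -/
theorem eq_critOrbit_one_of_sq_dvd (hd : 3 ≤ d) (hdk : (d : k) ≠ 0)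
    (hne : ∀ j, 1 ≤ j → j ≤ n + 1 → (critOrbit d c j : k) ≠ 0) {γ : k}
    (h : (X - C γ) ^ 2 ∣ (polyIter (phiDC d c) (n + 1)).map (Int.castRingHom k)) :
    γ = critOrbit d c 1 := by
  obtain ⟨g, hg⟩ := h
  have h1 : aeval γ (polyIter (phiDC d c) (n + 1)) = 0 := by
    rw [aeval_def, algebraMap_int_eq, ← eval_map, hg]; simp
  have h2 : aeval γ (derivative (polyIter (phiDC d c) (n + 1))) = 0 := by
    rw [aeval_def, algebraMap_int_eq, ← eval_map, ← derivative_map, hg]; simp [derivative_pow]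
  rw [derivative_polyIter_phiDC hd, map_mul, mul_eq_zero,
    or_iff_left (aeval_iterDerivCofactor_ne_zero hd hdk hne h1)] at h2
  simpa [sub_eq_zero] using h2

theorem not_X_sub_C_cube_dvd (hd : 3 ≤ d) (hdk : (d : k) ≠ 0)
    (hne : ∀ j, 1 ≤ j → j ≤ n + 1 → (critOrbit d c j : k) ≠ 0) {γ : k} :
    ¬ (X - C γ) ^ 3 ∣ (polyIter (phiDC d c) (n + 1)).map (Int.castRingHom k) := by
  intro h
  have hγ := eq_critOrbit_one_of_sq_dvd hd hdk hne ((pow_dvd_pow _ (by norm_num)).trans h)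
  obtain ⟨g, hg⟩ := h
  have h1 : aeval γ (polyIter (phiDC d c) (n + 1)) = 0 := by
    rw [aeval_def, algebraMap_int_eq, ← eval_map, hg]; simp
  apply aeval_iterDerivCofactor_ne_zero hd hdk hne h1
  have h2 := congrArg derivative hg
  rw [derivative_map, derivative_polyIter_phiDC hd, Polynomial.map_mul] at h2
  have h3 : (iterDerivCofactor d c n).map (Int.castRingHom k) =
      (X - C γ) * (3 * g + (X - C γ) * derivative g) := by
    refine mul_left_cancel₀ (X_sub_C_ne_zero γ) ?_
    rw [hγ]
    rw [hγ] at h2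
    simp only [Polynomial.map_sub, map_X, eq_intCast, Polynomial.map_intCast] at h2 ⊢
    rw [map_intCast]
    refine h2.trans ?_
    rw [derivative_mul, derivative_pow, derivative_sub, derivative_X, derivative_C, map_intCast]
    push_cast
    rw [show (C 3 : k[X]) = 3 from rfl]
    ring
  rw [aeval_def, algebraMap_int_eq, ← eval_map, h3]
  simp

end CriticalOrbit

section GoodPrime

open NumberField

variable {L : Type*} [Field L] [NumberField L]

/-- A monic integer polynomial splitting in a number field splits over its ring of integers. -/
theorem exists_multiset_ringOfIntegers {f : ℤ[X]} (hf : f.Monic)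
    (hirr : Irreducible (f.map (algebraMap ℤ ℚ))) (hsplit : (f.map (Int.castRingHom L)).Splits) :
    ∃ s : Multiset (𝓞 L), s.Nodup ∧ (∀ z : 𝓞 L, z ∈ s ↔ aeval (z : L) f = 0) ∧
      f.map (Int.castRingHom (𝓞 L)) = (s.map fun a => X - C a).prod := by
  have hroot : ∀ z : L, z ∈ (f.map (Int.castRingHom L)).roots ↔ aeval z f = 0 := fun z => by
    rw [mem_roots (hf.map _).ne_zero, IsRoot, eval_map, aeval_def, algebraMap_int_eq]
  have hlift : CanLift L (𝓞 L) (fun a : 𝓞 L => (a : L))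
      (fun z => z ∈ (f.map (Int.castRingHom L)).roots) :=
    ⟨fun z hz => ⟨⟨z, f, hf, (hroot z).1 hz⟩, rfl⟩⟩
  obtain ⟨s, hs⟩ : ∃ s : Multiset (𝓞 L), s.map (fun a : 𝓞 L => (a : L)) =
      (f.map (Int.castRingHom L)).roots :=
    (Multiset.canLift (fun a : 𝓞 L => (a : L)) _).prf _ fun _ => id
  refine ⟨s, ?_, fun z => ?_, ?_⟩
  · refine Multiset.Nodup.of_map (fun a : 𝓞 L => (a : L)) ?_
    rw [hs]
    refine nodup_roots ?_
    have := (hirr.separable).map (f := algebraMap ℚ L)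
    rwa [Polynomial.map_map, show (algebraMap ℚ L).comp (algebraMap ℤ ℚ) = Int.castRingHom L from
      RingHom.ext_int _ _] at this
  · rw [← hroot, ← hs, Multiset.mem_map]
    exact ⟨fun h => ⟨z, h, rfl⟩, fun ⟨w, hw, h⟩ => RingOfIntegers.ext h ▸ hw⟩
  · refine Polynomial.map_injective (algebraMap (𝓞 L) L) RingOfIntegers.coe_injective ?_
    rw [Polynomial.map_map, show (algebraMap (𝓞 L) L).comp (Int.castRingHom (𝓞 L)) =
      Int.castRingHom L from RingHom.ext_int _ _, hsplit.eq_prod_roots_of_monic (hf.map _), ← hs,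
      Polynomial.map_multiset_prod, Multiset.map_map, Multiset.map_map]
    simp

variable [IsGalois ℚ L]

theorem exists_swap_of_isGoodPrime {d c n p : ℕ} (hd : 3 ≤ d)
    (hirr : Irreducible ((polyIter (phiDC d c) (n + 1)).map (algebraMap ℤ ℚ)))
    (hgood : IsGoodPrime d c (n + 2) p)
    (hsplit : ((polyIter (phiDC d c) (n + 1)).map (Int.castRingHom L)).Splits)
    (hgen : ∀ σ : L ≃ₐ[ℚ] L,
      (∀ z, aeval z (polyIter (phiDC d c) (n + 1)) = 0 → σ z = z) → σ = 1) :
    ∃ (σ : L ≃ₐ[ℚ] L) (x : L), aeval x (polyIter (phiDC d c) (n + 1)) = 0 ∧ σ x ≠ x ∧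
      σ (σ x) = x ∧ ∀ z, aeval z (polyIter (phiDC d c) (n + 1)) = 0 → z ≠ x → z ≠ σ x →
        σ z = z := by
  obtain ⟨hp, hpd, hpj, hodd⟩ := hgood
  set f := polyIter (phiDC d c) (n + 1) with hf
  have hfm : f.Monic := (monic_phiDC hd c).polyIter (by rw [natDegree_phiDC hd]; omega) _
  obtain ⟨s, hsn, hsroot, hsprod⟩ := exists_multiset_ringOfIntegers hfm hirr hsplit
  have := Fact.mk hp
  have hpmax : (Ideal.span {(p : ℤ)}).IsMaximal :=
    PrincipalIdealRing.isMaximal_of_irreducible (Nat.prime_iff_prime_int.1 hp).irreducible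
  obtain ⟨P, hPmax, hover⟩ :=
    Ideal.exists_maximal_ideal_liesOver_of_isIntegral (S := 𝓞 L) (Ideal.span {(p : ℤ)})
  have hint : ∀ m : ℤ, (m : 𝓞 L ⧸ P) = 0 ↔ (p : ℤ) ∣ m := by
    intro m
    rw [← Ideal.mem_span_singleton, hover.over, Ideal.mem_comap, ← Ideal.Quotient.eq_zero_iff_mem]
    simp
  have hpP : (p : 𝓞 L) ∈ P := by
    rw [← Ideal.Quotient.eq_zero_iff_mem]
    simpa using (hint p).2 dvd_rfl
  have hdk : (d : 𝓞 L ⧸ P) ≠ 0 := by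
    intro h
    exact hpd (by exact_mod_cast (hint d).1 (by exact_mod_cast h))
  have hne : ∀ j, 1 ≤ j → j ≤ n + 1 → (critOrbit d c j : 𝓞 L ⧸ P) ≠ 0 := fun j h1 h2 h =>
    hpj j h1 (by omega) ((hint _).1 h)
  have hmk : (Ideal.Quotient.mk P).comp (Int.castRingHom (𝓞 L)) = Int.castRingHom (𝓞 L ⧸ P) :=
    RingHom.ext_int _ _
  have hdvd : ∀ t : Multiset (𝓞 L), t.Nodup → t ⊆ s →
      (t.map fun a => X - C (Ideal.Quotient.mk P a)).prod ∣ f.map (Int.castRingHom (𝓞 L ⧸ P)) := by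
    intro t ht hts
    rw [← hmk, ← Polynomial.map_map, hsprod, Polynomial.map_multiset_prod, Multiset.map_map]
    simp only [Function.comp_def, Polynomial.map_sub, map_X, map_C]
    exact Multiset.prod_dvd_prod_of_le (Multiset.map_le_map ((Multiset.le_iff_subset ht).2 hts))
  have hthree : ∀ x y z : 𝓞 L, x ∈ s → y ∈ s → z ∈ s → Ideal.Quotient.mk P y =
      Ideal.Quotient.mk P x → Ideal.Quotient.mk P z = Ideal.Quotient.mk P x → x ≠ y → x ≠ z →
      y = z := by
    intro x y z hx hy hz hyx hzx hxy hxz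
    by_contra hyz
    have h1 := hdvd {x, y, z} (by simp [hxy, hxz, hyz]) (by simp [Multiset.cons_subset, hx, hy, hz])
    simp only [Multiset.insert_eq_cons, Multiset.map_cons, Multiset.map_singleton,
      Multiset.prod_cons, Multiset.prod_singleton, hyx, hzx] at h1
    refine not_X_sub_C_cube_dvd hd hdk hne (γ := Ideal.Quotient.mk P x) ?_
    convert h1 using 1
    ring
  have htwo : ∀ x y : 𝓞 L, x ∈ s → y ∈ s → Ideal.Quotient.mk P y = Ideal.Quotient.mk P x →
      x ≠ y → Ideal.Quotient.mk P x = (critOrbit d c 1 : 𝓞 L ⧸ P) := by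
    intro x y hx hy hyx hxy
    have h1 := hdvd {x, y} (by simp [hxy]) (by simp [Multiset.cons_subset, hx, hy])
    simp only [Multiset.insert_eq_cons, Multiset.map_cons, Multiset.map_singleton,
      Multiset.prod_cons, Multiset.prod_singleton, hyx] at h1
    exact eq_critOrbit_one_of_sq_dvd hd hdk hne (by rwa [sq])
  obtain ⟨U, hU⟩ := X_sub_C_sq_dvd_polyIter_sub hd c n
  have hdvdp : (p : ℤ) ∣ critOrbit d c (n + 2) := by
    by_contra h
    rw [padicValInt_eq_zero_of_not_dvd h] at hodd
    simp at hodd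
  have hfU : f.map (Int.castRingHom (𝓞 L ⧸ P)) =
      (X - C (critOrbit d c 1 : 𝓞 L ⧸ P)) ^ 2 * U.map (Int.castRingHom (𝓞 L ⧸ P)) := by
    have h1 := congrArg (Polynomial.map (Int.castRingHom (𝓞 L ⧸ P))) hU
    rw [← hf, Polynomial.map_sub, map_C, eq_intCast, (hint _).2 hdvdp, C_0, sub_zero] at h1
    simpa using h1
  obtain ⟨x₀, hx₀s, hx₀⟩ : ∃ x₀ ∈ s, Ideal.Quotient.mk P x₀ = (critOrbit d c 1 : 𝓞 L ⧸ P) := by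
    have h1 := congrArg (eval (critOrbit d c 1 : 𝓞 L ⧸ P)) hfU
    rw [← hmk, ← Polynomial.map_map, hsprod, Polynomial.map_multiset_prod, Multiset.map_map,
      eval_multiset_prod, Multiset.map_map] at h1
    simp only [eval_mul, eval_pow, eval_sub, eval_X, eval_C, sub_self, ne_eq, OfNat.ofNat_ne_zero,
      not_false_eq_true, zero_pow, zero_mul, Multiset.prod_eq_zero_iff, Multiset.mem_map] at h1
    obtain ⟨a, ha, h2⟩ := h1
    refine ⟨a, ha, ?_⟩
    simp only [Function.comp_def, Polynomial.map_sub, map_X, map_C, eval_sub, eval_X, eval_C,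
      sub_eq_zero] at h2
    exact h2.symm
  have hUx : aeval x₀ U ∉ P := by
    intro h
    rw [← Ideal.Quotient.eq_zero_iff_mem, aeval_def, algebraMap_int_eq, hom_eval₂, hmk, hx₀,
      ← eval_map, ← IsRoot, ← dvd_iff_isRoot] at h
    obtain ⟨W, hW⟩ := h
    exact not_X_sub_C_cube_dvd hd hdk hne ⟨W, by rw [← hf, hfU, hW]; ring⟩
  have hval : (x₀ - (critOrbit d c 1 : ℤ)) ^ 2 * (-aeval x₀ U) = (critOrbit d c (n + 2) : ℤ) := by
    have h1 := congrArg (aeval x₀) hU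
    have h2 : aeval x₀ f = 0 := by
      refine RingOfIntegers.coe_injective ?_
      have := (hsroot x₀).1 hx₀s
      rw [aeval_def, algebraMap_int_eq] at this ⊢
      rw [hom_eval₂]
      rw [map_zero, ← this]
      exact eval₂_congr (RingHom.ext_int _ _) rfl rfl
    rw [map_sub, ← hf, h2] at h1
    simp only [map_mul, map_pow, map_sub, aeval_X, eq_intCast, map_intCast] at h1
    linear_combination h1
  obtain ⟨σ, hσ, hσ1⟩ := exists_mem_inertia_ne_one hp P hpP (neg_mem_iff.not.2 hUx) hodd hval
  have hσroot : ∀ z ∈ s, σ • z ∈ s := by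
    intro z hz
    rw [hsroot] at hz ⊢
    have h1 : ((σ • z : 𝓞 L) : L) = σ z := rfl
    rw [h1, aeval_int_algEquiv, hz, map_zero]
  have hσP : ∀ z, Ideal.Quotient.mk P (σ • z) = Ideal.Quotient.mk P z := fun z =>
    Ideal.Quotient.eq.2 (hσ z)
  have hlift : ∀ z : L, aeval z f = 0 → ∃ a ∈ s, (a : L) = z := fun z hz =>
    ⟨⟨z, f, hfm, hz⟩, (hsroot _).2 hz, rfl⟩
  obtain ⟨x, hxs, hx⟩ : ∃ x ∈ s, σ • x ≠ x := by
    by_contra! h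
    refine hσ1 (hgen σ fun z hz => ?_)
    obtain ⟨a, ha, rfl⟩ := hlift z hz
    exact congrArg (fun w : 𝓞 L => (w : L)) (h a ha)
  have hxα := htwo x (σ • x) hxs (hσroot x hxs) (hσP x) hx.symm
  have hfix : ∀ z ∈ s, z ≠ x → z ≠ σ • x → σ • z = z := by
    intro z hz hzx hzx'
    by_contra h
    have hzα := htwo z (σ • z) hz (hσroot z hz) (hσP z) (Ne.symm h)
    exact hzx' (hthree x (σ • x) z hxs (hσroot x hxs) hz (hσP x) (hzα.trans hxα.symm) hx.symm
      hzx.symm).symm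
  have hxx : σ • σ • x = x := by
    by_contra h
    have := hthree x (σ • x) (σ • σ • x) hxs (hσroot x hxs) (hσroot _ (hσroot x hxs)) (hσP x)
      ((hσP _).trans (hσP x)) hx.symm (Ne.symm h)
    exact hx (MulAction.injective σ this).symm
  refine ⟨σ, x, (hsroot x).1 hxs, fun h => hx (RingOfIntegers.ext h),
    congrArg (fun w : 𝓞 L => (w : L)) hxx, fun z hz hzx hzx' => ?_⟩
  obtain ⟨a, ha, rfl⟩ := hlift z hz
  exact congrArg (fun w : 𝓞 L => (w : L)) (hfix a ha (fun h => hzx (by rw [h]))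
    (fun h => hzx' (by rw [h]; rfl)))

end GoodPrime

section SwapLift

variable {Ω : Type*} [Field Ω] [CharZero Ω] [IsAlgClosed Ω] {φ : ℤ[X]}

/-- An automorphism acting as a transposition on the roots of the `(n+1)`-st iterate fixes the
roots of the `n`-th iterate, when the degree is at least three. -/
theorem fiberSwap_of_swap (hφ : φ.Monic) (hdeg : 3 ≤ φ.natDegree) {n : ℕ}
    (hirr : Irreducible ((polyIter φ (n + 1)).map (algebraMap ℤ ℚ))) {σ : Ω ≃ₐ[ℚ] Ω} {x : Ω}
    (hx : x ∈ iterRoots Ω φ (n + 1)) (hσ : σ (σ x) = x)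
    (hfix : ∀ z ∈ iterRoots Ω φ (n + 1), z ≠ x → z ≠ σ x → σ z = z) :
    FiberSwap φ n x (σ x) ∧ aeval (σ x) φ = aeval x φ := by
  have hdeg0 : φ.natDegree ≠ 0 := by omega
  have h : ∀ b ∈ iterRoots Ω φ n, σ b = b := by
    intro b hb
    have h1 := ncard_fiber hφ hdeg0 hirr hb
    obtain ⟨z, hz, hzx⟩ : ∃ z ∈ {z : Ω | aeval z φ = b}, z ∉ ({x, σ x} : Set Ω) := by
      refine Set.exists_mem_notMem_of_ncard_lt_ncard ?_
      have := Set.ncard_insert_le x {σ x}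
      rw [Set.ncard_singleton] at this
      omega
    simp only [Set.mem_insert_iff, Set.mem_singleton_iff, not_or] at hzx
    have hz' : aeval z φ = b := hz
    rw [← hz', ← aeval_int_algEquiv, hfix z _ hzx.1 hzx.2]
    rw [← aeval_mem_iterRoots hφ hdeg0, hz']
    exact hb
  refine ⟨⟨σ, h, rfl, hσ, hfix⟩, ?_⟩
  rw [aeval_int_algEquiv]
  exact h _ ((aeval_mem_iterRoots hφ hdeg0).2 hx)

variable [Algebra.IsAlgebraic ℚ Ω]

instance iterField_finiteDimensional (φ : ℤ[X]) (n : ℕ) :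
    FiniteDimensional ℚ (iterField Ω φ n) := by
  have := (finite_iterRoots Ω φ n).to_subtype
  exact IntermediateField.finiteDimensional_adjoin fun x _ => Algebra.IsIntegral.isIntegral x

theorem exists_fiberSwap_of_isGoodPrime {d c n p : ℕ} (hd : 3 ≤ d)
    (hirr : Irreducible ((polyIter (phiDC d c) (n + 1)).map (algebraMap ℤ ℚ)))
    (hgood : IsGoodPrime d c (n + 2) p) :
    ∃ x y : Ω, x ∈ iterRoots Ω (phiDC d c) (n + 1) ∧ x ≠ y ∧
      aeval x (phiDC d c) = aeval y (phiDC d c) ∧ FiberSwap (phiDC d c) n x y := by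
  have hφ := monic_phiDC hd c
  have hdeg : (phiDC d c).natDegree ≠ 0 := by rw [natDegree_phiDC hd]; omega
  set f := polyIter (phiDC d c) (n + 1) with hf
  set L := iterField Ω (phiDC d c) (n + 1) with hL
  have : NumberField L := {}
  have : IsGalois ℚ L := {}
  have hnormal : Normal ℚ Ω := normal_iff.2 fun x =>
    ⟨Algebra.IsIntegral.isIntegral x, IsAlgClosed.splits _⟩
  have hval : ∀ z : L, aeval (z : Ω) f = (aeval z f : L) := fun z =>
    aeval_algHom_apply (L.val.restrictScalars ℤ) z f
  have hroot : ∀ z : L, aeval z f = 0 ↔ (z : Ω) ∈ iterRoots Ω (phiDC d c) (n + 1) := fun z => by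
    rw [mem_iterRoots hφ hdeg, hval, ZeroMemClass.coe_eq_zero]
  obtain ⟨σ, x, hx, hσx, hσσ, hfix⟩ := exists_swap_of_isGoodPrime (L := L) hd hirr hgood (by
    refine Splits.of_splits_map (algebraMap L Ω) (IsAlgClosed.splits _) fun z hz => ?_
    rw [Polynomial.map_map, mem_roots', IsRoot, eval_map] at hz
    have h1 : aeval z f = 0 := by
      rw [← hz.2, aeval_def]
      exact eval₂_congr (RingHom.ext_int _ _) rfl rfl
    exact ⟨⟨z, mem_iterField_of_mem_iterRoots ((mem_iterRoots hφ hdeg).2 h1)⟩, rfl⟩) (by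
    intro σ hσ
    have h2 : (σ : L →ₐ[ℚ] L) = (1 : L ≃ₐ[ℚ] L) :=
      IntermediateField.algHom_ext_of_eq_adjoin ℚ (S := L) rfl
        fun z hz => hσ ⟨z, _⟩ ((hroot _).2 hz)
    exact AlgEquiv.ext fun x => DFunLike.congr_fun h2 x)
  have hlift : ∀ z : L, σ.liftNormal Ω (z : Ω) = σ z := fun z => σ.liftNormal_commutes Ω z
  have h := fiberSwap_of_swap (σ := σ.liftNormal Ω) (x := (x : Ω)) hφ
    (hd.trans_eq (natDegree_phiDC hd c).symm) hirr ((hroot x).1 hx) (by rw [hlift, hlift, hσσ])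
    (fun z hz h1 h2 => by
      have h3 := hlift ⟨z, mem_iterField_of_mem_iterRoots hz⟩
      rw [hfix ⟨z, _⟩ ((hroot _).2 hz) (fun h => h1 (congrArg Subtype.val h))
        (fun h => h2 (by rw [hlift]; exact congrArg Subtype.val h))] at h3
      exact h3)
  exact ⟨x, _, (hroot x).1 hx, fun h1 => hσx (Subtype.ext (by rw [← hlift, ← h1])), h.2.symm, h.1⟩

end SwapLift

section Cubic

theorem not_isSquare_three_mul_two_mul_sq_sub_one (c : ℕ) :
    ¬ IsSquare ((3 * (2 * (c : ℤ) ^ 2 - 1) : ℤ) : ℚ) := by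
  rw [Rat.isSquare_intCast_iff]
  rintro ⟨t, ht⟩
  have h1 := congrArg (Int.cast : ℤ → ZMod 9) ht
  push_cast at h1
  revert h1
  generalize (t : ZMod 9) = t'
  generalize (c : ZMod 9) = c'
  revert t' c'
  decide

theorem discr_cubic {Ω : Type*} [Field Ω] {a b e : Ω} {c : ℕ} (hab : a ≠ b) (hae : a ≠ e)
    (hbe : b ≠ e)
    (ha : a ^ 3 - 3 * c * a ^ 2 + 2 * c = 0) (hb : b ^ 3 - 3 * c * b ^ 2 + 2 * c = 0)
    (he : e ^ 3 - 3 * c * e ^ 2 + 2 * c = 0) :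
    ((a - b) * (b - e) * (e - a)) ^ 2 = 3 * (2 * (c : Ω) ^ 2 - 1) * (6 * c) ^ 2 := by
  have h1 : a ^ 2 + a * b + b ^ 2 - 3 * c * (a + b) = 0 :=
    mul_left_cancel₀ (sub_ne_zero.2 hab) (by linear_combination ha - hb)
  have h2 : a ^ 2 + a * e + e ^ 2 - 3 * c * (a + e) = 0 :=
    mul_left_cancel₀ (sub_ne_zero.2 hae) (by linear_combination ha - he)
  have e1 : a + b + e = 3 * c :=
    mul_left_cancel₀ (sub_ne_zero.2 hbe) (by linear_combination h1 - h2)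
  have e2 : a * b + b * e + e * a = 0 := by linear_combination (a + b) * e1 - h1
  have e3 : a * b * e = -(2 * c) := by linear_combination ha + a * e2 - a ^ 2 * e1
  have h3 : ((a - b) * (b - e) * (e - a)) ^ 2 =
      (a + b + e) ^ 2 * (a * b + b * e + e * a) ^ 2 - 4 * (a * b + b * e + e * a) ^ 3
      - 4 * (a + b + e) ^ 3 * (a * b * e)
      + 18 * (a + b + e) * (a * b + b * e + e * a) * (a * b * e) - 27 * (a * b * e) ^ 2 := by ring
  rw [h3, e1, e2, e3]
  ring

variable {Ω : Type*} [Field Ω] [CharZero Ω] [IsAlgClosed Ω] [Algebra.IsAlgebraic ℚ Ω]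

theorem exists_fiberSwap_cubic {c : ℕ} (hc : 0 < c)
    (hirr : Irreducible ((polyIter (phiDC 3 c) 1).map (algebraMap ℤ ℚ))) :
    ∃ x y : Ω, x ∈ iterRoots Ω (phiDC 3 c) 1 ∧ x ≠ y ∧
      aeval x (phiDC 3 c) = aeval y (phiDC 3 c) ∧ FiberSwap (phiDC 3 c) 0 x y := by
  have hφ := monic_phiDC le_rfl c
  have hdeg : (phiDC 3 c).natDegree = 3 := natDegree_phiDC le_rfl c
  have hdeg0 : (phiDC 3 c).natDegree ≠ 0 := by omega
  have hcard := card_iterRoots (Ω := Ω) 1 hirr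
  rw [hdeg, pow_one, Nat.card_coe_set_eq, Set.ncard_eq_three] at hcard
  obtain ⟨a, b, e, hab, hae, hbe, hR⟩ := hcard
  have hroot : ∀ z ∈ iterRoots Ω (phiDC 3 c) 1, z ^ 3 - 3 * c * z ^ 2 + 2 * c = 0 := by
    intro z hz
    rw [mem_iterRoots hφ hdeg0] at hz
    simp [polyIter, phiDC, map_ofNat] at hz
    linear_combination hz
  have ha : a ∈ iterRoots Ω (phiDC 3 c) 1 := by simp [hR]
  have hb : b ∈ iterRoots Ω (phiDC 3 c) 1 := by simp [hR]
  have he : e ∈ iterRoots Ω (phiDC 3 c) 1 := by simp [hR]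
  have hdisc := discr_cubic hab hae hbe (hroot a ha) (hroot b hb) (hroot e he)
  obtain ⟨σ, hσ⟩ : ∃ σ : Ω ≃ₐ[ℚ] Ω,
      σ ((a - b) * (b - e) * (e - a)) ≠ (a - b) * (b - e) * (e - a) := by
    by_contra! h
    have hnormal : Normal ℚ Ω := normal_iff.2 fun x =>
      ⟨Algebra.IsIntegral.isIntegral x, IsAlgClosed.splits _⟩
    have : IsGalois ℚ Ω := {}
    rw [← InfiniteGalois.mem_bot_iff_fixed] at h
    obtain ⟨r, hr⟩ := IntermediateField.mem_bot.1 h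
    apply not_isSquare_three_mul_two_mul_sq_sub_one c
    have hc0 : (c : ℚ) ≠ 0 := by exact_mod_cast hc.ne'
    refine ⟨r / (6 * c), ?_⟩
    rw [← hr, ← map_pow] at hdisc
    have h1 : r ^ 2 = 3 * (2 * (c : ℚ) ^ 2 - 1) * (6 * c) ^ 2 := by
      refine (algebraMap ℚ Ω).injective ?_
      rw [hdisc]
      simp
    push_cast
    field_simp
    linear_combination -h1
  have hmem : ∀ z ∈ iterRoots Ω (phiDC 3 c) 1, σ z = a ∨ σ z = b ∨ σ z = e := by
    intro z hz
    have := (algEquiv_mem_iterRoots hφ hdeg0 σ).2 hz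
    simpa [hR] using this
  have key : ∀ x ∈ iterRoots Ω (phiDC 3 c) 1, σ x ≠ x → σ (σ x) = x →
      (∀ z ∈ iterRoots Ω (phiDC 3 c) 1, z ≠ x → z ≠ σ x → σ z = z) →
      ∃ x y : Ω, x ∈ iterRoots Ω (phiDC 3 c) 1 ∧ x ≠ y ∧
      aeval x (phiDC 3 c) = aeval y (phiDC 3 c) ∧ FiberSwap (phiDC 3 c) 0 x y := by
    intro x hx h1 h2 h3
    have h := fiberSwap_of_swap hφ hdeg.ge hirr hx h2 h3
    exact ⟨x, σ x, hx, h1.symm, h.2.symm, h.1⟩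
  have hinj := σ.injective
  simp only [hR, Set.mem_insert_iff, Set.mem_singleton_iff, forall_eq_or_imp, forall_eq] at key hmem
  rw [map_mul, map_mul, map_sub, map_sub, map_sub] at hσ
  obtain ⟨ka, kb, ke⟩ := key
  have hσab := hinj.ne hab
  have hσae := hinj.ne hae
  have hσbe := hinj.ne hbe
  obtain ⟨h1 | h1 | h1, h2 | h2 | h2, h3 | h3 | h3⟩ := hmem <;>
    simp only [h1, h2, h3] at hσab hσae hσbe hσ ka kb ke <;> grind

end Cubic

theorem aeval_int_ringHom {A B : Type*} [CommRing A] [CommRing B] [Algebra ℤ A] [Algebra ℤ B]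
    (f : A →+* B) (p : ℤ[X]) (z : A) : aeval (f z) p = f (aeval z p) := by
  rw [aeval_def, aeval_def, hom_eval₂, Subsingleton.elim (f.comp (algebraMap ℤ A))]

section SmallRoots

variable {q : ℕ} [Fact q.Prime] {d c : ℕ}

theorem norm_natCast_padicAlgCl (m : ℕ) : ‖(m : PadicAlgCl q)‖ = ‖(m : ℚ_[q])‖ := by
  rw [← PadicAlgCl.norm_extends, map_natCast]

theorem aeval_phiDC_eq {R : Type*} [CommRing R] [Algebra ℤ R] (hd : 3 ≤ d) (z : R) :
    aeval z (phiDC d c) = z ^ (d - 1) * (z - (c * d : ℕ)) + (c * (d - 1) : ℕ) := by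
  obtain ⟨e, rfl⟩ : ∃ e, d = e + 1 := ⟨d - 1, by omega⟩
  simp [phiDC]
  ring

/-- The roots of the `n`-th iterate all of whose iterates lie in the open unit disc. -/
def smallRoots (q : ℕ) [Fact q.Prime] (d c : ℕ) : ℕ → Set (PadicAlgCl q)
  | 0 => {0}
  | n + 1 => {z | aeval z (phiDC d c) ∈ smallRoots q d c n ∧ ‖z‖ < 1}

theorem norm_pow_eq_of_norm_lt_one (hd : 3 ≤ d) (hcd : ¬ q ∣ c * d) {z : PadicAlgCl q}
    (hz : ‖z‖ < 1) :
    ‖z‖ ^ (d - 1) = ‖aeval z (phiDC d c) - (c * (d - 1) : ℕ)‖ := by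
  have h1 : ‖((c * d : ℕ) : PadicAlgCl q)‖ = 1 := by
    rw [norm_natCast_padicAlgCl, Padic.norm_natCast_eq_one_iff]
    exact (Nat.Prime.coprime_iff_not_dvd Fact.out).2 hcd
  have h2 : ‖z - ((c * d : ℕ) : PadicAlgCl q)‖ = 1 := by
    rw [sub_eq_add_neg, IsUltrametricDist.norm_add_eq_max_of_norm_ne_norm (by
      rw [norm_neg, h1]; exact hz.ne), norm_neg, h1, max_eq_right hz.le]
  rw [aeval_phiDC_eq hd, add_sub_cancel_right, norm_mul, norm_pow, h2, mul_one]

theorem norm_natCast_mul_sub_one (hd : 3 ≤ d) (hc : ¬ q ∣ c) (hq : q ∣ d - 1) :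
    0 < ‖((c * (d - 1) : ℕ) : PadicAlgCl q)‖ ∧ ‖((c * (d - 1) : ℕ) : PadicAlgCl q)‖ < 1 := by
  have hc0 : c ≠ 0 := by rintro rfl; simp at hc
  refine ⟨norm_pos_iff.2 (by exact_mod_cast Nat.mul_ne_zero hc0 (by omega)), ?_⟩
  rw [norm_natCast_padicAlgCl, Padic.norm_natCast_lt_one_iff]
  exact hq.mul_left c

theorem norm_sub_pow_of_mem_smallRoots (hd : 3 ≤ d) (hcd : ¬ q ∣ c * d) (hq : q ∣ d - 1) :
    ∀ {n : ℕ} {β : PadicAlgCl q}, β ∈ smallRoots q d c n →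
      ‖β - (c * (d - 1) : ℕ)‖ ^ (d - 1) ^ n = ‖((c * (d - 1) : ℕ) : PadicAlgCl q)‖ ∧
      (1 ≤ n → ‖β‖ ^ (d - 1) ^ n = ‖((c * (d - 1) : ℕ) : PadicAlgCl q)‖) := by
  obtain ⟨h0, h1⟩ := norm_natCast_mul_sub_one (q := q) hd
    (fun h => hcd (h.mul_right d) : ¬ q ∣ c) hq
  set r := ‖((c * (d - 1) : ℕ) : PadicAlgCl q)‖ with hr
  intro n
  induction n with
  | zero =>
    intro β hβ
    rw [show β = 0 from hβ, zero_sub, norm_neg, pow_zero, pow_one]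
    exact ⟨rfl, by simp⟩
  | succ n ih =>
    rintro β ⟨hβ, hlt⟩
    have h2 : ‖β‖ ^ (d - 1) ^ (n + 1) = r := by
      rw [pow_succ', pow_mul, norm_pow_eq_of_norm_lt_one hd hcd hlt, (ih hβ).1]
    refine ⟨?_, fun _ => h2⟩
    have h3 : r < ‖β‖ := by
      rw [← h2]
      refine pow_lt_self_of_lt_one₀ ?_ hlt (Nat.one_lt_pow (by omega) (by omega))
      rcases (norm_nonneg β).eq_or_lt with h | h
      · rw [← h, zero_pow (pow_ne_zero _ (by omega))] at h2
        exact absurd h2 h0.ne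
      · exact h
    rw [sub_eq_add_neg, IsUltrametricDist.norm_add_eq_max_of_norm_ne_norm (by
      rw [norm_neg, ← hr]; exact h3.ne'), norm_neg, ← hr, max_eq_left h3.le, h2]

theorem norm_sub_lt_one_of_mem_smallRoots (hd : 3 ≤ d) (hcd : ¬ q ∣ c * d) (hq : q ∣ d - 1)
    {n : ℕ} {β : PadicAlgCl q} (hβ : β ∈ smallRoots q d c n) :
    0 < ‖β - (c * (d - 1) : ℕ)‖ ∧ ‖β - (c * (d - 1) : ℕ)‖ < 1 := by
  obtain ⟨h0, h1⟩ := norm_natCast_mul_sub_one (q := q) hd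
    (fun h => hcd (h.mul_right d) : ¬ q ∣ c) hq
  have h2 := (norm_sub_pow_of_mem_smallRoots hd hcd hq hβ).1
  have hne : (d - 1) ^ n ≠ 0 := pow_ne_zero _ (by omega)
  rw [← h2] at h0 h1
  refine ⟨(norm_nonneg _).lt_of_ne fun h => ?_, ?_⟩
  · rw [← h, zero_pow hne] at h0
    exact h0.false
  · exact (pow_lt_one_iff_of_nonneg (norm_nonneg _) hne).1 h1

theorem norm_le_one_of_aeval_mem_smallRoots (hd : 3 ≤ d) (hcd : ¬ q ∣ c * d) (hq : q ∣ d - 1)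
    {n : ℕ} {z : PadicAlgCl q} (hz : aeval z (phiDC d c) ∈ smallRoots q d c n) : ‖z‖ ≤ 1 := by
  have h1 := (norm_sub_lt_one_of_mem_smallRoots hd hcd hq hz).2
  by_contra! h
  rw [aeval_phiDC_eq hd, add_sub_cancel_right, norm_mul, norm_pow] at h1
  have h2 : ‖((c * d : ℕ) : PadicAlgCl q)‖ = 1 := by
    rw [norm_natCast_padicAlgCl, Padic.norm_natCast_eq_one_iff]
    exact (Nat.Prime.coprime_iff_not_dvd Fact.out).2 hcd
  rw [sub_eq_add_neg, IsUltrametricDist.norm_add_eq_max_of_norm_ne_norm (by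
    rw [norm_neg, h2]; exact h.ne'), norm_neg, h2, max_eq_left h.le] at h1
  exact (one_le_mul_of_one_le_of_one_le (one_le_pow₀ h.le) h.le).not_gt h1

/-- The polynomial `φ_{(d,c)} - β` is monic of degree `d` and its roots form the fiber over `β`. -/
theorem roots_fiberPoly (hd : 3 ≤ d) (β : PadicAlgCl q) :
    let f := (phiDC d c).map (algebraMap ℤ (PadicAlgCl q)) - C β
    f.Monic ∧ f.natDegree = d ∧ (∀ z, z ∈ f.roots ↔ aeval z (phiDC d c) = β) ∧
      Multiset.card f.roots = d ∧ f.roots.prod = (-1) ^ d * ((c * (d - 1) : ℕ) - β) := by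
  intro f
  have hm := (monic_phiDC hd c).map (algebraMap ℤ (PadicAlgCl q))
  have hdeg : ((phiDC d c).map (algebraMap ℤ (PadicAlgCl q))).natDegree = d := by
    rw [(monic_phiDC hd c).natDegree_map, natDegree_phiDC hd]
  have hfm : f.Monic := hm.sub_of_left (by
    rw [degree_eq_natDegree hm.ne_zero, hdeg]
    exact degree_C_le.trans_lt (by exact_mod_cast (by omega : 0 < d)))
  have hfd : f.natDegree = d := by rw [natDegree_sub_C, hdeg]
  have hsp := IsAlgClosed.splits f
  refine ⟨hfm, hfd, fun z => ?_, ?_, ?_⟩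
  · rw [mem_roots hfm.ne_zero, IsRoot.def, eval_sub, eval_C, eval_map_algebraMap, sub_eq_zero]
  · rw [← hsp.natDegree_eq_card_roots, hfd]
  · have h := hsp.coeff_zero_eq_prod_roots_of_monic hfm
    have h1 : f.coeff 0 = (c * (d - 1) : ℕ) - β := by
      have := aeval_phiDC_eq (c := c) hd (0 : PadicAlgCl q)
      rw [zero_pow (by omega), zero_mul, zero_add] at this
      rw [coeff_zero_eq_eval_zero, eval_sub, eval_C, eval_map_algebraMap, this]
    rw [← h1, h, hfd, ← mul_assoc, ← mul_pow, neg_one_mul, neg_neg, one_pow, one_mul]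

open Classical in
/-- Above a small root there is exactly one root of norm one, counted with multiplicity. -/
theorem card_filter_norm_lt_one (hd : 3 ≤ d) (hcd : ¬ q ∣ c * d) (hq : q ∣ d - 1)
    {n : ℕ} {β : PadicAlgCl q} (hβ : β ∈ smallRoots q d c n) :
    Multiset.card ((((phiDC d c).map (algebraMap ℤ (PadicAlgCl q)) - C β).roots).filter
      (‖·‖ < 1)) = d - 1 := by
  obtain ⟨h0, h1⟩ := norm_sub_lt_one_of_mem_smallRoots hd hcd hq hβ
  obtain ⟨-, -, hmem, hcard, hprod⟩ := roots_fiberPoly (c := c) hd β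
  set s := ((phiDC d c).map (algebraMap ℤ (PadicAlgCl q)) - C β).roots with hs
  set ρ := ‖β - (c * (d - 1) : ℕ)‖ with hρ
  have hsmall : ∀ z ∈ s.filter (‖·‖ < 1), ‖z‖ ^ (d - 1) = ρ := fun z hz => by
    rw [Multiset.mem_filter, hmem] at hz
    rw [norm_pow_eq_of_norm_lt_one hd hcd hz.2, hz.1]
  have hnorm : (s.map (fun z => ‖z‖)).prod = ρ := by
    have : (s.map (fun z => ‖z‖)).prod = ‖s.prod‖ :=
      Multiset.prod_hom s (normHom (α := PadicAlgCl q))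
    rw [this, hprod, norm_mul, norm_pow, norm_neg, norm_one, one_pow, one_mul, norm_sub_rev]
  rw [← Multiset.filter_add_not (‖·‖ < 1) s, Multiset.map_add, Multiset.prod_add,
    Multiset.prod_eq_one (s := (s.filter (¬ ‖·‖ < 1)).map _) (fun x hx => by
      obtain ⟨z, hz, rfl⟩ := Multiset.mem_map.1 hx
      rw [Multiset.mem_filter, hmem] at hz
      exact le_antisymm (norm_le_one_of_aeval_mem_smallRoots hd hcd hq (hz.1 ▸ hβ))
        (not_lt.1 hz.2)), mul_one] at hnorm
  have hne : d - 1 ≠ 0 := by omega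
  have h2 : ρ ^ Multiset.card (s.filter (‖·‖ < 1)) = ρ ^ (d - 1) := by
    conv_rhs => rw [← hnorm, ← Multiset.prod_map_pow]
    rw [Multiset.map_congr rfl hsmall, Multiset.map_const', Multiset.prod_replicate]
  exact pow_right_injective₀ h0 h1.ne h2

theorem exists_unique_aeval_eq_not_norm_lt_one (hd : 3 ≤ d) (hcd : ¬ q ∣ c * d) (hq : q ∣ d - 1)
    {n : ℕ} {β : PadicAlgCl q} (hβ : β ∈ smallRoots q d c n) :
    ∃! x : PadicAlgCl q, aeval x (phiDC d c) = β ∧ ¬ ‖x‖ < 1 := by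
  classical
  have h1 := card_filter_norm_lt_one hd hcd hq hβ
  obtain ⟨-, -, hmem, hcard, -⟩ := roots_fiberPoly (c := c) hd β
  set s := ((phiDC d c).map (algebraMap ℤ (PadicAlgCl q)) - C β).roots with hs
  rw [← Multiset.filter_add_not (‖·‖ < 1) s, Multiset.card_add, h1] at hcard
  obtain ⟨x, hx⟩ := Multiset.card_eq_one.1
    (by omega : Multiset.card (s.filter (¬ ‖·‖ < 1)) = 1)
  have h : ∀ y, (aeval y (phiDC d c) = β ∧ ¬ ‖y‖ < 1) ↔ y = x := fun y => by
    rw [← Multiset.mem_singleton (a := x), ← hx, Multiset.mem_filter, hmem]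
  exact ⟨x, (h x).2 rfl, fun y hy => (h y).1 hy⟩

theorem finite_smallRoots (hd : 3 ≤ d) (hcd : ¬ q ∣ c * d) (hq : q ∣ d - 1) (n : ℕ) :
    (smallRoots q d c n).Finite ∧ (smallRoots q d c n).ncard ≤ (d - 1) ^ n := by
  classical
  induction n with
  | zero => exact ⟨Set.finite_singleton _, (Set.ncard_singleton _).le⟩
  | succ n ih =>
    set t : PadicAlgCl q → Finset (PadicAlgCl q) := fun β =>
      ((((phiDC d c).map (algebraMap ℤ (PadicAlgCl q)) - C β).roots).filter
        (‖·‖ < 1)).toFinset with ht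
    have hsub : smallRoots q d c (n + 1) ⊆ (ih.1.toFinset.biUnion t : Finset (PadicAlgCl q)) := by
      rintro z ⟨hz, hlt⟩
      obtain ⟨-, -, hmem, -⟩ := roots_fiberPoly (c := c) hd (aeval z (phiDC d c))
      rw [Finset.mem_coe, Finset.mem_biUnion]
      refine ⟨_, ih.1.mem_toFinset.2 hz, ?_⟩
      rw [Multiset.mem_toFinset, Multiset.mem_filter, hmem]
      exact ⟨rfl, hlt⟩
    refine ⟨(Finset.finite_toSet _).subset hsub,
      (Set.ncard_le_ncard hsub (Finset.finite_toSet _)).trans ?_⟩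
    rw [Set.ncard_coe_finset, pow_succ]
    refine (Finset.card_biUnion_le_card_mul _ _ (d - 1) fun β hβ => ?_).trans
      (Nat.mul_le_mul_right _ ?_)
    · exact (Multiset.toFinset_card_le _).trans
        (card_filter_norm_lt_one hd hcd hq (ih.1.mem_toFinset.1 hβ)).le
    · rw [← Set.ncard_eq_toFinset_card _ ih.1]
      exact ih.2

theorem algEquiv_mem_smallRoots (τ : PadicAlgCl q ≃ₐ[ℚ_[q]] PadicAlgCl q) :
    ∀ {n : ℕ} {z : PadicAlgCl q}, z ∈ smallRoots q d c n → τ z ∈ smallRoots q d c n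
  | 0, z, h => by rw [show z = 0 from h, map_zero]; rfl
  | n + 1, z, h => by
    refine ⟨?_, ?_⟩
    · have h1 := aeval_int_ringHom (τ : PadicAlgCl q →+* PadicAlgCl q) (phiDC d c) z
      exact h1 ▸ algEquiv_mem_smallRoots τ h.1
    · rw [← PadicAlgCl.spectralNorm_eq, ← spectralNorm_eq_of_equiv]
      exact h.2

theorem pow_dvd_natDegree_minpoly (hd : 3 ≤ d) (hcd : ¬ q ∣ c * d) (hq : q ∣ d - 1)
    (hgcd : Nat.gcd (d - 1) ((d - 1).factorization q) = 1) {n : ℕ} (hn : 1 ≤ n)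
    {z : PadicAlgCl q} (hz : z ∈ smallRoots q d c n) :
    (d - 1) ^ n ∣ (minpoly ℚ_[q] z).natDegree := by
  have hq1 : 1 < (q : ℝ) := by exact_mod_cast (Fact.out : q.Prime).one_lt
  have h1 := (norm_sub_pow_of_mem_smallRoots hd hcd hq hz).2 hn
  have h0 := (norm_natCast_mul_sub_one (q := q) hd
    (fun h => hcd (h.mul_right d) : ¬ q ∣ c) hq).1
  set k := (minpoly ℚ_[q] z).natDegree with hk
  set a := (minpoly ℚ_[q] z).coeff 0 with ha
  have hint := Algebra.IsIntegral.isIntegral (R := ℚ_[q]) z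
  have hk0 : k ≠ 0 := (minpoly.natDegree_pos hint).ne'
  have h2 : ‖z‖ ^ k = ‖a‖ := by
    rw [← PadicAlgCl.spectralNorm_eq, spectralNorm.spectralNorm_eq_norm_coeff_zero_rpow,
      one_div, Real.rpow_inv_natCast_pow (norm_nonneg _) hk0]
  have hz0 : z ≠ 0 := by
    rintro rfl
    rw [norm_zero, zero_pow (pow_ne_zero _ (by omega))] at h1
    exact h0.ne h1
  have ha0 : a ≠ 0 := minpoly.coeff_zero_ne_zero hint hz0
  have hr : ‖((c * (d - 1) : ℕ) : PadicAlgCl q)‖ =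
      (q : ℝ) ^ (-((d - 1).factorization q : ℤ)) := by
    rw [Nat.cast_mul, norm_mul, norm_natCast_padicAlgCl c, Padic.norm_natCast_eq_one_iff.2
      ((Nat.Prime.coprime_iff_not_dvd Fact.out).2 fun h => hcd (h.mul_right d)), one_mul,
      norm_natCast_padicAlgCl, Padic.norm_eq_zpow_neg_valuation (by
        exact_mod_cast (by omega : d - 1 ≠ 0)), Padic.valuation_natCast,
      Nat.factorization_def _ Fact.out]
  have h3 : (q : ℝ) ^ (-((d - 1).factorization q : ℤ) * k) =
      (q : ℝ) ^ (-a.valuation * ((d - 1) ^ n : ℕ)) := by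
    rw [zpow_mul, zpow_mul, ← hr, ← h1, zpow_natCast, zpow_natCast, ← pow_mul, mul_comm, pow_mul,
      h2, Padic.norm_eq_zpow_neg_valuation ha0]
  have h4 := zpow_right_injective₀ (by linarith) hq1.ne' h3
  have h5 : (((d - 1) ^ n : ℕ) : ℤ) ∣ ((d - 1).factorization q * k : ℕ) :=
    ⟨a.valuation, by push_cast at h4 ⊢; linarith⟩
  exact (Nat.Coprime.pow_left n hgcd).dvd_of_dvd_mul_left (Int.natCast_dvd_natCast.1 h5)

/-- The absolute Galois group of `ℚ_[q]` permutes the small roots transitively. -/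
theorem exists_algEquiv_smallRoots (hd : 3 ≤ d) (hcd : ¬ q ∣ c * d) (hq : q ∣ d - 1)
    (hgcd : Nat.gcd (d - 1) ((d - 1).factorization q) = 1) {n : ℕ} (hn : 1 ≤ n)
    {z w : PadicAlgCl q} (hz : z ∈ smallRoots q d c n) (hw : w ∈ smallRoots q d c n) :
    ∃ τ : PadicAlgCl q ≃ₐ[ℚ_[q]] PadicAlgCl q, τ z = w := by
  have hint := Algebra.IsIntegral.isIntegral (R := ℚ_[q]) z
  obtain ⟨hfin, hcard⟩ := finite_smallRoots (c := c) hd hcd hq n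
  have hsub : (minpoly ℚ_[q] z).rootSet (PadicAlgCl q) ⊆ smallRoots q d c n := fun y hy => by
    obtain ⟨τ, rfl⟩ := minpoly.exists_algEquiv_of_root hint.isAlgebraic
      (aeval_eq_zero_of_mem_rootSet hy)
    simpa using algEquiv_mem_smallRoots τ.symm hz
  have h1 : ((minpoly ℚ_[q] z).rootSet (PadicAlgCl q)).ncard = (minpoly ℚ_[q] z).natDegree := by
    rw [Set.ncard_eq_toFinset_card', Set.toFinset_card]
    exact card_rootSet_eq_natDegree (minpoly.irreducible hint).separable (IsAlgClosed.splits _)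
  have h2 := Set.eq_of_subset_of_ncard_le hsub (by
    rw [h1]
    exact hcard.trans (Nat.le_of_dvd (minpoly.natDegree_pos hint)
      (pow_dvd_natDegree_minpoly hd hcd hq hgcd hn hz))) hfin
  obtain ⟨τ, h⟩ := minpoly.exists_algEquiv_of_root hint.isAlgebraic
    (aeval_eq_zero_of_mem_rootSet (h2.ge hw))
  exact ⟨τ.symm, by rw [← h, τ.symm_apply_apply]⟩

end SmallRoots

theorem exists_algEquiv_of_ringEquiv {Ω P : Type*} [Field Ω] [CharZero Ω] [IsAlgClosed Ω]
    [Algebra.IsAlgebraic ℚ Ω] [Field P] [CharZero P] (ι : Ω →+* P) (τ : P ≃+* P) :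
    ∃ σ : Ω ≃ₐ[ℚ] Ω, ∀ z, ι (σ z) = τ (ι z) := by
  have : Normal ℚ Ω := normal_iff.2 fun x =>
    ⟨Algebra.IsIntegral.isIntegral x, IsAlgClosed.splits _⟩
  let : Algebra Ω P := ι.toAlgebra
  let χ : P ≃ₐ[ℚ] P := AlgEquiv.ofRingEquiv (f := τ) fun r => by simp
  exact ⟨χ.restrictNormal Ω, fun z => χ.restrictNormal_commutes Ω z⟩

section SmallRootsTransfer

variable {q : ℕ} [Fact q.Prime] {d c : ℕ} {Ω : Type*} [Field Ω] [IsAlgClosed Ω]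
  (ι : Ω →+* PadicAlgCl q)

theorem exists_eq_of_aeval_phiDC_eq (hd : 3 ≤ d) {β : Ω} {z : PadicAlgCl q}
    (h : aeval z (phiDC d c) = ι β) : ∃ y : Ω, ι y = z ∧ aeval y (phiDC d c) = β := by
  have h0 := aeval_int_ringHom ι (phiDC d c)
  set f := (phiDC d c).map (algebraMap ℤ Ω) - C β with hf
  have hf0 : f ≠ 0 := by
    intro h1
    have h2 := congrArg natDegree h1
    rw [natDegree_sub_C, (monic_phiDC hd c).natDegree_map, natDegree_phiDC hd,
      natDegree_zero] at h2
    omega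
  have h1 : (f.map ι).IsRoot z := by
    rw [IsRoot.def, hf, Polynomial.map_sub, map_C, eval_sub, eval_C, Polynomial.map_map,
      Subsingleton.elim (ι.comp (algebraMap ℤ Ω)) (algebraMap ℤ (PadicAlgCl q)),
      eval_map_algebraMap, h, sub_self]
  obtain ⟨y, rfl⟩ := (IsAlgClosed.splits f).mem_range_of_isRoot hf0 h1
  exact ⟨y, rfl, ι.injective (by rw [← h0, h])⟩

variable [CharZero Ω]

theorem exists_mem_iterRoots_mem_smallRoots (hd : 3 ≤ d) (hcd : ¬ q ∣ c * d) (hq : q ∣ d - 1)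
    (n : ℕ) : ∃ β ∈ iterRoots Ω (phiDC d c) n, ι β ∈ smallRoots q d c n := by
  have hφ := monic_phiDC hd c
  have hdeg : (phiDC d c).natDegree ≠ 0 := by rw [natDegree_phiDC hd]; omega
  induction n with
  | zero => exact ⟨0, (mem_iterRoots hφ hdeg).2 (by simp [polyIter]), map_zero ι⟩
  | succ n ih =>
    classical
    obtain ⟨β, hβ, hβ'⟩ := ih
    have h1 := card_filter_norm_lt_one hd hcd hq hβ'
    obtain ⟨-, -, hmem, -⟩ := roots_fiberPoly (c := c) hd (ι β)
    obtain ⟨z, hz⟩ := Multiset.card_pos_iff_exists_mem.1 (h1.symm ▸ (by omega : 0 < d - 1))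
    rw [Multiset.mem_filter, hmem] at hz
    obtain ⟨y, rfl, hy⟩ := exists_eq_of_aeval_phiDC_eq ι hd hz.1
    exact ⟨y, (aeval_mem_iterRoots hφ hdeg).1 (hy.symm ▸ hβ), hz.1.symm ▸ hβ', hz.2⟩

variable [Algebra.IsAlgebraic ℚ Ω]

/-- If `q ∣ d - 1` and `d - 1` is coprime to its `q`-adic valuation, a single nontrivial fiber swap
generates all of them. -/
theorem fiberSwap_of_dvd_sub_one (hd : 3 ≤ d) (hq : q ∣ d - 1)
    (hgcd : Nat.gcd (d - 1) ((d - 1).factorization q) = 1) (hc : Nat.gcd c (d - 1) = 1) {n : ℕ}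
    (hirr : Irreducible ((polyIter (phiDC d c) (n + 1)).map (algebraMap ℤ ℚ))) {x y : Ω}
    (hx : x ∈ iterRoots Ω (phiDC d c) (n + 1)) (hxy : x ≠ y)
    (hF : aeval x (phiDC d c) = aeval y (phiDC d c))
    (h : FiberSwap (phiDC d c) n x y) {a b : Ω} (ha : a ∈ iterRoots Ω (phiDC d c) (n + 1))
    (hab : aeval a (phiDC d c) = aeval b (phiDC d c)) : FiberSwap (phiDC d c) n a b := by
  have hqp : q.Prime := Fact.out
  have hcd : ¬ q ∣ c * d := fun h1 => by
    rcases hqp.dvd_mul.1 h1 with h2 | h2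
    · exact hqp.one_lt.ne' (Nat.dvd_one.1 (hc ▸ Nat.dvd_gcd h2 hq))
    · exact hqp.one_lt.ne' (Nat.dvd_one.1 (by
        simpa [Nat.sub_sub_self (by omega : 1 ≤ d)] using Nat.dvd_sub h2 hq))
  have hφ := monic_phiDC hd c
  have hdeg : (phiDC d c).natDegree ≠ 0 := by rw [natDegree_phiDC hd]; omega
  let : Algebra ℚ (PadicAlgCl q) := DivisionRing.toRatAlgebra
  let ι : Ω →+* PadicAlgCl q := (IsAlgClosed.lift (R := ℚ) : Ω →ₐ[ℚ] PadicAlgCl q)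
  have hι := aeval_int_ringHom ι (phiDC d c)
  obtain ⟨β, hβ, hβ'⟩ := exists_mem_iterRoots_mem_smallRoots ι hd hcd hq n
  obtain ⟨z, ⟨hz, hz1⟩, huniq⟩ := exists_unique_aeval_eq_not_norm_lt_one hd hcd hq hβ'
  obtain ⟨u, rfl, hu⟩ := exists_eq_of_aeval_phiDC_eq ι hd hz
  have hu' : u ∈ iterRoots Ω (phiDC d c) (n + 1) :=
    (aeval_mem_iterRoots hφ hdeg).1 (hu.symm ▸ hβ)
  have hsmall : ∀ w, aeval w (phiDC d c) = β → w ≠ u → ι w ∈ smallRoots q d c (n + 1) :=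
    fun w hw hwu => by
      have h1 : aeval (ι w) (phiDC d c) = ι β := by rw [hι, hw]
      refine ⟨h1.symm ▸ hβ', ?_⟩
      by_contra h2
      exact hwu (ι.injective (huniq _ ⟨h1, h2⟩))
  obtain ⟨γ, rfl⟩ := exists_algEquiv_of_mem_iterRoots hφ hdeg hirr hx hu'
  have hw := h.map hφ hdeg γ
  have hwF : aeval (γ y) (phiDC d c) = β := by
    rw [aeval_int_algEquiv, ← hF, ← aeval_int_algEquiv, hu]
  refine fiberSwap_of_fiber hφ hdeg hirr hu' (fun w' hw' => ?_) ha hab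
  by_cases hne : w' = γ x
  · rw [hne]
    exact .refl n _
  rw [hu] at hw'
  obtain ⟨τ, hτ⟩ := exists_algEquiv_smallRoots hd hcd hq hgcd n.succ_pos
    (hsmall _ hwF fun h1 => hxy (γ.injective h1.symm)) (hsmall _ hw' hne)
  obtain ⟨σ, hσ⟩ := exists_algEquiv_of_ringEquiv ι (τ : PadicAlgCl q ≃+* PadicAlgCl q)
  have h1 : σ (γ y) = w' := ι.injective (by rw [hσ]; exact hτ)
  have h2 : σ (γ x) = γ x := by
    refine ι.injective (huniq _ ⟨?_, ?_⟩)
    · have h3 : σ β = β := by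
        conv_lhs => rw [← hwF, ← aeval_int_algEquiv, h1, hw']
      rw [hι, aeval_int_algEquiv, hu, h3]
    · rw [hσ]
      refine fun h3 => hz1 ?_
      rwa [← PadicAlgCl.spectralNorm_eq, spectralNorm_eq_of_equiv τ]
  have h3 := hw.map hφ hdeg σ
  rwa [h1, h2] at h3

end SmallRootsTransfer

/-- A single nontrivial fiber swap forces the relative Galois group of `φ_{(d,c)}` at that level to
have maximal order. -/
theorem card_relGal_phiDC {Ω : Type*} [Field Ω] [CharZero Ω] [IsAlgClosed Ω]
    [Algebra.IsAlgebraic ℚ Ω] {d c n : ℕ} (hd : 3 ≤ d)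
    (hcase : d.Prime ∨ ∃ q : ℕ, q.Prime ∧ q ∣ (d - 1) ∧
      Nat.gcd (d - 1) ((d - 1).factorization q) = 1)
    (hirr : ∀ n : ℕ, 1 ≤ n → Irreducible ((polyIter (phiDC d c) n).map (algebraMap ℤ ℚ)))
    (hc : Nat.gcd c (d - 1) = 1)
    (h : ∃ x y : Ω, x ∈ iterRoots Ω (phiDC d c) (n + 1) ∧ x ≠ y ∧
      aeval x (phiDC d c) = aeval y (phiDC d c) ∧ FiberSwap (phiDC d c) n x y) :
    Nat.card {σ : iterField Ω (phiDC d c) (n + 1) ≃ₐ[ℚ] iterField Ω (phiDC d c) (n + 1) //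
      ∀ (x : Ω) (_ : x ∈ iterField Ω (phiDC d c) n) (hx' : x ∈ iterField Ω (phiDC d c) (n + 1)),
        σ ⟨x, hx'⟩ = ⟨x, hx'⟩} = d.factorial ^ d ^ n := by
  have hφ := monic_phiDC hd c
  have hdeg := natDegree_phiDC hd c
  obtain ⟨x, y, hx, hxy, hF, hswap⟩ := h
  have hirr' : Irreducible ((polyIter (phiDC d c) n).map (algebraMap ℤ ℚ)) := by
    rcases n.eq_zero_or_pos with rfl | hn
    · rw [polyIter, map_X]
      exact irreducible_X
    · exact hirr n hn
  rw [card_relGal_of_fiberSwap hφ (by omega) hirr' (hirr _ n.succ_pos), hdeg]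
  intro a b ha hab
  rcases hcase with hp | ⟨q, hq, hqd, hgcd⟩
  · exact fiberSwap_of_prime hφ (hdeg.symm ▸ hp) (hirr _ n.succ_pos) hx hxy hF hswap ha hab
  · have : Fact q.Prime := ⟨hq⟩
    exact fiberSwap_of_dvd_sub_one hd hqd hgcd hc (hirr _ n.succ_pos) hx hxy hF hswap ha hab

theorem card_relGal_adjoin_eq {Ω : Type*} [Field Ω] [CharZero Ω] [I : Algebra ℤ Ω]
    [A : Algebra ℚ Ω] (φ : ℤ[X]) (n : ℕ) :
    Nat.card {σ : IntermediateField.adjoin ℚ ((polyIter φ (n + 1)).rootSet Ω) ≃ₐ[ℚ]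
        IntermediateField.adjoin ℚ ((polyIter φ (n + 1)).rootSet Ω) //
      ∀ (x : Ω) (_ : x ∈ IntermediateField.adjoin ℚ ((polyIter φ n).rootSet Ω))
        (hx' : x ∈ IntermediateField.adjoin ℚ ((polyIter φ (n + 1)).rootSet Ω)),
          σ ⟨x, hx'⟩ = ⟨x, hx'⟩} =
    Nat.card {σ : iterField Ω φ (n + 1) ≃ₐ[ℚ] iterField Ω φ (n + 1) //
      ∀ (x : Ω) (_ : x ∈ iterField Ω φ n) (hx' : x ∈ iterField Ω φ (n + 1)),
        σ ⟨x, hx'⟩ = ⟨x, hx'⟩} := by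
  obtain rfl : I = Ring.toIntAlgebra Ω := Subsingleton.elim _ _
  obtain rfl : A = DivisionRing.toRatAlgebra := Subsingleton.elim _ _
  rfl

theorem relGalCard_succ_eq (φ : ℤ[X]) (n : ℕ) : relGalCard φ (n + 1) =
    Nat.card {σ : iterField (AlgebraicClosure ℚ) φ (n + 1) ≃ₐ[ℚ]
        iterField (AlgebraicClosure ℚ) φ (n + 1) //
      ∀ (x : AlgebraicClosure ℚ) (_ : x ∈ iterField (AlgebraicClosure ℚ) φ n)
        (hx' : x ∈ iterField (AlgebraicClosure ℚ) φ (n + 1)), σ ⟨x, hx'⟩ = ⟨x, hx'⟩} :=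
  card_relGal_adjoin_eq φ n

theorem isAlgebraic_toRatAlgebra {Ω : Type*} [Field Ω] [CharZero Ω] [A : Algebra ℚ Ω]
    [Algebra.IsAlgebraic ℚ Ω] :
    @Algebra.IsAlgebraic ℚ Ω _ _ DivisionRing.toRatAlgebra := by
  obtain rfl : A = DivisionRing.toRatAlgebra := Subsingleton.elim _ _
  assumption

/-- Fix `d ≥ 3` which is prime or such that some prime `q ∣ d-1` satisfies
`gcd(d-1, v_q(d-1)) = 1`, and assume the Vojta-type hypothesis. Let
`φ_{(d,c)}(x) = x^d - cd·x^{d-1} + c(d-1)` and let `B_d` be the set of positive integers `c`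
such that all iterates `φ_{(d,c)}^n` are irreducible over `ℚ` and `gcd(c, d-1) = 1`. Then for
all but finitely many `c ∈ B_d`, the extension `K_n/K_{n-1}` is maximal for every `n ≥ 1`,
i.e. `Gal(K_n/K_{n-1})` has order `(d!)^(d^(n-1))` for every `n ≥ 1` (equivalently, the
arboreal Galois representation of `φ_{(d,c)}` over `ℚ` is surjective). -/
theorem stmt_3 (d : ℕ) (hd : 3 ≤ d)
    (hcase : d.Prime ∨ ∃ q : ℕ, q.Prime ∧ q ∣ (d - 1) ∧
      Nat.gcd (d - 1) ((d - 1).factorization q) = 1)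
    (hVojta : ∃ C₁ C₂ : ℝ, ∀ f : Polynomial ℤ, f.natDegree = d →
      Squarefree (f.map (algebraMap ℤ ℚ)) →
      ∀ x y : ℤ, y ^ 2 = f.eval x →
        Real.log (max 1 |(x : ℝ)|) ≤ C₁ * intPolyHeight f + C₂) :
    {c : ℕ | (0 < c ∧
        (∀ n : ℕ, 1 ≤ n → Irreducible ((polyIter (phiDC d c) n).map (algebraMap ℤ ℚ))) ∧
        Nat.gcd c (d - 1) = 1) ∧
      ¬ (∀ n : ℕ, 1 ≤ n →
        relGalCard (phiDC d c) n = (Nat.factorial d) ^ (d ^ (n - 1)))}.Finite := by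
  obtain ⟨B, hB, hgood⟩ := exists_finite_forall_exists_isGoodPrime hd hVojta
  refine hB.subset fun c ⟨⟨hc0, hirr, hc⟩, hne⟩ => ?_
  by_contra hcB
  refine hne fun n hn => ?_
  obtain ⟨n, rfl⟩ := Nat.exists_eq_add_of_le' hn
  have := isAlgebraic_toRatAlgebra (Ω := AlgebraicClosure ℚ)
    (A := AlgebraicClosure.instAlgebra ℚ)
  rw [relGalCard_succ_eq, Nat.add_sub_cancel]
  refine card_relGal_phiDC hd hcase hirr hc ?_
  by_cases h : d ≠ 3 ∨ n + 2 ≠ 2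
  · obtain ⟨p, hp⟩ := hgood c hcB hc0 hirr (n + 2) (by omega) h
    exact exists_fiberSwap_of_isGoodPrime hd (hirr _ n.succ_pos) hp
  · obtain ⟨rfl, rfl⟩ : d = 3 ∧ n = 0 := by omega
    exact exists_fiberSwap_cubic hc0 (hirr 1 le_rfl)
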